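/- Let q ∈ [1,∞] and let B^q = {x ∈ ℝ^d : (Σ_{k=1}^d |x_k|^q)^{1/q} ≤ 1} (with B^∞ = {x : max_k |x_k| ≤ 1}). For every p ∈ (1, ∞] there is a constant C_{p,q} > 0 independent of the dimension d such that for all f ∈ ℓ^p(ℤ^d) one has ‖ sup_{t ≥ d^{1+1/q}} |𝓜_t^{B^q} f| ‖_{ℓ^p(ℤ^d)} ≤ C_{p,q} ‖f‖_{ℓ^p(ℤ^d)}. -/

import Mathlib

open MeasureTheory ENNReal

/-- The ℓ^p(ℤ^d) "norm" of a nonnegative (ℝ≥0∞-valued) function, `p ∈ (0,∞]`. -/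
noncomputable def lpZ (d : ℕ) (p : ℝ≥0∞) (g : (Fin d → ℤ) → ℝ≥0∞) : ℝ≥0∞ :=
  if p = ∞ then ⨆ x, g x else (∑' x, g x ^ p.toReal) ^ (1 / p.toReal)

/-- `x ↦ ‖f x‖₊` as an ℝ≥0∞-valued function. -/
noncomputable def nnC {d : ℕ} (f : (Fin d → ℤ) → ℂ) : (Fin d → ℤ) → ℝ≥0∞ :=
  fun x => (‖f x‖₊ : ℝ≥0∞)

/-- The lattice points of the dilate `G_t = t • G`. -/
def latticeSet (d : ℕ) (G : Set (Fin d → ℝ)) (t : ℝ) : Set (Fin d → ℤ) :=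
  {y | t⁻¹ • (fun i => (y i : ℝ)) ∈ G}

/-- The discrete Hardy–Littlewood averaging operator `𝓜_t^G`. -/
noncomputable def discAvg (d : ℕ) (G : Set (Fin d → ℝ)) (t : ℝ)
    (f : (Fin d → ℤ) → ℂ) (x : Fin d → ℤ) : ℂ :=
  ((latticeSet d G t).ncard : ℂ)⁻¹ * ∑' y : latticeSet d G t, f (x - ↑y)

/-- The unit ball `B^q` of the `ℓ^q` norm on ℝ^d, `q ∈ [1,∞]`. -/
noncomputable def qBall (d : ℕ) (q : ℝ≥0∞) : Set (Fin d → ℝ) :=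
  if q = ∞ then {x | ∀ k, |x k| ≤ 1} else {x | ∑ k, |x k| ^ q.toReal ≤ 1}



noncomputable def NN {X E : Type*} [Fintype X] [NormedAddCommGroup E] (p : ℝ) (f : X → E) : ℝ :=
  (∑ x, ‖f x‖ ^ p) ^ (1 / p)

namespace Real
open scoped Real
open Finset (Icc Ico card_range card_univ coe_filter cons_induction le_sup' mem_Icc mem_coe mem_filter mem_range mem_univ mul_sum prod_congr prod_cons prod_le_one prod_mul_distrib prod_univ_sum range range_mono single_le_sum subset_univ sum_add_distrib sum_comm sum_congr sum_cons sum_const sum_div sum_eq_single sum_filter sum_image sum_insert sum_le_sum sum_le_sum_of_subset_of_nonneg sum_mul sum_mul_sum sum_nonneg sum_range_add sum_range_sub' sum_range_succ sum_range_succ' sum_sub_distrib univ)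
open Complex (I abs_re_le_norm add_re cos_ofReal_re exp_mul_I mul_conj normSq_apply normSq_eq_norm_sq norm_I norm_cpow_eq_rpow_re_of_pos norm_exp norm_exp_ofReal_mul_I norm_real ofReal_sum one_re re re_add_im re_ofReal_mul sin_ofReal_re sub_re)

section NNbasic
variable {X Y E : Type*} [Fintype X] [Fintype Y] [NormedAddCommGroup E]

theorem NN_sum_nonneg (p : ℝ) (f : X → E) : 0 ≤ ∑ x, ‖f x‖ ^ p :=
  sum_nonneg fun _ _ => rpow_nonneg (norm_nonneg _) _

theorem NN_nonneg (p : ℝ) (f : X → E) : 0 ≤ NN p f := rpow_nonneg (NN_sum_nonneg p f) _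

theorem NN_pow {p : ℝ} (hp : 0 < p) (f : X → E) : NN p f ^ p = ∑ x, ‖f x‖ ^ p := by
  unfold NN
  rw [← rpow_mul (NN_sum_nonneg p f), one_div, inv_mul_cancel₀ hp.ne', rpow_one]

theorem NN_le_of_sum {p : ℝ} (hp : 0 < p) {f : X → E} {B : ℝ} (hB : 0 ≤ B)
    (h : ∑ x, ‖f x‖ ^ p ≤ B ^ p) : NN p f ≤ B := by
  rw [← NN_pow hp] at h
  exact (rpow_le_rpow_iff (NN_nonneg _ _) hB hp).1 h

theorem NN_sum_le_of {p : ℝ} (hp : 0 < p) {f : X → E} {B : ℝ}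
    (h : NN p f ≤ B) : ∑ x, ‖f x‖ ^ p ≤ B ^ p := by
  rw [← NN_pow hp]
  exact rpow_le_rpow (NN_nonneg _ _) h hp.le

theorem NN_mono {F : Type*} [NormedAddCommGroup F] {p : ℝ} (hp : 0 < p) {f : X → E} {g : X → F}
    (h : ∀ x, ‖f x‖ ≤ ‖g x‖) : NN p f ≤ NN p g := by
  apply NN_le_of_sum hp (NN_nonneg _ _)
  rw [NN_pow hp]
  exact sum_le_sum fun x _ => rpow_le_rpow (norm_nonneg _) (h x) hp.le

theorem NN_mono' {p : ℝ} (hp : 0 < p) {f : X → E} {g : X → ℝ}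
    (h : ∀ x, ‖f x‖ ≤ g x) : NN p f ≤ NN p g :=
  NN_mono hp fun x => (h x).trans (le_abs_self _)

theorem NN_congr {F : Type*} [NormedAddCommGroup F] {p : ℝ} {f : X → E} {g : X → F}
    (h : ∀ x, ‖f x‖ = ‖g x‖) : NN p f = NN p g := by
  unfold NN; simp only [h]

theorem NN_norm (p : ℝ) (f : X → E) : NN p (fun x => ‖f x‖) = NN p f :=
  NN_congr (by simp)

theorem NN_zero {p : ℝ} (hp : 0 < p) : NN p (fun _ : X => (0 : E)) = 0 := by
  unfold NN; simp [hp.ne']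

theorem NN_add_le {p : ℝ} (hp : 1 ≤ p) (f g : X → E) :
    NN p (fun x => f x + g x) ≤ NN p f + NN p g := by
  have h0 : 0 < p := by linarith
  calc NN p (fun x => f x + g x) ≤ NN p (fun x => ‖f x‖ + ‖g x‖) :=
        NN_mono' h0 fun x => norm_add_le _ _
    _ ≤ _ := by
        unfold NN
        have := Lp_add_le (univ) (fun x => ‖f x‖) (fun x => ‖g x‖) hp
        simpa using this

theorem NN_sum_le {ι : Type*} {p : ℝ} (hp : 1 ≤ p) (s : Finset ι) (f : ι → X → E) :
    NN p (fun x => ∑ i ∈ s, f i x) ≤ ∑ i ∈ s, NN p (f i) := by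
  classical
  induction s using Finset.induction_on with
  | empty => simp [NN_zero (by linarith : 0 < p)]
  | insert a s ha ih =>
    simp only [sum_insert ha]
    exact (NN_add_le hp _ _).trans (by linarith)

theorem NN_neg (p : ℝ) (f : X → E) : NN p (fun x => - f x) = NN p f := NN_congr (by simp)

theorem NN_sub_le {p : ℝ} (hp : 1 ≤ p) (f g : X → E) :
    NN p (fun x => f x - g x) ≤ NN p f + NN p g := by
  have := NN_add_le hp f (fun x => - g x)
  rw [NN_neg] at this
  simpa [sub_eq_add_neg] using this

theorem NN_const_mul {𝕜 : Type*} [NormedField 𝕜] {p : ℝ} (hp : 0 < p) (c : 𝕜) (f : X → 𝕜) :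
    NN p (fun x => c * f x) = ‖c‖ * NN p f := by
  unfold NN
  simp only [norm_mul, mul_rpow (norm_nonneg _) (norm_nonneg _), ← mul_sum]
  rw [mul_rpow (by positivity) (NN_sum_nonneg p f), ← rpow_mul (norm_nonneg _),
    mul_one_div_cancel hp.ne', rpow_one]

theorem NN_equiv (e : Y ≃ X) (p : ℝ) (f : X → E) : NN p (fun y => f (e y)) = NN p f := by
  unfold NN; rw [Equiv.sum_comp e (fun x => ‖f x‖ ^ p)]

theorem NN_two_sq (f : X → E) : NN 2 f ^ 2 = ∑ x, ‖f x‖ ^ 2 := by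
  have := NN_pow (p := 2) (by norm_num) f
  simpa using this

theorem le_NN {p : ℝ} (hp : 0 < p) (f : X → E) (x : X) : ‖f x‖ ≤ NN p f := by
  have : ‖f x‖ ^ p ≤ NN p f ^ p := by
    rw [NN_pow hp]
    exact single_le_sum (f := fun x => ‖f x‖ ^ p)
      (fun i _ => rpow_nonneg (norm_nonneg _) _) (mem_univ x)
  exact (rpow_le_rpow_iff (norm_nonneg _) (NN_nonneg _ _) hp).1 this

end NNbasic

def cv {G R : Type*} [Fintype G] [AddCommGroup G] [CommRing R] (K f : G → R) (x : G) : R :=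
  ∑ y, K y * f (x - y)

section cvbasic
variable {G : Type*} [Fintype G] [AddCommGroup G]

theorem NN_shift {E : Type*} [NormedAddCommGroup E] (p : ℝ) (f : G → E) (y : G) :
    NN p (fun x => f (x - y)) = NN p f := NN_equiv (Equiv.subRight y) p f

theorem NN_cv_le {𝕜 : Type*} [NormedField 𝕜] {p : ℝ} (hp : 1 ≤ p) (K f : G → 𝕜) :
    NN p (cv K f) ≤ (∑ y, ‖K y‖) * NN p f := by
  have h0 : 0 < p := by linarith
  calc NN p (cv K f) ≤ ∑ y, NN p (fun x => K y * f (x - y)) :=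
        NN_sum_le hp univ (fun y x => K y * f (x - y))
    _ = _ := by
      rw [sum_mul]
      refine sum_congr rfl fun y _ => ?_
      rw [NN_const_mul h0, NN_shift]

theorem cv_comm {R : Type*} [CommRing R] (K f : G → R) : cv K f = cv f K := by
  ext x
  unfold cv
  rw [← Equiv.sum_comp (Equiv.subLeft x)]
  refine sum_congr rfl fun y _ => ?_
  simp [mul_comm]

theorem cv_assoc {R : Type*} [CommRing R] (K L f : G → R) : cv (cv K L) f = cv K (cv L f) := by
  ext x
  unfold cv
  simp only [sum_mul, mul_sum]
  rw [sum_comm]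
  refine sum_congr rfl fun y _ => ?_
  rw [← Equiv.sum_comp (Equiv.addRight y)]
  refine sum_congr rfl fun z _ => ?_
  simp only [Equiv.coe_addRight, add_sub_cancel_right]
  rw [sub_sub x y z, add_comm z y]; ring

theorem cv_add {R : Type*} [CommRing R] (K f g : G → R) (x : G) :
    cv K (fun y => f y + g y) x = cv K f x + cv K g x := by
  simp [cv, mul_add, sum_add_distrib]
theorem cv_sub_left {R : Type*} [CommRing R] (K L f : G → R) (x : G) :
    cv (fun y => K y - L y) f x = cv K f x - cv L f x := by
  simp [cv, sub_mul, sum_sub_distrib]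
theorem cv_smul {R : Type*} [CommRing R] (c : R) (K f : G → R) (x : G) :
    cv K (fun y => c * f y) x = c * cv K f x := by
  simp only [cv, mul_sum]; exact sum_congr rfl fun _ _ => by ring
theorem cv_smul_left {R : Type*} [CommRing R] (c : R) (K f : G → R) (x : G) :
    cv (fun y => c * K y) f x = c * cv K f x := by
  simp only [cv, mul_sum]; exact sum_congr rfl fun _ _ => by ring
theorem cv_sum {R ι : Type*} [CommRing R] (s : Finset ι) (K : G → R) (f : ι → G → R) (x : G) :
    cv K (fun y => ∑ i ∈ s, f i y) x = ∑ i ∈ s, cv K (f i) x := by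
  simp only [cv, mul_sum]; exact sum_comm
theorem cv_sum_left {R ι : Type*} [CommRing R] (s : Finset ι) (K : ι → G → R) (f : G → R) (x : G) :
    cv (fun y => ∑ i ∈ s, K i y) f x = ∑ i ∈ s, cv (K i) f x := by
  simp only [cv, sum_mul]; exact sum_comm

end cvbasic

theorem NN_dual {X : Type*} [Fintype X] {p p' : ℝ} (hpp : p.HolderConjugate p') (h : X → ℂ) {C : ℝ}
    (hC : 0 ≤ C) (H : ∀ g : X → ℂ, ‖∑ x, h x * g x‖ ≤ C * NN p' g) : NN p h ≤ C := by
  have hp0 : 0 < p := hpp.pos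
  have hp' : 0 < p' := hpp.symm.pos
  by_cases hz : NN p h = 0
  · rw [hz]; exact hC
  have hpos : 0 < NN p h := lt_of_le_of_ne (NN_nonneg _ _) (Ne.symm hz)
  set g : X → ℂ := fun x => (starRingEnd ℂ (h x)) * ((‖h x‖ ^ (p - 2) : ℝ) : ℂ) with hg
  have h1 : ∀ x, h x * g x = ((‖h x‖ ^ p : ℝ) : ℂ) := by
    intro x
    by_cases hx : h x = 0
    · simp [hg, hx, hp0.ne']
    · have hx' : 0 < ‖h x‖ := norm_pos_iff.2 hx
      simp only [hg]
      rw [← mul_assoc, mul_conj, normSq_eq_norm_sq, ← Complex.ofReal_mul]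
      congr 1
      rw [← rpow_natCast, ← rpow_add hx']
      congr 1; push_cast; ring
  have h2 : ∀ x, ‖g x‖ ^ p' = ‖h x‖ ^ p := by
    intro x
    by_cases hx : h x = 0
    · simp [hg, hx, hp0.ne', hp'.ne']
    · have hx' : 0 < ‖h x‖ := norm_pos_iff.2 hx
      have : ‖g x‖ = ‖h x‖ ^ (p - 1) := by
        simp only [hg, norm_mul, RCLike.norm_conj, norm_real, norm_eq_abs]
        rw [abs_of_nonneg (rpow_nonneg hx'.le _), show p - 1 = 1 + (p - 2) by ring,
          rpow_add hx', rpow_one]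
      rw [this, ← rpow_mul hx'.le]
      congr 1
      exact hpp.sub_one_mul_conj
  have h3 := H g
  simp only [h1] at h3
  rw [← ofReal_sum, norm_real, norm_eq_abs,
    abs_of_nonneg (NN_sum_nonneg p h), ← NN_pow hp0] at h3
  have h4 : NN p' g = NN p h ^ (p - 1) := by
    unfold NN
    simp only [h2]
    rw [← rpow_mul (NN_sum_nonneg p h)]
    congr 1
    have := hpp.sub_one_mul_conj
    field_simp
    linarith
  rw [h4] at h3
  have h5 : NN p h ^ p = NN p h * NN p h ^ (p - 1) := by
    rw [← rpow_one_add' hpos.le (by linarith [hp0])]; congr 1; ring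
  rw [h5] at h3
  exact le_of_mul_le_mul_right h3 (rpow_pos_of_pos hpos _)

theorem NN_holder {X : Type*} [Fintype X] {p p' : ℝ} (hpp : p.HolderConjugate p') (f g : X → ℂ) :
    ‖∑ x, f x * g x‖ ≤ NN p f * NN p' g := by
  calc ‖∑ x, f x * g x‖ ≤ ∑ x, ‖f x‖ * ‖g x‖ := by
        refine (norm_sum_le _ _).trans (le_of_eq (by simp))
    _ ≤ _ := by
        have := inner_le_Lp_mul_Lq univ (fun x => ‖f x‖) (fun x => ‖g x‖) hpp
        simpa [NN] using this

open Complex.HadamardThreeLines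

noncomputable def sgnpow (w : ℂ) (e : ℂ) : ℂ := if w = 0 then 0 else (w / ‖w‖) * (‖w‖ : ℂ) ^ e

theorem sgnpow_one (w : ℂ) : sgnpow w 1 = w := by
  unfold sgnpow
  split_ifs with h
  · exact h.symm
  · rw [Complex.cpow_one]; exact div_mul_cancel₀ _ (by simpa using h)

theorem norm_sgnpow (w e : ℂ) (he : e.re ≠ 0) : ‖sgnpow w e‖ = ‖w‖ ^ e.re := by
  unfold sgnpow
  split_ifs with h
  · simp [h, zero_rpow he]
  · have hw : 0 < ‖w‖ := norm_pos_iff.2 h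
    rw [norm_mul, norm_cpow_eq_rpow_re_of_pos hw]
    simp [hw.ne']

theorem sgnpow_diff (w : ℂ) {e : ℂ → ℂ} (he : Differentiable ℂ e) :
    Differentiable ℂ fun z => sgnpow w (e z) := by
  unfold sgnpow
  split_ifs with h
  · fun_prop
  · have hw : (‖w‖ : ℂ) ≠ 0 := by simpa using h
    exact (differentiable_const _).mul (he.const_cpow (Or.inl hw))

theorem sgnpow_bdd (w : ℂ) {e : ℂ → ℂ} {S : Set ℂ} {M : ℝ} (he : ∀ z ∈ S, |(e z).re| ≤ M) :
    ∃ B, ∀ z ∈ S, ‖sgnpow w (e z)‖ ≤ B := by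
  unfold sgnpow
  split_ifs with h
  · exact ⟨0, by simp⟩
  · have hw : 0 < ‖w‖ := norm_pos_iff.2 h
    refine ⟨exp (|log ‖w‖| * M), fun z hz => ?_⟩
    rw [norm_mul, norm_cpow_eq_rpow_re_of_pos hw]
    simp only [norm_div, norm_real, norm_norm, div_self hw.ne', one_mul]
    rw [rpow_def_of_pos hw]
    apply Real.exp_le_exp.2
    calc _ ≤ |log ‖w‖ * (e z).re| := le_abs_self _
      _ = |log ‖w‖| * |(e z).re| := abs_mul _ _
      _ ≤ _ := by gcongr; exact he z hz

theorem NN_sgnpow {X : Type*} [Fintype X] (f : X → ℂ) {p r : ℝ} (hp : 0 < p) (hr : 0 < r) (e : ℂ)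
    (he : e.re = p / r) : NN r (fun x => sgnpow (f x) e) = (NN p f) ^ (p / r) := by
  have hpos : 0 < p / r := by positivity
  unfold NN
  rw [← rpow_mul (NN_sum_nonneg p f)]
  have : ∀ x, ‖sgnpow (f x) e‖ ^ r = ‖f x‖ ^ p := by
    intro x
    rw [norm_sgnpow _ _ (by rw [he]; exact hpos.ne'), he, ← rpow_mul (norm_nonneg _)]
    congr 1; field_simp
  simp only [this]
  congr 1; field_simp

theorem stein {X Y : Type*} [Fintype X] [Fintype Y] (a : ℂ → X → Y → ℂ) {p0 p1 p θ B0 B1 : ℝ}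
    (hp0 : 1 < p0) (hp1 : 1 < p1) (hθ0 : 0 ≤ θ) (hθ1 : θ ≤ 1)
    (hp : 1 / p = (1 - θ) / p0 + θ / p1) (hB0 : 0 ≤ B0) (hB1 : 0 ≤ B1)
    (had : ∀ x y, DiffContOnCl ℂ (fun z => a z x y) (verticalStrip 0 1))
    (hab : ∀ x y, ∃ M, ∀ z ∈ verticalClosedStrip 0 1, ‖a z x y‖ ≤ M)
    (h0 : ∀ z : ℂ, z.re = 0 → ∀ f : Y → ℂ,
      NN p0 (fun x => ∑ y, a z x y * f y) ≤ B0 * NN p0 f)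
    (h1 : ∀ z : ℂ, z.re = 1 → ∀ f : Y → ℂ,
      NN p1 (fun x => ∑ y, a z x y * f y) ≤ B1 * NN p1 f) (f : Y → ℂ) :
    NN p (fun x => ∑ y, a θ x y * f y) ≤ B0 ^ (1 - θ) * B1 ^ θ * NN p f := by
  have hp0' : 0 < p0 := by linarith
  have hp1' : 0 < p1 := by linarith
  have hi0 : 1 / p0 < 1 := by rw [div_lt_one hp0']; exact hp0
  have hi1 : 1 / p1 < 1 := by rw [div_lt_one hp1']; exact hp1
  have hi0' : 0 < 1 / p0 := by positivity
  have hi1' : 0 < 1 / p1 := by positivity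
  have hip : 0 < 1 / p := by
    rw [hp, div_eq_mul_one_div, div_eq_mul_one_div θ]
    rcases eq_or_lt_of_le hθ0 with h | h
    · rw [← h]; simpa using hi0'
    · have : 0 ≤ (1 - θ) * (1 / p0) := mul_nonneg (by linarith) hi0'.le
      have : 0 < θ * (1 / p1) := by positivity
      linarith
  have hip1 : 1 / p < 1 := by
    rw [hp, div_eq_mul_one_div, div_eq_mul_one_div θ]
    rcases eq_or_lt_of_le hθ0 with h | h
    · rw [← h]; simpa using hi0
    · nlinarith
  have hp' : 0 < p := by simpa using hip
  have hp1p : 1 < p := by rwa [div_lt_one hp'] at hip1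
  set q0 := p0.conjExponent with hq0
  set q1 := p1.conjExponent with hq1
  set q := p.conjExponent with hq
  have c0 : p0.HolderConjugate q0 := Real.HolderConjugate.conjExponent hp0
  have c1 : p1.HolderConjugate q1 := Real.HolderConjugate.conjExponent hp1
  have c : p.HolderConjugate q := Real.HolderConjugate.conjExponent hp1p
  have e0 : 1 / q0 = 1 - 1 / p0 := by have := c0.inv_add_inv_eq_one; simp only [one_div]; linarith
  have e1 : 1 / q1 = 1 - 1 / p1 := by have := c1.inv_add_inv_eq_one; simp only [one_div]; linarith
  have e2 : 1 / q = 1 - 1 / p := by have := c.inv_add_inv_eq_one; simp only [one_div]; linarith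
  have hq' : 0 < q := c.symm.pos
  have hq0' : 0 < q0 := c0.symm.pos
  have hq1' : 0 < q1 := c1.symm.pos
  have hqq : 1 / q = (1 - θ) / q0 + θ / q1 := by
    rw [e2, div_eq_mul_one_div (1 - θ), e0, div_eq_mul_one_div θ, e1, hp]; ring
  refine NN_dual c _ (by have := NN_nonneg p f; positivity) fun g => ?_
  set ef : ℂ → ℂ := fun z => (p / p0 : ℝ) * (1 - z) + (p / p1 : ℝ) * z with hef
  set eg : ℂ → ℂ := fun z => (q / q0 : ℝ) * (1 - z) + (q / q1 : ℝ) * z with heg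
  have hefd : Differentiable ℂ ef := by simp only [hef]; fun_prop
  have hegd : Differentiable ℂ eg := by simp only [heg]; fun_prop
  have hefb : ∀ z ∈ verticalClosedStrip 0 1, |(ef z).re| ≤ p / p0 + p / p1 := by
    intro z hz
    simp only [verticalClosedStrip, Set.mem_preimage, Set.mem_Icc] at hz
    have a1 : 0 < p / p0 := by positivity
    have a2 : 0 < p / p1 := by positivity
    simp only [hef, add_re, re_ofReal_mul, sub_re, one_re]
    rw [abs_le]; constructor <;> nlinarith
  have hegb : ∀ z ∈ verticalClosedStrip 0 1, |(eg z).re| ≤ q / q0 + q / q1 := by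
    intro z hz
    simp only [verticalClosedStrip, Set.mem_preimage, Set.mem_Icc] at hz
    have a1 : 0 < q / q0 := by positivity
    have a2 : 0 < q / q1 := by positivity
    simp only [heg, add_re, re_ofReal_mul, sub_re, one_re]
    rw [abs_le]; constructor <;> nlinarith
  have efθ : ef θ = 1 := by
    simp only [hef]
    have : p / p0 * (1 - θ) + p / p1 * θ = 1 := by
      have : p * (1 / p) = 1 := by field_simp
      rw [hp] at this; linear_combination this
    exact_mod_cast congrArg (fun r : ℝ => (r : ℂ)) this
  have egθ : eg θ = 1 := by
    simp only [heg]
    have : q / q0 * (1 - θ) + q / q1 * θ = 1 := by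
      have : q * (1 / q) = 1 := by field_simp
      rw [hqq] at this; linear_combination this
    exact_mod_cast congrArg (fun r : ℝ => (r : ℂ)) this
  set Φ : ℂ → ℂ := fun z => ∑ x, (∑ y, a z x y * sgnpow (f y) (ef z)) * sgnpow (g x) (eg z) with hΦ
  have hd : DiffContOnCl ℂ Φ (verticalStrip 0 1) := by
    have key : ∀ x, DiffContOnCl ℂ (fun z => (∑ y, a z x y * sgnpow (f y) (ef z)) *
        sgnpow (g x) (eg z)) (verticalStrip 0 1) := by
      intro x
      have k1 : DiffContOnCl ℂ (fun z => ∑ y, a z x y * sgnpow (f y) (ef z)) (verticalStrip 0 1) := by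
        have : ∀ y, DiffContOnCl ℂ (fun z => a z x y * sgnpow (f y) (ef z)) (verticalStrip 0 1) :=
          fun y => (had x y).smul (sgnpow_diff (f y) hefd).diffContOnCl
        exact ⟨DifferentiableOn.fun_sum fun y _ => (this y).1, continuousOn_finsetSum _ fun y _ => (this y).2⟩
      exact k1.smul (sgnpow_diff (g x) hegd).diffContOnCl
    exact ⟨DifferentiableOn.fun_sum fun y _ => (key y).1, continuousOn_finsetSum _ fun y _ => (key y).2⟩
  have hbdd : BddAbove ((Norm.norm ∘ Φ) '' verticalClosedStrip 0 1) := by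
    choose Ma hMa using hab
    choose Mf hMf using fun y => sgnpow_bdd (f y) hefb
    choose Mg hMg using fun y => sgnpow_bdd (g y) hegb
    refine ⟨∑ x, (∑ y, Ma x y * Mf y) * Mg x, ?_⟩
    rintro _ ⟨z, hz, rfl⟩
    simp only [Function.comp, hΦ]
    refine (norm_sum_le _ _).trans (sum_le_sum fun x _ => ?_)
    rw [norm_mul]
    have hs : ‖∑ y, a z x y * sgnpow (f y) (ef z)‖ ≤ ∑ y, Ma x y * Mf y := by
      refine (norm_sum_le _ _).trans (sum_le_sum fun y _ => ?_)
      rw [norm_mul]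
      exact mul_le_mul (hMa x y z hz) (hMf y z hz) (norm_nonneg _)
        ((norm_nonneg _).trans (hMa x y z hz))
    exact mul_le_mul hs (hMg x z hz) (norm_nonneg _) ((norm_nonneg _).trans hs)
  set F := NN p f with hF
  set Gg := NN q g with hGg
  have hFn : 0 ≤ F := NN_nonneg _ _
  have hGn : 0 ≤ Gg := NN_nonneg _ _
  have b0 : ∀ z ∈ re ⁻¹' {0}, ‖Φ z‖ ≤ B0 * F ^ (p / p0) * Gg ^ (q / q0) := by
    intro z hz
    have hz : z.re = 0 := hz
    refine (NN_holder c0 _ _).trans ?_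
    rw [NN_sgnpow g hq' hq0' (eg z) (by simp [heg, hz])]
    refine mul_le_mul_of_nonneg_right ?_ (by positivity)
    refine (h0 z hz _).trans (le_of_eq ?_)
    rw [NN_sgnpow f hp' hp0' (ef z) (by simp [hef, hz])]
  have b1 : ∀ z ∈ re ⁻¹' {1}, ‖Φ z‖ ≤ B1 * F ^ (p / p1) * Gg ^ (q / q1) := by
    intro z hz
    have hz : z.re = 1 := hz
    refine (NN_holder c1 _ _).trans ?_
    rw [NN_sgnpow g hq' hq1' (eg z) (by simp [heg, hz])]
    refine mul_le_mul_of_nonneg_right ?_ (by positivity)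
    refine (h1 z hz _).trans (le_of_eq ?_)
    rw [NN_sgnpow f hp' hp1' (ef z) (by simp [hef, hz])]
  have main := norm_le_interp_of_mem_verticalClosedStrip₀₁' Φ (z := (θ : ℂ))
    (by simp [verticalClosedStrip, hθ0, hθ1]) hd hbdd b0 b1
  have hΦθ : Φ θ = ∑ x, (∑ y, a θ x y * f y) * g x := by
    simp only [hΦ, efθ, egθ, sgnpow_one]
  rw [hΦθ] at main
  refine main.trans (le_of_eq ?_)
  simp only [Complex.ofReal_re]
  rw [mul_rpow (by positivity) (by positivity), mul_rpow hB0 (by positivity),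
    mul_rpow (by positivity) (by positivity), mul_rpow hB1 (by positivity),
    ← rpow_mul hFn, ← rpow_mul hFn, ← rpow_mul hGn, ← rpow_mul hGn]
  have f1 : F ^ (p / p0 * (1 - θ)) * F ^ (p / p1 * θ) = F := by
    rw [← rpow_add_of_nonneg hFn (mul_nonneg (by positivity) (by linarith)) (by positivity)]
    have : p / p0 * (1 - θ) + p / p1 * θ = 1 := by
      have : p * (1 / p) = 1 := by field_simp
      rw [hp] at this; linear_combination this
    rw [this, rpow_one]
  have f2 : Gg ^ (q / q0 * (1 - θ)) * Gg ^ (q / q1 * θ) = Gg := by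
    rw [← rpow_add_of_nonneg hGn (mul_nonneg (by positivity) (by linarith)) (by positivity)]
    have : q / q0 * (1 - θ) + q / q1 * θ = 1 := by
      have : q * (1 / q) = 1 := by field_simp
      rw [hqq] at this; linear_combination this
    rw [this, rpow_one]
  calc _ = B0 ^ (1 - θ) * B1 ^ θ * (F ^ (p / p0 * (1 - θ)) * F ^ (p / p1 * θ)) *
        (Gg ^ (q / q0 * (1 - θ)) * Gg ^ (q / q1 * θ)) := by ring
    _ = _ := by rw [f1, f2]

noncomputable def hat {G : Type*} [Fintype G] [AddCommGroup G] (f : G → ℂ) (χ : AddChar G ℂ) : ℂ :=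
  ∑ x, f x * χ (-x)

section fourier
variable {G : Type*} [Fintype G] [AddCommGroup G]

theorem parseval (f : G → ℂ) :
    ∑ χ : AddChar G ℂ, ‖hat f χ‖ ^ 2 = Fintype.card G * NN 2 f ^ 2 := by
  classical
  have h : ∀ χ : AddChar G ℂ, ((‖hat f χ‖ ^ 2 : ℝ) : ℂ) =
      ∑ x, ∑ y, f x * (starRingEnd ℂ) (f y) * χ (y - x) := by
    intro χ
    rw [← normSq_eq_norm_sq, ← mul_conj, hat, map_sum, sum_mul_sum]
    refine sum_congr rfl fun x _ => sum_congr rfl fun y _ => ?_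
    rw [map_mul, ← AddChar.map_neg_eq_conj, neg_neg, sub_eq_add_neg, AddChar.map_add_eq_mul]
    ring
  have : ((∑ χ : AddChar G ℂ, ‖hat f χ‖ ^ 2 : ℝ) : ℂ) = ((Fintype.card G * NN 2 f ^ 2 : ℝ) : ℂ) := by
    rw [ofReal_sum]
    simp only [h]
    rw [sum_comm]
    have h2 : ∀ x : G, ∑ χ : AddChar G ℂ, ∑ y, f x * (starRingEnd ℂ) (f y) * χ (y - x) =
        (Fintype.card G : ℂ) * ((‖f x‖ ^ 2 : ℝ) : ℂ) := by
      intro x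
      rw [sum_comm]
      simp only [← mul_sum, AddChar.sum_apply_eq_ite, sub_eq_zero, mul_ite, mul_zero]
      rw [Finset.sum_ite_eq']
      simp only [mem_univ, if_true]
      rw [mul_conj, normSq_eq_norm_sq, mul_comm]
    simp only [h2, ← mul_sum, NN_two_sq]
    push_cast; rfl
  exact_mod_cast this

theorem hat_cv (K f : G → ℂ) (χ : AddChar G ℂ) : hat (cv K f) χ = hat K χ * hat f χ := by
  unfold hat cv
  simp only [sum_mul]
  rw [sum_comm]
  refine sum_congr rfl fun y _ => ?_
  rw [← Equiv.sum_comp (Equiv.addRight y) (fun x => K y * f (x - y) * χ (-x))]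
  simp only [mul_sum]
  refine sum_congr rfl fun z _ => ?_
  simp only [Equiv.coe_addRight, add_sub_cancel_right, neg_add, AddChar.map_add_eq_mul]
  ring

theorem NN2_cv_le_of (K f : G → ℂ) (g : AddChar G ℂ → ℝ)
    (h : ∀ χ, ‖hat K χ‖ ^ 2 * ‖hat f χ‖ ^ 2 ≤ g χ) :
    (Fintype.card G : ℝ) * NN 2 (cv K f) ^ 2 ≤ ∑ χ, g χ := by
  rw [← parseval]
  refine sum_le_sum fun χ _ => ?_
  rw [hat_cv, norm_mul, mul_pow]; exact h χ

theorem NN2_cv_le {B : ℝ} (hB : 0 ≤ B) (K f : G → ℂ) (h : ∀ χ : AddChar G ℂ, ‖hat K χ‖ ≤ B) :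
    NN 2 (cv K f) ≤ B * NN 2 f := by
  have h1 := NN2_cv_le_of K f (fun χ => B ^ 2 * ‖hat f χ‖ ^ 2) (fun χ => by gcongr; exact h χ)
  rw [← mul_sum, parseval] at h1
  have hc : (0 : ℝ) < Fintype.card G := by exact_mod_cast Fintype.card_pos
  have h2 : NN 2 (cv K f) ^ 2 ≤ (B * NN 2 f) ^ 2 := by
    rw [mul_pow]
    refine le_of_mul_le_mul_left ?_ hc
    linarith
  exact (pow_le_pow_iff_left₀ (NN_nonneg _ _) (mul_nonneg hB (NN_nonneg _ _)) (by norm_num)).1 h2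

theorem hat_sub (f g : G → ℂ) (χ : AddChar G ℂ) : hat (fun x => f x - g x) χ = hat f χ - hat g χ := by
  simp [hat, sub_mul, sum_sub_distrib]
theorem hat_smul (c : ℂ) (f : G → ℂ) (χ : AddChar G ℂ) : hat (fun x => c * f x) χ = c * hat f χ := by
  simp [hat, mul_sum, mul_assoc]
theorem hat_sum {ι : Type*} (s : Finset ι) (f : ι → G → ℂ) (χ : AddChar G ℂ) :
    hat (fun x => ∑ i ∈ s, f i x) χ = ∑ i ∈ s, hat (f i) χ := by
  simp only [hat, sum_mul]; exact sum_comm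

end fourier

section prod
variable {H : Type*} [Fintype H] [AddCommGroup H] {d : ℕ}

noncomputable def chi (χ : AddChar (Fin d → H) ℂ) (j : Fin d) : AddChar H ℂ where
  toFun x := χ (Pi.single j x)
  map_zero_eq_one' := by simp
  map_add_eq_mul' a b := by rw [Pi.single_add, AddChar.map_add_eq_mul]

theorem chi_prod (χ : AddChar (Fin d → H) ℂ) (x : Fin d → H) : χ x = ∏ j, chi χ j (x j) := by
  have : x = ∑ j, Pi.single j (x j) := (Finset.univ_sum_single x).symm
  conv_lhs => rw [this]
  have h : ∀ s : Finset (Fin d), χ (∑ j ∈ s, Pi.single j (x j)) = ∏ j ∈ s, chi χ j (x j) := by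
    intro s
    induction s using Finset.induction_on with
    | empty => simp
    | insert a s ha ih =>
      rw [sum_insert ha, Finset.prod_insert ha, AddChar.map_add_eq_mul, ih]; rfl
  exact h _

theorem hat_prod (k : Fin d → H → ℂ) (χ : AddChar (Fin d → H) ℂ) :
    hat (fun x : Fin d → H => ∏ j, k j (x j)) χ = ∏ j, hat (k j) (chi χ j) := by
  classical
  unfold hat
  rw [prod_univ_sum]
  simp only [Fintype.piFinset_univ]
  refine sum_congr rfl fun x _ => ?_
  rw [chi_prod, ← prod_mul_distrib]
  rfl

theorem sum_prod_eq {R : Type*} [CommRing R] (k : Fin d → H → R) :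
    ∑ x : Fin d → H, ∏ j, k j (x j) = ∏ j, ∑ y, k j y := by
  classical
  rw [prod_univ_sum]
  simp only [Fintype.piFinset_univ]

end prod

open Complex.HadamardThreeLines

theorem norm_sin_le (z : ℂ) : ‖Complex.sin z‖ ≤ cosh z.im := by
  rw [Complex.sin, norm_div, norm_mul, norm_I, mul_one, cosh_eq]
  simp only [Complex.norm_ofNat]
  gcongr
  refine (norm_sub_le _ _).trans (le_of_eq ?_)
  rw [norm_exp, norm_exp]; simp

theorem abs_im_le_norm_sin (z : ℂ) : |z.im| ≤ ‖Complex.sin z‖ := by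
  have h : |sinh z.im| ≤ ‖Complex.sin z‖ := by
    rw [Complex.sin, norm_div, norm_mul, norm_I, mul_one, sinh_eq, abs_div]
    simp only [Complex.norm_ofNat, abs_two]
    gcongr
    have := abs_norm_sub_norm_le (Complex.exp (-z * I)) (Complex.exp (z * I))
    rw [norm_exp, norm_exp] at this
    simpa using this
  refine le_trans ?_ h
  rcases le_total 0 z.im with hz | hz
  · rw [abs_of_nonneg hz]; exact (Real.self_le_sinh_iff.2 hz).trans (le_abs_self _)
  · rw [abs_of_nonpos hz, ← abs_neg, ← sinh_neg]
    exact (Real.self_le_sinh_iff.2 (by linarith)).trans (le_abs_self _)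

theorem cosh_one_lt_two : cosh 1 < 2 := by
  rw [cosh_eq]
  have h1 := exp_one_lt_d9
  have h2 : exp (-1) < 1 := by rw [exp_lt_one_iff]; norm_num
  linarith

section disc
variable {G : Type*} [Fintype G] [AddCommGroup G]

theorem disc_lemma {p : ℝ} (hp : 1 < p) (hp2 : p ≤ 2) (F : ℂ → G → ℂ) {ρ : ℝ} (hρ : 0 < ρ)
    (hd : ∀ x, DifferentiableOn ℂ (fun w => F w x) (Metric.ball 0 ρ))
    (h2 : ∀ w ∈ Metric.ball (0 : ℂ) ρ, ∀ χ : AddChar G ℂ, ‖hat (F w) χ‖ ≤ 1)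
    (hr : ∀ r : ℝ, |r| < ρ → ∑ x, ‖F r x‖ ≤ 1) (w : ℂ) (hw : ‖w‖ ≤ (1 - 1 / p) / 2 * ρ) (f : G → ℂ) :
    NN p (cv (F w) f) ≤ NN p f := by
  have hp0 : 0 < p := by linarith
  have hi : 1 / p < 1 := by rw [div_lt_one hp0]; exact hp
  have hi2 : 1 / 2 ≤ 1 / p := one_div_le_one_div_of_le hp0 hp2
  set a := ρ / 2 with ha
  have ha0 : 0 < a := by positivity
  obtain ⟨ζ, hζ, hy0⟩ : ∃ ζ : ℂ, Complex.sin ζ = w / a ∧ 0 ≤ ζ.im := by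
    obtain ⟨ζ, hζ⟩ := Complex.sin_surjective (w / a)
    rcases le_total 0 ζ.im with h | h
    · exact ⟨ζ, hζ, h⟩
    · exact ⟨π - ζ, by rw [Complex.sin_pi_sub, hζ], by simpa using h⟩
  set y := ζ.im with hy
  have hy1 : y ≤ 1 - 1 / p := by
    have := abs_im_le_norm_sin ζ
    rw [hζ, norm_div, norm_real, norm_of_nonneg ha0.le, le_div_iff₀ ha0] at this
    have h' : |ζ.im| * a ≤ (1 - 1 / p) * a := this.trans (hw.trans (by rw [ha]; linarith))
    exact (le_abs_self _).trans (le_of_mul_le_mul_right h' ha0)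
  have hylt : y < 1 := by have : 0 < 1 / p := by positivity
                          linarith
  set p0 := (1 - y) / (1 / p - y / 2) with hp0d
  have hden : 0 < 1 / p - y / 2 := by linarith
  have hp01 : 1 < p0 := by rw [hp0d, lt_div_iff₀ hden]; linarith
  have hinv : 1 / p = (1 - y) / p0 + y / 2 := by
    have : 1 - y ≠ 0 := by linarith
    rw [hp0d, div_div_cancel₀ this]; ring
  have hcr : ∀ (K f : G → ℂ), (fun x => ∑ y, K (x - y) * f y) = cv K f := by
    intro K f; rw [cv_comm]; ext x; unfold cv; exact sum_congr rfl fun _ _ => mul_comm _ _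
  set A : ℂ → ℂ := fun z => a * Complex.sin (ζ.re + z * I) with hA
  have hAd : Differentiable ℂ A := by simp only [hA]; fun_prop
  have hAn : ∀ z, ‖A z‖ ≤ a * cosh z.re := by
    intro z
    simp only [hA, norm_mul, norm_real, norm_of_nonneg ha0.le]
    gcongr
    simpa using norm_sin_le (ζ.re + z * I)
  have hAc : ∀ z ∈ verticalClosedStrip 0 1, ‖A z‖ ≤ a * cosh 1 := by
    intro z hz
    refine (hAn z).trans ?_
    simp only [verticalClosedStrip, Set.mem_preimage, Set.mem_Icc] at hz
    gcongr
    rw [cosh_le_cosh, abs_of_nonneg hz.1]; simpa using hz.2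
  have hac : a * cosh 1 < ρ := by
    have := cosh_one_lt_two; rw [ha]; nlinarith
  have hsub : Metric.closedBall (0 : ℂ) (a * cosh 1) ⊆ Metric.ball 0 ρ :=
    Metric.closedBall_subset_ball hac
  have hstr : ∀ z ∈ verticalClosedStrip 0 1, A z ∈ Metric.closedBall (0 : ℂ) (a * cosh 1) :=
    fun z hz => by simpa using hAc z hz
  have hclos : closure (verticalStrip 0 1) ⊆ verticalClosedStrip 0 1 :=
    closure_minimal (fun z hz => ⟨hz.1.le, hz.2.le⟩) (isClosed_Icc.preimage Complex.continuous_re)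
  have key := stein (X := G) (Y := G) (fun z x y => F (A z) (x - y)) (p0 := p0) (p1 := 2) (p := p)
    (θ := y) (B0 := 1) (B1 := 1) hp01 (by norm_num) hy0 hylt.le hinv (by norm_num) (by norm_num)
    (by
      intro x y
      have hm : Set.MapsTo A (verticalStrip 0 1) (Metric.ball 0 ρ) :=
        fun z hz => hsub (hstr z ⟨hz.1.le, hz.2.le⟩)
      have hm' : Set.MapsTo A (closure (verticalStrip 0 1)) (Metric.ball 0 ρ) :=
        fun z hz => hsub (hstr z (hclos hz))
      exact ⟨(hd (x - y)).comp hAd.differentiableOn hm,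
        (hd (x - y)).continuousOn.comp hAd.continuous.continuousOn hm'⟩)
    (by
      intro x y
      obtain ⟨M, hM⟩ := (isCompact_closedBall (0 : ℂ) (a * cosh 1)).exists_bound_of_continuousOn
        ((hd (x - y)).continuousOn.mono hsub)
      exact ⟨M, fun z hz => hM _ (hstr z hz)⟩)
    (by
      intro z hz f
      rw [hcr]
      refine (NN_cv_le hp01.le _ _).trans ?_
      refine mul_le_mul_of_nonneg_right ?_ (NN_nonneg _ _)
      have hz' : A z = ((a * sin (ζ.re - z.im) : ℝ) : ℂ) := by
        simp only [hA]
        push_cast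
        congr 2
        apply Complex.ext <;> simp [hz]; ring
      rw [hz']
      apply hr
      rw [abs_mul, abs_of_pos ha0]
      have := abs_sin_le_one (ζ.re - z.im)
      rw [ha] at *; nlinarith)
    (by
      intro z hz f
      rw [hcr]
      exact NN2_cv_le (by norm_num) _ _ (h2 _ (hsub (hstr z (by simp [verticalClosedStrip, hz]))))) f
  rw [hcr] at key
  have hAy : A y = w := by
    simp only [hA]
    have : (ζ.re : ℂ) + y * I = ζ := re_add_im ζ
    rw [this, hζ]
    have : (a : ℂ) ≠ 0 := by exact_mod_cast ha0.ne'
    field_simp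
  rw [hAy] at key
  simpa using key

theorem lip_lemma {p : ℝ} (hp : 1 < p) (F : ℂ → G → ℂ) {ρ : ℝ} (hρ : 0 < ρ)
    (hd : ∀ x, DifferentiableOn ℂ (fun w => F w x) (Metric.ball 0 ρ))
    (hb : ∀ w ∈ Metric.ball (0 : ℂ) ρ, ∀ f : G → ℂ, NN p (cv (F w) f) ≤ NN p f)
    {w w' : ℂ} (hw : ‖w‖ < ρ) (hw' : ‖w'‖ < ρ / 2) (f : G → ℂ) :
    NN p (fun x => cv (F w) f x - cv (F w') f x) ≤ 4 / ρ * ‖w - w'‖ * NN p f := by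
  have hp0 : 0 < p := by linarith
  have hf := NN_nonneg p f
  by_cases hc : ρ / 2 ≤ ‖w - w'‖
  · have h1 := (NN_sub_le hp.le (cv (F w) f) (cv (F w') f)).trans
      (add_le_add (hb w (by simpa using hw) f) (hb w' (by simp; linarith) f))
    have : 2 ≤ 4 / ρ * ‖w - w'‖ := by
      rw [div_mul_eq_mul_div, le_div_iff₀ hρ]; linarith
    nlinarith
  push Not at hc
  refine NN_dual (Real.HolderConjugate.conjExponent hp) _ (by positivity) fun g => ?_
  set q := p.conjExponent
  have cq : p.HolderConjugate q := Real.HolderConjugate.conjExponent hp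
  have hg := NN_nonneg q g
  set φ : ℂ → ℂ := fun w => ∑ x, cv (F w) f x * g x with hφ
  have hφd : DifferentiableOn ℂ φ (Metric.ball 0 ρ) := by
    simp only [hφ, cv]
    refine DifferentiableOn.fun_sum fun x _ => ?_
    refine DifferentiableOn.mul_const (DifferentiableOn.fun_sum fun y _ => ?_) _
    exact (hd y).mul_const _
  have hφb : ∀ u ∈ Metric.ball (0 : ℂ) ρ, ‖φ u‖ ≤ NN p f * NN q g := fun u hu =>
    (NN_holder cq _ _).trans (mul_le_mul_of_nonneg_right (hb u hu f) hg)
  have hsub : Metric.ball w' (ρ / 2) ⊆ Metric.ball 0 ρ := by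
    intro u hu
    simp only [Metric.mem_ball, dist_eq_norm, sub_zero] at hu ⊢
    calc ‖u‖ = ‖(u - w') + w'‖ := by simp
      _ ≤ _ := norm_add_le _ _
      _ < ρ := by linarith
  have hmap : Set.MapsTo φ (Metric.ball w' (ρ / 2))
      (Metric.closedBall (φ w') (2 * (NN p f * NN q g))) := by
    intro u hu
    rw [mem_closedBall_iff_norm]
    have h1 := hφb u (hsub hu)
    have h2 := hφb w' (by simp; linarith)
    exact (norm_sub_le _ _).trans (by linarith)
  have hmain := Complex.dist_le_div_mul_dist_of_mapsTo_ball (hφd.mono hsub) hmap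
    (by rw [Metric.mem_ball, dist_eq_norm]; exact hc)
  rw [dist_eq_norm, dist_eq_norm] at hmain
  have e : ∑ x, (cv (F w) f x - cv (F w') f x) * g x = φ w - φ w' := by
    simp only [hφ, sub_mul, sum_sub_distrib]
  rw [e]
  refine hmain.trans (le_of_eq ?_)
  field_simp; ring

end disc

section ergodic
variable {X : Type*} [Fintype X]

theorem garsia (T : (X → ℝ) →ₗ[ℝ] (X → ℝ)) (hpos : ∀ f, (∀ x, 0 ≤ f x) → ∀ x, 0 ≤ T f x)
    (hsum : ∀ f, ∑ x, T f x = ∑ x, f x) (f : X → ℝ) (n : ℕ) (E : Finset X)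
    (hE : ∀ x, x ∈ E ↔ ∃ m < n, 0 < ∑ l ∈ range (m + 1), (T ^ l) f x) :
    0 ≤ ∑ x ∈ E, f x := by
  classical
  have hmono : ∀ f g : X → ℝ, (∀ x, f x ≤ g x) → ∀ x, T f x ≤ T g x := by
    intro f g h x
    have := hpos (g - f) (fun x => by simpa using h x) x
    rw [map_sub] at this; simpa using this
  set S : ℕ → X → ℝ := fun m => ∑ l ∈ range m, (T ^ l) f with hS
  set M : X → ℝ := fun x => (range (n + 1)).sup' ⟨0, by simp⟩ (fun m => S m x) with hM
  have hM0 : ∀ x, 0 ≤ M x := fun x => by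
    have := le_sup' (s := range (n + 1)) (fun m => S m x) (b := 0) (by simp)
    refine le_trans (by simp [hS]) this
  have hSM : ∀ m ≤ n, ∀ x, S m x ≤ M x := fun m hm x =>
    le_sup' (s := range (n + 1)) (fun m => S m x) (by simpa using Nat.lt_succ_of_le hm)
  have hrec : ∀ m, S (m + 1) = f + T (S m) := by
    intro m
    simp only [hS, sum_range_succ', map_sum, pow_succ']
    simp [add_comm]
  have hin : ∀ x ∈ E, M x - T M x ≤ f x := by
    intro x hx
    obtain ⟨m0, hm0, hm0'⟩ := (hE x).1 hx
    obtain ⟨m, hm, hmM⟩ := Finset.exists_mem_eq_sup' (s := range (n + 1)) ⟨0, by simp⟩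
      (fun m => S m x)
    have hmM : M x = S m x := hmM
    have hpos' : 0 < M x := lt_of_lt_of_le (by simpa [hS] using hm0') (hSM (m0 + 1) hm0 x)
    cases m with
    | zero => exfalso; rw [hmM] at hpos'; simp [hS] at hpos'
    | succ m =>
      have hm' : m ≤ n := by simp at hm; omega
      have := hmono _ _ (hSM m hm') x
      rw [hmM, hrec m]; simp only [Pi.add_apply]; linarith
  have hout : ∀ x, x ∉ E → M x = 0 := by
    intro x hx
    refine le_antisymm (Finset.sup'_le _ _ fun m hm => ?_) (hM0 x)
    by_contra hc
    push Not at hc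
    cases m with
    | zero => simp [hS] at hc
    | succ m => exact hx ((hE x).2 ⟨m, by simpa using hm, by simpa [hS] using hc⟩)
  have hTM := hpos M hM0
  calc 0 = ∑ x, (M x - T M x) := by rw [sum_sub_distrib, hsum, sub_self]
    _ = ∑ x ∈ E, (M x - T M x) + ∑ x ∈ Eᶜ, (M x - T M x) := (Finset.sum_add_sum_compl E _).symm
    _ ≤ ∑ x ∈ E, f x + 0 := by
        refine add_le_add (sum_le_sum hin) (Finset.sum_nonpos fun x hx => ?_)
        rw [hout x (by simpa using hx)]; linarith [hTM x]
    _ = _ := add_zero _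

theorem strong_of_weak {p : ℝ} (hp : 1 < p) (f M : X → ℝ) (hf : ∀ x, 0 ≤ f x) (hM : ∀ x, 0 ≤ M x)
    (hw : ∀ l : ℝ, 0 < l → 0 ≤ ∑ x, if l < M x then (f x - l) else 0) :
    ∑ x, M x ^ p ≤ p / (p - 1) * ∑ x, f x * M x ^ (p - 1) := by
  obtain ⟨A, hA0, hA⟩ : ∃ A : ℝ, 0 ≤ A ∧ ∀ x, M x ≤ A :=
    ⟨∑ x, M x, sum_nonneg fun x _ => hM x,
      fun x => single_le_sum (f := M) (fun i _ => hM i) (mem_univ x)⟩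
  have i1 : ∀ a b, IntervalIntegrable (fun l : ℝ => l ^ (p - 1)) MeasureTheory.volume a b :=
    fun a b => intervalIntegral.intervalIntegrable_rpow' (by linarith)
  have i2 : ∀ a b, IntervalIntegrable (fun l : ℝ => l ^ (p - 2)) MeasureTheory.volume a b :=
    fun a b => intervalIntegral.intervalIntegrable_rpow' (by linarith)
  have hint : ∀ x a b, IntervalIntegrable (fun l : ℝ => f x * l ^ (p - 2) - l ^ (p - 1))
      MeasureTheory.volume a b := fun x a b => ((i2 a b).const_mul _).sub (i1 a b)
  have hval : ∀ x, ∫ l in (0 : ℝ)..A, (if l < M x then (f x * l ^ (p - 2) - l ^ (p - 1)) else 0) =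
      f x * (M x ^ (p - 1) / (p - 1)) - M x ^ p / p ∧
      IntervalIntegrable (fun l : ℝ => if l < M x then (f x * l ^ (p - 2) - l ^ (p - 1)) else 0)
        MeasureTheory.volume 0 A := by
    intro x
    have a1 : Set.EqOn (fun l : ℝ => f x * l ^ (p - 2) - l ^ (p - 1))
        (fun l : ℝ => if l < M x then (f x * l ^ (p - 2) - l ^ (p - 1)) else 0)
        (Set.uIoo 0 (M x)) := by
      intro l hl
      rw [Set.uIoo_of_le (hM x)] at hl
      simp [hl.2]
    have a2 : Set.EqOn (fun _ : ℝ => (0 : ℝ))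
        (fun l : ℝ => if l < M x then (f x * l ^ (p - 2) - l ^ (p - 1)) else 0)
        (Set.uIoo (M x) A) := by
      intro l hl
      rw [Set.uIoo_of_le (hA x)] at hl
      simp [hl.1.le]
    have b1 := (hint x 0 (M x)).congr_uIoo a1
    have b2 := (intervalIntegrable_const (μ := MeasureTheory.volume) (a := M x) (b := A)
      (c := (0 : ℝ))).congr_uIoo a2
    refine ⟨?_, b1.trans b2⟩
    rw [← intervalIntegral.integral_add_adjacent_intervals b1 b2,
      ← intervalIntegral.integral_congr_uIoo a1, ← intervalIntegral.integral_congr_uIoo a2]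
    simp only [intervalIntegral.integral_zero, add_zero]
    rw [intervalIntegral.integral_sub ((i2 _ _).const_mul _) (i1 _ _),
      intervalIntegral.integral_const_mul, integral_rpow (Or.inl (by linarith)),
      integral_rpow (Or.inl (by linarith))]
    rw [zero_rpow (by linarith), zero_rpow (by linarith)]
    simp only [sub_zero, show p - 2 + 1 = p - 1 by ring, show p - 1 + 1 = p by ring]
  have hnn : 0 ≤ ∫ l in (0 : ℝ)..A, ∑ x,
      (if l < M x then (f x * l ^ (p - 2) - l ^ (p - 1)) else 0) := by
    refine intervalIntegral.integral_nonneg hA0 ?_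
    intro l hl
    rcases eq_or_lt_of_le hl.1 with hl | hl
    · refine sum_nonneg fun x _ => ?_
      rw [← hl, zero_rpow (show p - 1 ≠ 0 by linarith), sub_zero]
      split_ifs
      · exact mul_nonneg (hf x) (rpow_nonneg le_rfl _)
      · exact le_rfl
    · have := mul_nonneg (rpow_nonneg hl.le (p - 2)) (hw l hl)
      rw [mul_sum] at this
      refine this.trans (le_of_eq (sum_congr rfl fun x _ => ?_))
      split_ifs
      · rw [mul_sub, show p - 1 = (p - 2) + 1 by ring, rpow_add_one hl.ne']; ring
      · simp
  rw [intervalIntegral.integral_finset_sum (fun x _ => (hval x).2)] at hnn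
  simp only [fun x => (hval x).1] at hnn
  have hp1 : 0 < p - 1 := by linarith
  have hp0 : 0 < p := by linarith
  have e : ∑ x, (f x * (M x ^ (p - 1) / (p - 1)) - M x ^ p / p) =
      (∑ x, f x * M x ^ (p - 1)) / (p - 1) - (∑ x, M x ^ p) / p := by
    rw [sum_sub_distrib, sum_div, sum_div]
    congr 1; exact sum_congr rfl fun _ _ => by ring
  rw [e, sub_nonneg, div_le_iff₀ hp0] at hnn
  refine hnn.trans (le_of_eq (by ring))

theorem strong_NN {p : ℝ} (hp : 1 < p) (f M : X → ℝ) (hf : ∀ x, 0 ≤ f x) (hM : ∀ x, 0 ≤ M x)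
    (h : ∑ x, M x ^ p ≤ p / (p - 1) * ∑ x, f x * M x ^ (p - 1)) :
    NN p M ≤ p / (p - 1) * NN p f := by
  have hp0 : 0 < p := by linarith
  have hp1 : 0 < p - 1 := by linarith
  have cq : p.HolderConjugate p.conjExponent := Real.HolderConjugate.conjExponent hp
  by_cases hz : NN p M = 0
  · rw [hz]; have := NN_nonneg p f; positivity
  have hpos : 0 < NN p M := lt_of_le_of_ne (NN_nonneg _ _) (Ne.symm hz)
  have hh := inner_le_Lp_mul_Lq univ f (fun x => M x ^ (p - 1)) cq
  have e1 : ∑ x, M x ^ p = NN p M ^ p := by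
    rw [NN_pow hp0]; simp only [norm_eq_abs]
    exact sum_congr rfl fun x _ => by rw [abs_of_nonneg (hM x)]
  have e2 : ∑ x, |M x ^ (p - 1)| ^ p.conjExponent = NN p M ^ p := by
    rw [← e1]
    refine sum_congr rfl fun x _ => ?_
    rw [abs_of_nonneg (rpow_nonneg (hM x) _), ← rpow_mul (hM x), cq.sub_one_mul_conj]
  rw [e2, ← rpow_mul hpos.le, show p * (1 / p.conjExponent) = p - 1 by
    have := cq.inv_add_inv_eq_one
    have h2 : 1 / p.conjExponent = 1 - 1 / p := by simp only [one_div]; linarith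
    rw [h2]; field_simp] at hh
  have e3 : (∑ x, |f x| ^ p) ^ (1 / p) = NN p f := rfl
  rw [e3] at hh
  rw [e1] at h
  have h5 : NN p M ^ p = NN p M * NN p M ^ (p - 1) := by
    rw [← rpow_one_add' hpos.le (by linarith [hp0])]; congr 1; ring
  rw [h5] at h
  have h6 : NN p M * NN p M ^ (p - 1) ≤ (p / (p - 1) * NN p f) * NN p M ^ (p - 1) := by
    refine h.trans ?_
    rw [mul_assoc]
    exact mul_le_mul_of_nonneg_left hh (by positivity)
  exact le_of_mul_le_mul_right h6 (rpow_pos_of_pos hpos _)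

theorem max_ergodic {p : ℝ} (hp : 1 < p) (T : (X → ℝ) →ₗ[ℝ] (X → ℝ))
    (hpos : ∀ f, (∀ x, 0 ≤ f x) → ∀ x, 0 ≤ T f x)
    (hsum : ∀ f, ∑ x, T f x = ∑ x, f x) (hone : T (fun _ => 1) = fun _ => 1)
    (f : X → ℝ) (hf : ∀ x, 0 ≤ f x) (n : ℕ) :
    ∃ M : X → ℝ, (∀ x, 0 ≤ M x) ∧
      (∀ m < n, ∀ x, (∑ l ∈ range (m + 1), (T ^ l) f x) / (m + 1) ≤ M x) ∧
      NN p M ≤ p / (p - 1) * NN p f := by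
  classical
  have hTl : ∀ l, ∀ x, 0 ≤ (T ^ l) f x := by
    intro l
    induction l with
    | zero => simpa using hf
    | succ l ih => rw [pow_succ']; exact hpos _ ih
  have hT1 : ∀ l (c : ℝ), (T ^ l) (fun _ => c) = fun _ => c := by
    intro l c
    have : (fun _ : X => c) = c • (fun _ : X => (1 : ℝ)) := by ext; simp
    rw [this, map_smul]
    congr 1
    induction l with
    | zero => simp
    | succ l ih => rw [pow_succ', Module.End.mul_apply, ih, hone]
  set A : ℕ → X → ℝ := fun m x => (∑ l ∈ range (m + 1), (T ^ l) f x) / (m + 1) with hA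
  set M : X → ℝ := fun x => (range (n + 1)).sup' ⟨0, by simp⟩ (fun m => A m x) with hM
  have hAM : ∀ m < n + 1, ∀ x, A m x ≤ M x := fun m hm x =>
    le_sup' (s := range (n + 1)) (fun m => A m x) (by simpa using hm)
  have hM0 : ∀ x, 0 ≤ M x := fun x =>
    le_trans (by simpa [hA] using hf x) (hAM 0 (by omega) x)
  refine ⟨M, hM0, fun m hm x => hAM m (by omega) x, ?_⟩
  refine strong_NN hp f M hf hM0 (strong_of_weak hp f M hf hM0 fun l hl => ?_)
  have := garsia T hpos hsum (fun x => f x - l) (n + 1) (Finset.univ.filter fun x => l < M x) (by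
    intro x
    simp only [mem_filter, mem_univ, true_and]
    refine (Finset.lt_sup'_iff _).trans ?_
    simp only [mem_range]
    refine exists_congr fun m => and_congr_right fun hm => ?_
    have hh : ∀ k, (T ^ k) (fun x => f x - l) x = (T ^ k) f x - l := by
      intro k
      have : (fun x => f x - l) = f - (fun _ => l) := rfl
      rw [this, map_sub, hT1]; rfl
    simp only [hh, sum_sub_distrib, sum_const, card_range, nsmul_eq_mul,
      sub_pos, hA]
    rw [lt_div_iff₀ (by positivity)]
    push_cast
    rw [mul_comm])
  rwa [sum_filter] at this

end ergodic

section kernels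
variable {G : Type*} [Fintype G] [AddCommGroup G]

def IsProb (K : G → ℝ) : Prop := (∀ x, 0 ≤ K x) ∧ ∑ x, K x = 1

open Classical in
noncomputable def dlt : G → ℝ := fun x => if x = 0 then 1 else 0

theorem dlt_prob : IsProb (dlt : G → ℝ) := by
  classical
  refine ⟨fun x => ?_, by simp [dlt]⟩
  unfold dlt; split_ifs <;> norm_num

theorem cv_dlt (f : G → ℝ) : cv dlt f = f := by
  classical
  ext x; simp [cv, dlt]

theorem cv_nonneg {K f : G → ℝ} (hK : ∀ x, 0 ≤ K x) (hf : ∀ x, 0 ≤ f x) (x : G) : 0 ≤ cv K f x :=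
  sum_nonneg fun y _ => mul_nonneg (hK y) (hf _)

theorem sum_cv {R : Type*} [CommRing R] (K f : G → R) : ∑ x, cv K f x = (∑ x, K x) * ∑ x, f x := by
  unfold cv
  rw [sum_comm, sum_mul]
  refine sum_congr rfl fun y _ => ?_
  rw [← mul_sum]; congr 1
  exact Equiv.sum_comp (Equiv.subRight y) f

theorem IsProb.cv {K L : G → ℝ} (hK : IsProb K) (hL : IsProb L) : IsProb (cv K L) :=
  ⟨cv_nonneg hK.1 hL.1, by rw [sum_cv, hK.2, hL.2, one_mul]⟩

theorem IsProb.NN_cv_le {K : G → ℝ} (hK : IsProb K) {p : ℝ} (hp : 1 ≤ p) (f : G → ℝ) :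
    NN p (Real.cv K f) ≤ NN p f := by
  refine (Real.NN_cv_le hp K f).trans (le_of_eq ?_)
  have : ∑ y, ‖K y‖ = 1 := by
    rw [← hK.2]; exact sum_congr rfl fun y _ => by rw [norm_of_nonneg (hK.1 y)]
  rw [this, one_mul]

def cx (K : G → ℝ) : G → ℂ := fun x => (K x : ℂ)

theorem cv_cx (K f : G → ℝ) (x : G) : cv (cx K) (cx f) x = ((cv K f x : ℝ) : ℂ) := by
  simp [cv, cx]

theorem norm_cv_cx_le {K : G → ℝ} (hK : ∀ x, 0 ≤ K x) (f : G → ℂ) (x : G) :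
    ‖cv (cx K) f x‖ ≤ cv K (fun y => ‖f y‖) x := by
  unfold cv cx
  refine (norm_sum_le _ _).trans (le_of_eq (sum_congr rfl fun y _ => ?_))
  rw [norm_mul, norm_real, norm_of_nonneg (hK y)]

noncomputable def vpow (V : G → ℝ) : ℕ → G → ℝ
  | 0 => dlt
  | m + 1 => cv V (vpow V m)

noncomputable def pker (V : G → ℝ) (i : ℕ) : G → ℝ :=
  fun x => (2 ^ i : ℝ)⁻¹ * ∑ m ∈ range (2 ^ i), vpow V m x

variable {V : G → ℝ}

theorem vpow_prob (hV : IsProb V) : ∀ m, IsProb (vpow V m)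
  | 0 => dlt_prob
  | m + 1 => hV.cv (vpow_prob hV m)

theorem vpow_add (m n : ℕ) : vpow V (m + n) = cv (vpow V m) (vpow V n) := by
  induction m with
  | zero => rw [zero_add, vpow, cv_dlt]
  | succ m ih => rw [Nat.succ_add, vpow, ih, vpow, cv_assoc]

theorem pker_prob (hV : IsProb V) (i : ℕ) : IsProb (pker V i) := by
  refine ⟨fun x => mul_nonneg (by positivity)
    (sum_nonneg fun m _ => (vpow_prob hV m).1 x), ?_⟩
  unfold pker
  rw [← mul_sum, sum_comm]
  simp [(vpow_prob hV _).2]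

theorem pker_zero : pker V 0 = dlt := by
  ext x; simp [pker, vpow]

theorem pker_succ (i : ℕ) (x : G) :
    pker V (i + 1) x = (pker V i x + cv (vpow V (2 ^ i)) (pker V i) x) / 2 := by
  have : cv (vpow V (2 ^ i)) (pker V i) x = (2 ^ i : ℝ)⁻¹ *
      ∑ m ∈ range (2 ^ i), vpow V (2 ^ i + m) x := by
    have h : pker V i = fun x => (2 ^ i : ℝ)⁻¹ * ∑ m ∈ range (2 ^ i), vpow V m x := rfl
    rw [h, cv_smul, cv_sum]
    simp only [vpow_add]
  rw [this]
  unfold pker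
  rw [show (2 ^ (i + 1) : ℕ) = 2 ^ i + 2 ^ i by rw [pow_succ, mul_two], sum_range_add,
    pow_succ]
  field_simp

noncomputable def qker (V : G → ℝ) (i : ℕ) : G → ℝ := fun x => (dlt x + vpow V (2 ^ i) x) / 2

theorem qker_prob (hV : IsProb V) (i : ℕ) : IsProb (qker V i) := by
  refine ⟨fun x => ?_, ?_⟩
  · have h1 := (dlt_prob (G := G)).1 x
    have h2 := (vpow_prob hV (2 ^ i)).1 x
    unfold qker; linarith
  · unfold qker
    rw [← sum_div, sum_add_distrib, dlt_prob.2, (vpow_prob hV _).2]; norm_num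

theorem pker_succ' (i : ℕ) : pker V (i + 1) = cv (qker V i) (pker V i) := by
  ext x
  rw [pker_succ]
  have : qker V i = fun x => (2 : ℝ)⁻¹ * (dlt x + vpow V (2 ^ i) x) := by
    ext y; unfold qker; ring
  rw [this, cv_smul_left]
  have h2 : cv (fun y => dlt y + vpow V (2 ^ i) y) (pker V i) x =
      cv dlt (pker V i) x + cv (vpow V (2 ^ i)) (pker V i) x := by
    simp [cv, add_mul, sum_add_distrib]
  rw [h2, cv_dlt]; ring

theorem pker_max (hV : IsProb V) {p : ℝ} (hp : 1 < p) (L : ℕ) (f : G → ℝ) (hf : ∀ x, 0 ≤ f x) :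
    ∃ M : G → ℝ, (∀ x, 0 ≤ M x) ∧ (∀ i ≤ L, ∀ x, cv (pker V i) f x ≤ M x) ∧
      NN p M ≤ p / (p - 1) * NN p f := by
  let T : (G → ℝ) →ₗ[ℝ] (G → ℝ) :=
    { toFun := fun f => cv V f
      map_add' := fun f g => by ext x; exact cv_add V f g x
      map_smul' := fun c f => by ext x; exact cv_smul c V f x }
  have hT : ∀ l f, (T ^ l) f = cv (vpow V l) f := by
    intro l f
    induction l with
    | zero => simp [vpow, cv_dlt]
    | succ l ih => rw [pow_succ', Module.End.mul_apply, ih, vpow, cv_assoc]; rfl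
  obtain ⟨M, h0, h1, h2⟩ := max_ergodic hp T (fun f hf x => cv_nonneg hV.1 hf x)
    (fun f => by change ∑ x, cv V f x = _; rw [sum_cv, hV.2, one_mul])
    (by ext x; change cv V (fun _ => 1) x = 1; simp [cv, hV.2]) f hf (2 ^ L)
  refine ⟨M, h0, fun i hi x => ?_, h2⟩
  have hpos : 0 < 2 ^ i := by positivity
  have := h1 (2 ^ i - 1) (by have := Nat.pow_le_pow_right (n := 2) (by norm_num) hi; omega) x
  rw [Nat.sub_add_cancel hpos] at this
  refine le_trans (le_of_eq ?_) this
  have e : ((2 ^ i - 1 : ℕ) : ℝ) + 1 = 2 ^ i := by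
    rw [Nat.cast_sub hpos]; push_cast; ring
  rw [e]
  unfold pker
  rw [cv_smul_left, cv_sum_left, div_eq_inv_mul]
  simp only [hT]

noncomputable def sker (V : G → ℝ) (L i : ℕ) : G → ℝ :=
  if i < L then fun x => pker V i x - pker V (i + 1) x else if i = L then pker V L else fun _ => 0

theorem sum_sker (L : ℕ) (x : G) : ∑ i ∈ range (L + 1), sker V L i x = dlt x := by
  rw [sum_range_succ]
  have : ∀ i ∈ range L, sker V L i x = pker V i x - pker V (i + 1) x := by
    intro i hi
    simp [sker, Finset.mem_range.1 hi]
  rw [sum_congr rfl this, sum_range_sub', pker_zero]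
  simp [sker]

end kernels

theorem rpow_conv {p a b : ℝ} (hp : 1 < p) (hp2 : p ≤ 2) (ha : 0 ≤ a) (hb : 0 ≤ b) {m : ℝ}
    (ham : a ≤ m) (hbm : b ≤ m) :
    p * (p - 1) / 2 * (b - a) ^ 2 ≤ (b ^ p - a ^ p - p * a ^ (p - 1) * (b - a)) * m ^ (2 - p) := by
  have hm : 0 ≤ m := ha.trans ham
  have hp0 : 0 < p := by linarith
  rcases eq_or_lt_of_le hm with hm0 | hm0
  · have : a = 0 := by linarith
    have : b = 0 := by linarith
    subst_vars; simp
  set c := p * (p - 1) / 2 * m ^ (p - 2) with hc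
  set φ : ℝ → ℝ := fun t => t ^ p - c * t ^ 2 with hφ
  have hd : ∀ t, HasDerivAt φ (p * t ^ (p - 1) - c * (2 * t)) t := by
    intro t
    have h1 := hasDerivAt_rpow_const (x := t) (p := p) (Or.inr hp.le)
    have h2 := ((hasDerivAt_pow 2 t).const_mul c)
    have h3 := h1.sub h2
    simp only [Nat.cast_ofNat, Nat.add_one_sub_one, pow_one] at h3
    exact h3
  have hconv : ConvexOn ℝ (Set.Icc 0 m) φ := by
    refine convexOn_of_hasDerivWithinAt2_nonneg (convex_Icc 0 m)
      (f' := fun t => p * t ^ (p - 1) - c * (2 * t))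
      (f'' := fun t => p * ((p - 1) * t ^ (p - 2)) - c * 2) ?_ ?_ ?_ ?_
    · exact fun t _ => (hd t).continuousAt.continuousWithinAt
    · exact fun t _ => (hd t).hasDerivWithinAt
    · intro t ht
      rw [interior_Icc] at ht
      have h1 := (hasDerivAt_rpow_const (x := t) (p := p - 1) (Or.inl ht.1.ne')).const_mul p
      have h2 := ((hasDerivAt_id' t).const_mul 2).const_mul c
      have := (h1.sub h2).hasDerivWithinAt (s := interior (Set.Icc 0 m))
      rw [show p - 1 - 1 = p - 2 by ring, mul_one] at this
      exact this
    · intro t ht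
      rw [interior_Icc] at ht
      have : m ^ (p - 2) ≤ t ^ (p - 2) :=
        rpow_le_rpow_of_nonpos ht.1 ht.2.le (by linarith)
      have h3 : 0 < p * (p - 1) := by nlinarith
      simp only [hc]
      nlinarith
  have htan : φ a + (p * a ^ (p - 1) - c * (2 * a)) * (b - a) ≤ φ b := by
    rcases lt_trichotomy a b with h | h | h
    · have := hconv.le_slope_of_hasDerivAt ⟨ha, ham⟩ ⟨hb, hbm⟩ h (hd a)
      rw [slope_def_field, le_div_iff₀ (by linarith)] at this
      linarith
    · subst h; simp
    · have := hconv.slope_le_of_hasDerivAt ⟨hb, hbm⟩ ⟨ha, ham⟩ h (hd a)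
      rw [slope_def_field, div_le_iff₀ (by linarith)] at this
      linarith
  have h1 : c * (b - a) ^ 2 ≤ b ^ p - a ^ p - p * a ^ (p - 1) * (b - a) := by
    simp only [hφ] at htan; linarith
  have h2 : m ^ (p - 2) * m ^ (2 - p) = 1 := by
    rw [← rpow_add hm0]; simp
  calc p * (p - 1) / 2 * (b - a) ^ 2
      = c * (b - a) ^ 2 * m ^ (2 - p) := by
        simp only [hc]; linear_combination (-(p * (p - 1) / 2 * (b - a) ^ 2)) * h2
    _ ≤ _ := mul_le_mul_of_nonneg_right h1 (rpow_nonneg hm _)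

theorem rpow_tangent {p a b : ℝ} (hp : 1 < p) (hp2 : p ≤ 2) (ha : 0 ≤ a) (hb : 0 ≤ b) :
    0 ≤ b ^ p - a ^ p - p * a ^ (p - 1) * (b - a) := by
  have hm : 0 < a + b + 1 := by linarith
  have h := rpow_conv hp hp2 ha hb (m := a + b + 1) (by linarith) (by linarith)
  have h0 : 0 ≤ p * (p - 1) / 2 * (b - a) ^ 2 := by
    have : 0 < p - 1 := by linarith
    positivity
  by_contra hc
  push Not at hc
  have := mul_neg_of_neg_of_pos hc (rpow_pos_of_pos hm (2 - p))
  linarith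

noncomputable def CLP (p : ℝ) : ℝ :=
  (4 / (p * (p - 1))) ^ (1 / 2 : ℝ) * (p / (p - 1)) ^ ((2 - p) / 2)

section LP
variable {G : Type*} [Fintype G] [AddCommGroup G] {V : G → ℝ}

theorem lp_step (hV : IsProb V) {p : ℝ} (hp : 1 < p) (hp2 : p ≤ 2) (i : ℕ) (u : G → ℝ)
    (hu : ∀ x, 0 ≤ u x) (x : G) {m : ℝ} (h1 : u x ≤ m) (h2 : cv (qker V i) u x ≤ m) :
    (u x - cv (qker V i) u x) ^ 2 ≤ 4 / (p * (p - 1)) *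
      (cv (qker V i) (fun y => u y ^ p) x - cv (qker V i) u x ^ p) * m ^ (2 - p) := by
  have hK := qker_prob hV i
  set K := qker V i
  set w := cv K u x with hw
  have hw0 : 0 ≤ w := cv_nonneg hK.1 hu x
  have hK0 : 1 / 2 ≤ K 0 := by
    have := (vpow_prob hV (2 ^ i)).1 (0 : G)
    simp only [K, qker, dlt, if_true]; linarith
  have e : ∑ y, K y * (u (x - y) ^ p - w ^ p - p * w ^ (p - 1) * (u (x - y) - w)) =
      cv K (fun y => u y ^ p) x - w ^ p := by
    have : ∀ y, K y * (u (x - y) ^ p - w ^ p - p * w ^ (p - 1) * (u (x - y) - w)) =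
        K y * u (x - y) ^ p - (w ^ p - p * w ^ (p - 1) * w) * K y
          - p * w ^ (p - 1) * (K y * u (x - y)) := fun y => by ring
    simp only [this, sum_sub_distrib, ← mul_sum, hK.2]
    change cv K (fun y => u y ^ p) x - _ - _ * cv K u x = _
    rw [← hw]; ring
  have hge : K 0 * (u x ^ p - w ^ p - p * w ^ (p - 1) * (u x - w)) ≤
      cv K (fun y => u y ^ p) x - w ^ p := by
    rw [← e]
    have := single_le_sum
      (f := fun y => K y * (u (x - y) ^ p - w ^ p - p * w ^ (p - 1) * (u (x - y) - w)))
      (fun y _ => mul_nonneg (hK.1 y) (rpow_tangent hp hp2 hw0 (hu _))) (mem_univ (0 : G))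
    simpa using this
  have ht := rpow_tangent hp hp2 hw0 (hu x)
  have hc := rpow_conv hp hp2 hw0 (hu x) h2 h1
  set br := u x ^ p - w ^ p - p * w ^ (p - 1) * (u x - w)
  have hbr : br ≤ 2 * (cv K (fun y => u y ^ p) x - w ^ p) := by nlinarith
  have hm : 0 ≤ m := (hu x).trans h1
  have hmp := rpow_nonneg hm (2 - p)
  have hpp : 0 < p * (p - 1) := by nlinarith
  have h3 : p * (p - 1) / 2 * (u x - w) ^ 2 ≤
      2 * (cv K (fun y => u y ^ p) x - w ^ p) * m ^ (2 - p) :=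
    hc.trans (mul_le_mul_of_nonneg_right hbr hmp)
  rw [div_mul_eq_mul_div, div_mul_eq_mul_div, le_div_iff₀ hpp]
  linarith

theorem lp_real (hV : IsProb V) {p : ℝ} (hp : 1 < p) (hp2 : p < 2) (L : ℕ) (f : G → ℝ)
    (hf : ∀ x, 0 ≤ f x) :
    NN p (fun x => NN 2 (fun i : Fin L => cv (pker V i) f x - cv (pker V (i + 1)) f x)) ≤
      CLP p * NN p f := by
  have hp0 : 0 < p := by linarith
  have hp1 : 0 < p - 1 := by linarith
  obtain ⟨M, hM0, hM, hMN⟩ := pker_max hV hp L f hf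
  set u : ℕ → G → ℝ := fun i => cv (pker V i) f with hu
  have hu0 : ∀ i x, 0 ≤ u i x := fun i x => cv_nonneg (pker_prob hV i).1 hf x
  have hus : ∀ i, u (i + 1) = cv (qker V i) (u i) := by
    intro i; simp only [hu]; rw [pker_succ', cv_assoc]
  set W : G → ℝ := fun x => ∑ i ∈ range L,
    (cv (qker V i) (fun y => u i y ^ p) x - u (i + 1) x ^ p) with hW
  set c0 := 4 / (p * (p - 1)) with hc0
  have hc0' : 0 < c0 := by positivity
  have hWi : ∀ i x, 0 ≤ cv (qker V i) (fun y => u i y ^ p) x - u (i + 1) x ^ p := by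
    intro i x
    have := lp_step hV hp hp2.le i (u i) (hu0 i) x (m := u i x + u (i + 1) x + 1)
      (by linarith [hu0 (i + 1) x]) (by rw [← hus]; linarith [hu0 i x])
    rw [← hus] at this
    by_contra hc
    push Not at hc
    have hm : 0 < u i x + u (i + 1) x + 1 := by linarith [hu0 (i + 1) x, hu0 i x]
    have h1 := mul_neg_of_neg_of_pos (mul_neg_of_pos_of_neg hc0' hc)
      (rpow_pos_of_pos hm (2 - p))
    have := sq_nonneg (u i x - u (i + 1) x)
    linarith
  have hW0 : ∀ x, 0 ≤ W x := fun x => sum_nonneg fun i _ => hWi i x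
  have hsumW : ∑ x, W x ≤ NN p f ^ p := by
    simp only [hW]
    rw [sum_comm]
    have : ∀ i ∈ range L, ∑ x, (cv (qker V i) (fun y => u i y ^ p) x - u (i + 1) x ^ p) =
        (∑ x, u i x ^ p) - ∑ x, u (i + 1) x ^ p := by
      intro i _
      rw [sum_sub_distrib, sum_cv, (qker_prob hV i).2, one_mul]
    rw [sum_congr rfl this, sum_range_sub', NN_pow hp0]
    have h0 : ∑ x, u 0 x ^ p = ∑ x, ‖f x‖ ^ p := by
      refine sum_congr rfl fun x _ => ?_
      simp only [hu]; rw [pker_zero, cv_dlt, norm_of_nonneg (hf x)]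
    rw [h0]
    have : 0 ≤ ∑ x, u L x ^ p := sum_nonneg fun x _ => rpow_nonneg (hu0 L x) _
    linarith
  have hpt : ∀ x, ∑ i : Fin L, ‖u i x - u (i + 1) x‖ ^ (2 : ℝ) ≤ c0 * W x * M x ^ (2 - p) := by
    intro x
    simp only [hW, mul_sum, sum_mul]
    rw [← Fin.sum_univ_eq_sum_range (fun i => c0 *
      (cv (qker V i) (fun y => u i y ^ p) x - u (i + 1) x ^ p) * M x ^ (2 - p))]
    refine sum_le_sum fun i _ => ?_
    have := lp_step hV hp hp2.le i (u i) (hu0 i) x (m := M x) (hM i i.2.le x)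
      (by rw [← hus]; exact hM (i + 1) i.2 x)
    rw [← hus] at this
    simpa using this
  have hCn : 0 ≤ CLP p := by unfold CLP; positivity
  set F := NN p f
  have hF : 0 ≤ F := NN_nonneg _ _
  refine NN_le_of_sum hp0 (mul_nonneg hCn hF) ?_
  have hpt2 : ∀ x, ‖NN 2 (fun i : Fin L => u i x - u (i + 1) x)‖ ^ p ≤
      c0 ^ (p / 2) * (W x ^ (p / 2) * (M x ^ p) ^ ((2 - p) / 2)) := by
    intro x
    rw [norm_of_nonneg (NN_nonneg _ _)]
    unfold NN
    rw [← rpow_mul (NN_sum_nonneg _ _), show 1 / 2 * p = p / 2 by ring]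
    refine (rpow_le_rpow (NN_sum_nonneg _ _) (hpt x) (by positivity)).trans (le_of_eq ?_)
    rw [mul_rpow (mul_nonneg hc0'.le (hW0 x)) (rpow_nonneg (hM0 x) _),
      mul_rpow hc0'.le (hW0 x), ← rpow_mul (hM0 x), ← rpow_mul (hM0 x), mul_assoc]
    congr 3; ring
  refine (sum_le_sum fun x _ => hpt2 x).trans ?_
  rw [← mul_sum]
  have hcj : (2 / p).HolderConjugate (2 / (2 - p)) := by
    rw [holderConjugate_iff]
    have : 0 < 2 - p := by linarith
    refine ⟨by rw [lt_div_iff₀ hp0]; linarith, by field_simp; ring⟩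
  have hh := inner_le_Lp_mul_Lq_of_nonneg univ hcj
    (f := fun x => W x ^ (p / 2)) (g := fun x => (M x ^ p) ^ ((2 - p) / 2))
    (fun x _ => rpow_nonneg (hW0 x) _) (fun x _ => rpow_nonneg (rpow_nonneg (hM0 x) _) _)
  have g1 : ∀ x, (W x ^ (p / 2)) ^ (2 / p) = W x := by
    intro x; rw [← rpow_mul (hW0 x), show p / 2 * (2 / p) = 1 by field_simp, rpow_one]
  have g2 : ∀ x, ((M x ^ p) ^ ((2 - p) / 2)) ^ (2 / (2 - p)) = M x ^ p := by
    intro x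
    have : 2 - p ≠ 0 := by linarith
    rw [← rpow_mul (rpow_nonneg (hM0 x) _), show (2 - p) / 2 * (2 / (2 - p)) = 1 by
      field_simp, rpow_one]
  simp only [g1, g2, one_div_div] at hh
  have hMsum : ∑ x, M x ^ p ≤ (p / (p - 1) * F) ^ p := by
    have := NN_sum_le_of hp0 hMN
    simpa [abs_of_nonneg (hM0 _)] using this
  calc c0 ^ (p / 2) * ∑ x, W x ^ (p / 2) * (M x ^ p) ^ ((2 - p) / 2)
      ≤ c0 ^ (p / 2) * ((∑ x, W x) ^ (p / 2) * (∑ x, M x ^ p) ^ ((2 - p) / 2)) :=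
        mul_le_mul_of_nonneg_left hh (by positivity)
    _ ≤ c0 ^ (p / 2) * ((F ^ p) ^ (p / 2) * ((p / (p - 1) * F) ^ p) ^ ((2 - p) / 2)) := by
        have n1 : 0 ≤ ∑ x, W x := sum_nonneg fun x _ => hW0 x
        have n2 : 0 ≤ ∑ x, M x ^ p := sum_nonneg fun x _ => rpow_nonneg (hM0 x) _
        refine mul_le_mul_of_nonneg_left (mul_le_mul (rpow_le_rpow n1 hsumW (by positivity))
          (rpow_le_rpow n2 hMsum (by linarith)) (by positivity) (by positivity)) (by positivity)
    _ = (CLP p * F) ^ p := by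
        have hpq : 0 ≤ p / (p - 1) := by positivity
        unfold CLP
        rw [mul_rpow hpq hF, mul_rpow (by positivity) (by positivity),
          mul_rpow (by positivity) hF, mul_rpow (by positivity) (by positivity)]
        rw [← hc0]
        simp only [← rpow_mul hF, ← rpow_mul hpq, ← rpow_mul hc0'.le]
        have : F ^ (p * (p / 2)) * F ^ (p * ((2 - p) / 2)) = F ^ p := by
          have h2p : 0 < 2 - p := by linarith
          rw [← rpow_add_of_nonneg hF (by positivity) (by positivity)]
          congr 1; ring
        rw [← this, show 1 / 2 * p = p / 2 by ring, show (2 - p) / 2 * p = p * ((2 - p) / 2) by ring]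
        ring

end LP

section LPC
variable {G : Type*} [Fintype G] [AddCommGroup G] {V : G → ℝ}

theorem NN2_snoc {n : ℕ} {E : Type*} [NormedAddCommGroup E] (f : Fin (n + 1) → E) :
    NN 2 f ≤ NN 2 (fun i : Fin n => f i.castSucc) + ‖f (Fin.last n)‖ := by
  have h0 := NN_nonneg 2 (fun i : Fin n => f i.castSucc)
  refine abs_le_of_sq_le_sq' ?_ (by positivity) |>.2
  have h1 := NN_two_sq f
  have h2 := NN_two_sq (fun i : Fin n => f i.castSucc)
  rw [Fin.sum_univ_castSucc] at h1
  have := norm_nonneg (f (Fin.last n))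
  nlinarith

noncomputable def sqf (V : G → ℝ) (L : ℕ) (f : G → ℂ) (x : G) : ℝ :=
  NN 2 (fun i : Fin (L + 1) => cv (cx (sker V L i)) f x)

theorem sqf_nonneg (L : ℕ) (f : G → ℂ) (x : G) : 0 ≤ sqf V L f x := NN_nonneg _ _

theorem sqf_smul (L : ℕ) (c : ℂ) (f : G → ℂ) (x : G) :
    sqf V L (fun y => c * f y) x = ‖c‖ * sqf V L f x := by
  unfold sqf
  rw [← NN_const_mul (by norm_num)]
  simp only [cv_smul]

theorem sqf_add (L : ℕ) (f g : G → ℂ) (x : G) :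
    sqf V L (fun y => f y + g y) x ≤ sqf V L f x + sqf V L g x := by
  unfold sqf
  simp only [cv_add]
  exact NN_add_le (by norm_num) _ _

theorem sqf_nn (hV : IsProb V) {p : ℝ} (hp : 1 < p) (hp2 : p < 2) (L : ℕ) (f : G → ℝ)
    (hf : ∀ x, 0 ≤ f x) : NN p (sqf V L (cx f)) ≤ (CLP p + 1) * NN p f := by
  have hp0 : 0 < p := by linarith
  have h : ∀ x, ‖sqf V L (cx f) x‖ ≤
      NN 2 (fun i : Fin L => cv (pker V i) f x - cv (pker V (i + 1)) f x) + ‖cv (pker V L) f x‖ := by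
    intro x
    rw [norm_of_nonneg (sqf_nonneg L _ x)]
    refine (NN2_snoc _).trans (le_of_eq ?_)
    congr 1
    · refine NN_congr fun i => ?_
      rw [cv_cx, norm_real, ← cv_sub_left]
      simp [sker]
    · rw [cv_cx, norm_real]; simp [sker]
  refine (NN_mono' hp0 h).trans ((NN_add_le hp.le _ _).trans ?_)
  rw [add_mul, one_mul]
  refine add_le_add (lp_real hV hp hp2 L f hf) ?_
  rw [NN_norm]
  exact (pker_prob hV L).NN_cv_le hp.le f

theorem sqf_sub (L : ℕ) (f g : G → ℂ) (x : G) :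
    sqf V L (fun y => f y - g y) x ≤ sqf V L f x + sqf V L g x := by
  have := sqf_add (V := V) L f (fun y => -1 * g y) x
  rw [sqf_smul] at this
  simpa [sub_eq_add_neg] using this

theorem sqf_re (hV : IsProb V) {p : ℝ} (hp : 1 < p) (hp2 : p < 2) (L : ℕ) (f : G → ℝ) :
    NN p (sqf V L (cx f)) ≤ 2 * (CLP p + 1) * NN p f := by
  have hp0 : 0 < p := by linarith
  have hC : 0 ≤ CLP p + 1 := by
    have : 0 < p - 1 := by linarith
    unfold CLP; positivity
  have h : ∀ x, ‖sqf V L (cx f) x‖ ≤ sqf V L (cx fun x => max (f x) 0) x +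
      sqf V L (cx fun x => max (- f x) 0) x := by
    intro x
    rw [norm_of_nonneg (sqf_nonneg L _ x)]
    refine le_trans (le_of_eq ?_) (sqf_sub L _ _ x)
    congr 1
    funext y
    simp only [cx]
    rw [← Complex.ofReal_sub]
    congr 1
    rcases le_total (f y) 0 with h | h
    · rw [max_eq_right h, max_eq_left (by linarith)]; ring
    · rw [max_eq_left h, max_eq_right (by linarith)]; ring
  refine (NN_mono' hp0 h).trans ((NN_add_le hp.le _ _).trans ?_)
  have h1 := sqf_nn hV hp hp2 L (fun x => max (f x) 0) (fun x => le_max_right _ _)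
  have h2 := sqf_nn hV hp hp2 L (fun x => max (- f x) 0) (fun x => le_max_right _ _)
  have m1 : NN p (fun x => max (f x) 0) ≤ NN p f := NN_mono hp0 fun x => by
    rw [norm_of_nonneg (le_max_right _ _), norm_eq_abs]
    exact max_le (le_abs_self _) (abs_nonneg _)
  have m2 : NN p (fun x => max (- f x) 0) ≤ NN p f := NN_mono hp0 fun x => by
    rw [norm_of_nonneg (le_max_right _ _), norm_eq_abs]
    exact max_le (neg_le_abs _) (abs_nonneg _)
  nlinarith

theorem sqf_cx (hV : IsProb V) {p : ℝ} (hp : 1 < p) (hp2 : p < 2) (L : ℕ) (f : G → ℂ) :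
    NN p (sqf V L f) ≤ 4 * (CLP p + 1) * NN p f := by
  have hp0 : 0 < p := by linarith
  have hC : 0 ≤ CLP p + 1 := by
    have : 0 < p - 1 := by linarith
    unfold CLP; positivity
  have h : ∀ x, ‖sqf V L f x‖ ≤ sqf V L (cx fun x => (f x).re) x +
      sqf V L (cx fun x => (f x).im) x := by
    intro x
    rw [norm_of_nonneg (sqf_nonneg L _ x)]
    have h1 := sqf_smul (V := V) L I (cx fun x => (f x).im) x
    rw [norm_I, one_mul] at h1
    rw [← h1]
    refine le_trans (le_of_eq ?_) (sqf_add L _ _ x)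
    congr 1
    funext y
    simp only [cx]
    rw [mul_comm I, re_add_im]
  refine (NN_mono' hp0 h).trans ((NN_add_le hp.le _ _).trans ?_)
  have h1 := sqf_re hV hp hp2 L (fun x => (f x).re)
  have h2 := sqf_re hV hp hp2 L (fun x => (f x).im)
  have m1 : NN p (fun x => (f x).re) ≤ NN p f := NN_mono hp0 fun x => abs_re_le_norm _
  have m2 : NN p (fun x => (f x).im) ≤ NN p f := NN_mono hp0 fun x => Complex.abs_im_le_norm _
  nlinarith

end LPC

section symb
variable {G : Type*} [Fintype G] [AddCommGroup G] {V : G → ℝ}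

theorem hat_dlt (χ : AddChar G ℂ) : hat (cx (dlt : G → ℝ)) χ = 1 := by
  classical
  unfold hat cx dlt
  rw [sum_eq_single 0]
  · simp
  · intro b _ hb; simp [hb]
  · simp

theorem cx_cv (K f : G → ℝ) : cx (cv K f) = cv (cx K) (cx f) := funext fun x => (cv_cx K f x).symm

theorem hat_vpow {χ : AddChar G ℂ} {v : ℝ} (hv : hat (cx V) χ = v) (m : ℕ) :
    hat (cx (vpow V m)) χ = ((v ^ m : ℝ) : ℂ) := by
  induction m with
  | zero => simpa [vpow] using hat_dlt χ
  | succ n ih =>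
    rw [vpow, cx_cv, hat_cv, ih, hv]; push_cast; ring

noncomputable def psym (v : ℝ) (k : ℕ) : ℝ := (2 ^ k : ℝ)⁻¹ * ∑ m ∈ range (2 ^ k), v ^ m

theorem hat_pker {χ : AddChar G ℂ} {v : ℝ} (hv : hat (cx V) χ = v) (k : ℕ) :
    hat (cx (pker V k)) χ = psym v k := by
  have : cx (pker V k) = fun x => ((2 ^ k : ℂ)⁻¹) * ∑ m ∈ range (2 ^ k), cx (vpow V m) x := by
    funext x; simp [cx, pker]
  rw [this, hat_smul, hat_sum]
  simp only [hat_vpow hv, psym]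
  push_cast; rfl

theorem psym_nonneg {v : ℝ} (hv : 0 ≤ v) (k : ℕ) : 0 ≤ psym v k := by unfold psym; positivity

theorem psym_le_one {v : ℝ} (hv : 0 ≤ v) (hv1 : v ≤ 1) (k : ℕ) : psym v k ≤ 1 := by
  unfold psym
  rw [inv_mul_le_iff₀ (by positivity)]
  refine (sum_le_sum fun m _ => pow_le_one₀ hv hv1).trans ?_
  simp

theorem psym_decay {v : ℝ} (hv : 0 ≤ v) (k : ℕ) : psym v k * (2 ^ k * (1 - v)) ≤ 1 := by
  have h := geom_sum_mul_neg v (2 ^ k)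
  have : psym v k * (2 ^ k * (1 - v)) = (∑ m ∈ range (2 ^ k), v ^ m) * (1 - v) := by
    unfold psym; field_simp
  rw [this, h]
  have : 0 ≤ v ^ (2 ^ k) := by positivity
  linarith

theorem psym_near {v : ℝ} (hv : 0 ≤ v) (hv1 : v ≤ 1) (k : ℕ) : 1 - psym v k ≤ 2 ^ k * (1 - v) := by
  have h : ∀ m ∈ range (2 ^ k), 1 - 2 ^ k * (1 - v) ≤ v ^ m := by
    intro m hm
    have h1 := one_add_mul_le_pow (a := v - 1) (by linarith) m
    have h2 : (m : ℝ) ≤ 2 ^ k := by exact_mod_cast (Finset.mem_range.1 hm).le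
    have : v ^ m = (1 + (v - 1)) ^ m := by ring
    rw [this]
    nlinarith
  have h3 := sum_le_sum h
  simp only [sum_const, card_range, nsmul_eq_mul] at h3
  unfold psym
  have : (0 : ℝ) < 2 ^ k := by positivity
  push_cast at h3
  have := (le_inv_mul_iff₀ this).2 h3
  linarith

theorem psym_succ (v : ℝ) (k : ℕ) : psym v (k + 1) = psym v k * ((1 + v ^ (2 ^ k)) / 2) := by
  unfold psym
  rw [show (2 : ℕ) ^ (k + 1) = 2 ^ k + 2 ^ k by ring, sum_range_add]
  simp only [pow_add, ← mul_sum, pow_one]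
  field_simp

noncomputable def ssym (v : ℝ) (L i : ℕ) : ℝ :=
  if i < L then psym v i - psym v (i + 1) else if i = L then psym v L else 0

theorem hat_sker {χ : AddChar G ℂ} {v : ℝ} (hv : hat (cx V) χ = v) (L k : ℕ) :
    hat (cx (sker V L k)) χ = ssym v L k := by
  unfold ssym sker
  split_ifs
  · have : cx (fun x => pker V k x - pker V (k + 1) x) =
        fun x => cx (pker V k) x - cx (pker V (k + 1)) x := by funext x; simp [cx]
    rw [this, hat_sub, hat_pker hv, hat_pker hv]; push_cast; rfl
  · exact hat_pker hv L
  · simp [hat, cx]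

theorem psym_succ_le {v : ℝ} (hv : 0 ≤ v) (hv1 : v ≤ 1) (k : ℕ) : psym v (k + 1) ≤ psym v k := by
  rw [psym_succ]
  have := pow_le_one₀ hv hv1 (n := 2 ^ k)
  exact mul_le_of_le_one_right (psym_nonneg hv k) (by linarith)

theorem ssym_nonneg {v : ℝ} (hv : 0 ≤ v) (hv1 : v ≤ 1) (L i : ℕ) : 0 ≤ ssym v L i := by
  unfold ssym
  split_ifs
  · linarith [psym_succ_le hv hv1 i]
  · exact psym_nonneg hv L
  · rfl

theorem ssym_sum (v : ℝ) (L : ℕ) : ∑ i ∈ range (L + 1), ssym v L i = 1 := by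
  rw [sum_range_succ]
  have : ∀ i ∈ range L, ssym v L i = psym v i - psym v (i + 1) := by
    intro i hi
    simp [ssym, Finset.mem_range.1 hi]
  rw [sum_congr rfl this, sum_range_sub']
  simp [ssym, psym]

theorem ssym_decay {v : ℝ} (hv : 0 ≤ v) (hv1 : v ≤ 1) (L i : ℕ) :
    ssym v L i * (2 ^ i * (1 - v)) ≤ 1 := by
  have h2 : 0 ≤ 2 ^ i * (1 - v) := mul_nonneg (by positivity) (by linarith)
  unfold ssym
  split_ifs with h h1
  · refine le_trans ?_ (psym_decay hv i)
    gcongr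
    linarith [psym_nonneg hv (i + 1)]
  · subst h1; exact psym_decay hv i
  · simp

theorem ssym_le_one {v : ℝ} (hv : 0 ≤ v) (hv1 : v ≤ 1) (L i : ℕ) : ssym v L i ≤ 1 := by
  unfold ssym
  split_ifs with h h1
  · linarith [psym_nonneg hv (i + 1), psym_le_one hv hv1 i]
  · exact psym_le_one hv hv1 L
  · norm_num

theorem ssym_near {v : ℝ} (hv : 0 ≤ v) (hv1 : v ≤ 1) {L i : ℕ} (h : i < L) :
    ssym v L i ≤ 2 * (2 ^ i * (1 - v)) := by
  have h2 := psym_near hv hv1 (i + 1)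
  have := psym_le_one hv hv1 i
  rw [ssym, if_pos h]
  rw [pow_succ] at h2
  linarith

theorem symb_key {v : ℝ} (hv : 0 ≤ v) (hv1 : v ≤ 1) {L i k : ℕ} (hk : k ≤ L) {γ : ℂ} {C : ℝ}
    (hC : 1 ≤ C) (h1 : ‖γ - 1‖ ≤ C * (2 ^ k * (1 - v))) (h2 : ‖γ‖ ≤ 1)
    (h3 : ‖γ‖ ^ 2 * (2 ^ k * (1 - v)) ≤ C) :
    ‖γ - psym v k‖ ^ 2 * ssym v L i ≤ 8 * C * (1 / 2) ^ (max i k - min i k) := by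
  have hv' : 0 ≤ 1 - v := by linarith
  have p0 := psym_nonneg hv k
  have p1 := psym_le_one hv hv1 k
  have pd := psym_decay hv k
  have pn := psym_near hv hv1 k
  have s0 := ssym_nonneg hv hv1 L i
  have hy : (0 : ℝ) ≤ 2 ^ k * (1 - v) := by positivity
  set y : ℝ := 2 ^ k * (1 - v) with hyd
  set ϖ := psym v k
  set e := ‖γ - ϖ‖ with he
  have e0 : 0 ≤ e := norm_nonneg _
  have e1 : e ≤ ‖γ‖ + ϖ := by
    refine (norm_sub_le _ _).trans ?_
    rw [norm_real, norm_of_nonneg p0]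
  have e2 : e ≤ 2 * C * y := by
    have : γ - ϖ = (γ - 1) + ((1 - ϖ : ℝ) : ℂ) := by push_cast; ring
    rw [he, this]
    refine (norm_add_le _ _).trans ?_
    rw [norm_real, norm_of_nonneg (by linarith)]
    nlinarith
  rcases le_or_gt k i with hki | hki
  · rw [max_eq_left hki, min_eq_right hki]
    have hd := ssym_decay hv hv1 L i
    have hpow : (2 : ℝ) ^ i = 2 ^ k * 2 ^ (i - k) := by rw [← pow_add]; congr 1; omega
    have h4 : ssym v L i * y * 2 ^ (i - k) ≤ 1 := by
      rw [hpow] at hd; rw [hyd]; linarith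
    rw [one_div, inv_pow, ← div_eq_mul_inv, le_div_iff₀ (by positivity)]
    have h5 : e ^ 2 ≤ 4 * C * y := by nlinarith
    calc e ^ 2 * ssym v L i * 2 ^ (i - k) ≤ 4 * C * y * ssym v L i * 2 ^ (i - k) := by gcongr
      _ = 4 * C * (ssym v L i * y * 2 ^ (i - k)) := by ring
      _ ≤ 4 * C * 1 := by gcongr
      _ ≤ 8 * C := by linarith
  · rw [max_eq_right hki.le, min_eq_left hki.le]
    have hd := ssym_near hv hv1 (hki.trans_le hk)
    have hpow : (2 : ℝ) ^ k = 2 ^ i * 2 ^ (k - i) := by rw [← pow_add]; congr 1; omega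
    rw [one_div, inv_pow, ← div_eq_mul_inv, le_div_iff₀ (by positivity)]
    have h5 : e ^ 2 * y ≤ 4 * C := by
      have : e ^ 2 ≤ 2 * ‖γ‖ ^ 2 + 2 * ϖ ^ 2 := by nlinarith [sq_nonneg (‖γ‖ - ϖ), norm_nonneg γ]
      have : ϖ ^ 2 * y ≤ 1 := by nlinarith
      nlinarith
    calc e ^ 2 * ssym v L i * 2 ^ (k - i) ≤ e ^ 2 * (2 * (2 ^ i * (1 - v))) * 2 ^ (k - i) := by gcongr
      _ = 2 * (e ^ 2 * y) := by rw [hyd, hpow]; ring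
      _ ≤ 8 * C := by linarith

end symb

section VV
variable {G : Type*} [Fintype G] [AddCommGroup G]

theorem holder_pt {X : Type*} (s : Finset X) {θ : ℝ} (h0 : 0 < θ) (h1 : θ < 1) (A u v : X → ℝ)
    (hA : ∀ y, 0 ≤ A y) (hu : ∀ y, 0 ≤ u y) (hv : ∀ y, 0 ≤ v y) :
    ∑ y ∈ s, A y * (u y ^ (1 - θ) * v y ^ θ) ≤
      (∑ y ∈ s, A y * u y) ^ (1 - θ) * (∑ y ∈ s, A y * v y) ^ θ := by
  have h1' : 0 < 1 - θ := by linarith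
  have hcj : (1 / (1 - θ)).HolderConjugate (1 / θ) := by
    rw [holderConjugate_iff]
    refine ⟨by rw [lt_div_iff₀ h1']; linarith, by field_simp; ring⟩
  have hh := inner_le_Lp_mul_Lq_of_nonneg s hcj
    (f := fun y => (A y * u y) ^ (1 - θ)) (g := fun y => (A y * v y) ^ θ)
    (fun y _ => rpow_nonneg (mul_nonneg (hA y) (hu y)) _)
    (fun y _ => rpow_nonneg (mul_nonneg (hA y) (hv y)) _)
  have e1 : ∀ y, ((A y * u y) ^ (1 - θ)) ^ (1 / (1 - θ)) = A y * u y := fun y => by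
    rw [← rpow_mul (mul_nonneg (hA y) (hu y)), mul_one_div_cancel h1'.ne', rpow_one]
  have e2 : ∀ y, ((A y * v y) ^ θ) ^ (1 / θ) = A y * v y := fun y => by
    rw [← rpow_mul (mul_nonneg (hA y) (hv y)), mul_one_div_cancel h0.ne', rpow_one]
  simp only [e1, e2, one_div_one_div] at hh
  refine le_trans (le_of_eq (sum_congr rfl fun y _ => ?_)) hh
  rw [mul_rpow (hA y) (hu y), mul_rpow (hA y) (hv y)]
  have : A y = A y ^ (1 - θ) * A y ^ θ := by
    rw [← rpow_add_of_nonneg (hA y) h1'.le h0.le]; simp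
  nth_rewrite 1 [this]; ring

variable {T : Type*}

def Valid (A : T → G → ℝ) (p B : ℝ) : Prop :=
  ∀ (τ : G → T) (f : G → ℝ), (∀ x, 0 ≤ f x) → NN p (fun x => cv (A (τ x)) f x) ≤ B * NN p f

def Local (A : T → G → ℝ) (oct : T → ℕ) (p C : ℝ) : Prop :=
  ∀ (k : ℕ) (u : G → ℝ), (∀ x, 0 ≤ u x) → ∃ H : G → ℝ, (∀ x, 0 ≤ H x) ∧
    (∀ t, oct t = k → ∀ x, cv (A t) u x ≤ H x) ∧ NN p H ≤ C * NN p u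

theorem vv {A : T → G → ℝ} {oct : T → ℕ} (hA : ∀ t x, 0 ≤ A t x) {p1 p s θ C1 B : ℝ} (hp1 : 1 < p1)
    (hpp : p1 < p) (hp2 : p < 2) (hθ : θ = 1 - p1 / 2) (hs : 1 / s = 1 / 2 + θ / p) (hs0 : 0 < s)
    (hC1 : 0 ≤ C1) (hB : 0 ≤ B)
    (hloc : Local A oct p1 C1) (hval : Valid A p B) {L : ℕ} (hoct : ∀ t, oct t ≤ L)
    (τ : G → T) (g : Fin (L + 1) → G → ℝ) (hg : ∀ k x, 0 ≤ g k x) :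
    NN s (fun x => cv (A (τ x)) (g ⟨oct (τ x), Nat.lt_succ_of_le (hoct _)⟩) x) ≤
      C1 ^ (p1 / 2) * B ^ θ * NN s (fun x => NN 2 (fun k => g k x)) := by
  have hθ0 : 0 < θ := by rw [hθ]; linarith
  have hθ1 : θ < 1 := by rw [hθ]; linarith
  have hp0 : 0 < p := by linarith
  have hp10 : 0 < p1 := by linarith
  set h : G → ℝ := fun x => NN 2 (fun k => g k x) with hh
  have hh0 : ∀ x, 0 ≤ h x := fun x => NN_nonneg _ _
  set u : Fin (L + 1) → G → ℝ := fun k x => (h x ^ (s / 2) * (g k x / h x)) ^ (2 / p1) with hu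
  set v : G → ℝ := fun x => h x ^ (s / p) with hv
  have hb0 : ∀ k x, 0 ≤ h x ^ (s / 2) * (g k x / h x) := fun k x =>
    mul_nonneg (rpow_nonneg (hh0 x) _) (div_nonneg (hg k x) (hh0 x))
  have hu0 : ∀ k x, 0 ≤ u k x := fun k x => rpow_nonneg (hb0 k x) _
  have hv0 : ∀ x, 0 ≤ v x := fun x => rpow_nonneg (hh0 x) _
  have hgh : ∀ k x, g k x ≤ h x := fun k x => by
    have := le_NN (p := 2) (by norm_num) (fun k => g k x) k
    rwa [norm_of_nonneg (hg k x)] at this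
  have h1θ : 1 - θ = p1 / 2 := by rw [hθ]; ring
  have hfac : ∀ k x, g k x = u k x ^ (1 - θ) * v x ^ θ := by
    intro k x
    simp only [hu, hv]
    rw [← rpow_mul (hb0 k x), ← rpow_mul (hh0 x), h1θ,
      show 2 / p1 * (p1 / 2) = 1 by field_simp, rpow_one]
    rcases (hh0 x).eq_or_lt with h0 | h0
    · have : g k x = 0 := le_antisymm (by rw [h0]; exact hgh k x) (hg k x)
      rw [this]; simp
    · have : s / 2 + s / p * θ = 1 := by
        have : s * (1 / s) = 1 := by field_simp
        rw [hs] at this; rw [← this]; ring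
      rw [mul_right_comm, ← rpow_add h0, this, rpow_one]
      field_simp
  set κ : G → Fin (L + 1) := fun x => ⟨oct (τ x), Nat.lt_succ_of_le (hoct _)⟩ with hκ
  set α : G → ℝ := fun x => cv (A (τ x)) (u (κ x)) x with hα
  set β : G → ℝ := fun x => cv (A (τ x)) v x with hβ
  have hα0 : ∀ x, 0 ≤ α x := fun x => cv_nonneg (hA _) (hu0 _) x
  have hβ0 : ∀ x, 0 ≤ β x := fun x => cv_nonneg (hA _) hv0 x
  have hpt : ∀ x, cv (A (τ x)) (g (κ x)) x ≤ α x ^ (1 - θ) * β x ^ θ := by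
    intro x
    refine le_trans (le_of_eq ?_) (holder_pt univ hθ0 hθ1 (A (τ x)) (fun y => u (κ x) (x - y))
      (fun y => v (x - y)) (hA _) (fun y => hu0 _ _) (fun y => hv0 _))
    exact sum_congr rfl fun y _ => by rw [hfac]

  have hupow : ∀ x, ∑ k, u k x ^ p1 = h x ^ s := by
    intro x
    have e : ∀ k, u k x ^ p1 = h x ^ s * (g k x ^ 2 / h x ^ 2) := by
      intro k
      simp only [hu]
      rw [← rpow_mul (hb0 k x), show 2 / p1 * p1 = 2 by field_simp, mul_rpow
        (rpow_nonneg (hh0 x) _) (div_nonneg (hg k x) (hh0 x)), ← rpow_mul (hh0 x),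
        show s / 2 * 2 = s by ring, rpow_two, div_pow]
    simp only [e]
    rw [← mul_sum, ← sum_div]
    have := NN_two_sq (fun k => g k x)
    simp only [norm_eq_abs, sq_abs] at this
    rw [← this]
    rcases (hh0 x).eq_or_lt with h0 | h0
    · rw [← h0]; simp [hs0.ne']
    · change h x ^ s * (h x ^ 2 / h x ^ 2) = _
      rw [div_self (by positivity), mul_one]
  choose H hH0 hH hHN using fun k : Fin (L + 1) => hloc k (u k) (hu0 k)
  set E := ∑ x, h x ^ s with hE
  have hE0 : 0 ≤ E := sum_nonneg fun x _ => rpow_nonneg (hh0 x) _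
  have hαs : ∑ x, α x ^ p1 ≤ C1 ^ p1 * E := by
    calc ∑ x, α x ^ p1 ≤ ∑ x, ∑ k, H k x ^ p1 := by
          refine sum_le_sum fun x _ => ?_
          refine (rpow_le_rpow (hα0 x) (hH (κ x) (τ x) rfl x) hp10.le).trans ?_
          exact single_le_sum (f := fun k => H k x ^ p1)
            (fun k _ => rpow_nonneg (hH0 k x) _) (mem_univ (κ x))
      _ = ∑ k, ∑ x, H k x ^ p1 := sum_comm
      _ ≤ ∑ k, C1 ^ p1 * ∑ x, u k x ^ p1 := by
          refine sum_le_sum fun k _ => ?_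
          have := NN_sum_le_of hp10 (hHN k)
          rw [mul_rpow hC1 (NN_nonneg _ _), NN_pow hp10] at this
          simpa only [norm_of_nonneg (hH0 _ _), norm_of_nonneg (hu0 _ _)] using this
      _ = C1 ^ p1 * E := by
          rw [← mul_sum, sum_comm]
          simp only [hupow, hE]
  have hβs : ∑ x, β x ^ p ≤ B ^ p * E := by
    have := NN_sum_le_of hp0 (hval τ v hv0)
    rw [mul_rpow hB (NN_nonneg _ _), NN_pow hp0] at this
    simp only [norm_of_nonneg (hv0 _)] at this
    refine (le_of_eq (sum_congr rfl fun x _ => by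
      rw [← norm_of_nonneg (hβ0 x)])).trans ?_
    refine this.trans (le_of_eq ?_)
    congr 1
    refine sum_congr rfl fun x _ => ?_
    simp only [hv]
    rw [← rpow_mul (hh0 x), show s / p * p = s by field_simp]
  have hs1 : s / 2 + θ * s / p = 1 := by
    have : s * (1 / s) = 1 := by field_simp
    rw [hs] at this; rw [← this]; ring
  have hsθ : θ * s / p = 1 - s / 2 := by linarith
  have hsθ0 : 0 < θ * s / p := by positivity
  have hk := holder_pt univ (θ := θ * s / p) hsθ0 (by linarith [hs0])
    (fun _ : G => (1 : ℝ)) (fun x => α x ^ p1) (fun x => β x ^ p) (fun _ => zero_le_one)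
    (fun x => rpow_nonneg (hα0 x) _) (fun x => rpow_nonneg (hβ0 x) _)
  simp only [one_mul] at hk
  have hs' : 1 - θ * s / p = s / 2 := by linarith
  rw [hs'] at hk
  refine NN_le_of_sum hs0 (by have := NN_nonneg s h; positivity) ?_
  have hcv0 : ∀ x, 0 ≤ cv (A (τ x)) (g (κ x)) x := fun x => cv_nonneg (hA _) (hg _) x
  calc ∑ x, ‖cv (A (τ x)) (g (κ x)) x‖ ^ s
      ≤ ∑ x, (α x ^ p1) ^ (s / 2) * (β x ^ p) ^ (θ * s / p) := by
        refine sum_le_sum fun x _ => ?_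
        rw [norm_of_nonneg (hcv0 x)]
        refine (rpow_le_rpow (hcv0 x) (hpt x) hs0.le).trans (le_of_eq ?_)
        rw [mul_rpow (rpow_nonneg (hα0 x) _) (rpow_nonneg (hβ0 x) _),
          ← rpow_mul (hα0 x), ← rpow_mul (hα0 x), ← rpow_mul (hβ0 x),
          ← rpow_mul (hβ0 x), h1θ]
        congr 2
        · ring
        · field_simp
    _ ≤ _ := hk
    _ ≤ (C1 ^ p1 * E) ^ (s / 2) * (B ^ p * E) ^ (θ * s / p) := by
        have n1 : 0 ≤ ∑ x, α x ^ p1 := sum_nonneg fun x _ => rpow_nonneg (hα0 x) _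
        have n2 : 0 ≤ ∑ x, β x ^ p := sum_nonneg fun x _ => rpow_nonneg (hβ0 x) _
        exact mul_le_mul (rpow_le_rpow n1 hαs (by positivity))
          (rpow_le_rpow n2 hβs hsθ0.le) (by positivity) (by positivity)
    _ = (C1 ^ (p1 / 2) * B ^ θ * NN s h) ^ s := by
        have hEs : NN s h ^ s = E := by
          rw [NN_pow hs0]; simp only [norm_of_nonneg (hh0 _), hE]
        rw [mul_rpow (by positivity) (NN_nonneg _ _), hEs,
          mul_rpow (by positivity) hE0, mul_rpow (by positivity) hE0,
          mul_rpow (by positivity) (by positivity), ← rpow_mul hC1, ← rpow_mul hC1,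
          ← rpow_mul hB, ← rpow_mul hB]
        have hE1 : E ^ (s / 2) * E ^ (θ * s / p) = E := by
          rw [← rpow_add_of_nonneg hE0 (by positivity) hsθ0.le, hs1, rpow_one]
        rw [show p1 * (s / 2) = p1 / 2 * s by ring, show p * (θ * s / p) = θ * s by field_simp]
        nth_rewrite 3 [← hE1]
        ring

end VV

section chain
variable {X E T : Type*} [Fintype X] [NormedAddCommGroup E]

theorem chain {p : ℝ} (hp : 1 ≤ p) (F : T → X → E) (pos : T → ℝ) {B Λ a : ℝ} (hB : 0 ≤ B) (hΛ : 0 ≤ Λ)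
    (S : Finset T) (h1 : ∀ t ∈ S, NN p (F t) ≤ B)
    (h2 : ∀ t ∈ S, ∀ t' ∈ S, NN p (fun x => F t x - F t' x) ≤ Λ * |pos t - pos t'|)
    (ha : ∀ t ∈ S, a ≤ pos t) :
    ∀ b, a ≤ b → (∀ t ∈ S, pos t ≤ b) →
    ∃ H : X → ℝ, (∀ x, 0 ≤ H x) ∧ (∀ t ∈ S, ∀ x, ‖F t x‖ ≤ H x) ∧ NN p H ≤ B + Λ * (b - a) := by
  classical
  have hp0 : 0 < p := by linarith
  induction S using Finset.induction_on_max_value pos with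
  | empty =>
    intro b hab _
    refine ⟨fun _ => 0, fun _ => le_rfl, by simp, ?_⟩
    rw [NN_zero hp0]
    have := mul_nonneg hΛ (sub_nonneg.2 hab)
    linarith
  | insert m S hm hmax ih =>
    intro b hab hb
    have hmem : ∀ t ∈ S, t ∈ insert m S := fun t ht => Finset.mem_insert_of_mem ht
    have hmm : m ∈ insert m S := Finset.mem_insert_self _ _
    rcases S.eq_empty_or_nonempty with rfl | hne
    · refine ⟨fun x => ‖F m x‖, fun x => norm_nonneg _, by simp, ?_⟩
      rw [NN_norm]
      have := mul_nonneg hΛ (sub_nonneg.2 hab)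
      linarith [h1 m (by simp)]
    · obtain ⟨t0, ht0, hmx⟩ := S.exists_max_image pos hne
      obtain ⟨H, H0, H1, H2⟩ := ih (fun t ht => h1 t (hmem t ht))
        (fun t ht t' ht' => h2 t (hmem t ht) t' (hmem t' ht')) (fun t ht => ha t (hmem t ht))
        (pos t0) (ha t0 (hmem t0 ht0)) hmx
      refine ⟨fun x => H x + ‖F m x - F t0 x‖, fun x => add_nonneg (H0 x) (norm_nonneg _), ?_, ?_⟩
      · intro t ht x
        rcases Finset.mem_insert.1 ht with rfl | ht
        · have := norm_add_le (F t0 x) (F t x - F t0 x)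
          rw [add_sub_cancel] at this
          linarith [H1 t0 ht0 x]
        · linarith [H1 t ht x, norm_nonneg (F m x - F t0 x)]
      · refine (NN_add_le hp _ _).trans ?_
        rw [NN_norm]
        have h3 := h2 m hmm t0 (hmem t0 ht0)
        rw [abs_of_nonneg (by linarith [hmax t0 ht0])] at h3
        have h4 := mul_le_mul_of_nonneg_left (hb m hmm) hΛ
        nlinarith

theorem chain2 [Fintype T] (F : T → X → E) (pos : T → ℝ) {B Λ : ℝ} (hB : 0 ≤ B) (hΛ : 0 ≤ Λ)
    (J : ℕ) (hJ : 0 < J) (S : Finset T) (h1 : ∀ t ∈ S, NN 2 (F t) ≤ B)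
    (h2 : ∀ t ∈ S, ∀ t' ∈ S, NN 2 (fun x => F t x - F t' x) ≤ Λ * |pos t - pos t'|)
    (ha : ∀ t ∈ S, 0 ≤ pos t) (hb : ∀ t ∈ S, pos t < 2) :
    ∃ H : X → ℝ, (∀ x, 0 ≤ H x) ∧ (∀ t ∈ S, ∀ x, ‖F t x‖ ≤ H x) ∧
      NN 2 H ^ 2 ≤ 2 * J * (B + Λ / J) ^ 2 := by
  classical
  have hJ' : (0 : ℝ) < J := by exact_mod_cast hJ
  have key : ∀ c : Fin (2 * J), ∃ H : X → ℝ, (∀ x, 0 ≤ H x) ∧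
      (∀ t ∈ S.filter (fun t => ⌊pos t * J⌋₊ = c), ∀ x, ‖F t x‖ ≤ H x) ∧ NN 2 H ≤ B + Λ / J := by
    intro c
    have := chain (p := 2) (by norm_num) F pos hB hΛ (S.filter (fun t => ⌊pos t * J⌋₊ = c)) (a := c / J)
      (fun t ht => h1 t (Finset.mem_filter.1 ht).1)
      (fun t ht t' ht' => h2 t (Finset.mem_filter.1 ht).1 t' (Finset.mem_filter.1 ht').1)
      (fun t ht => by
        obtain ⟨h, h'⟩ := Finset.mem_filter.1 ht
        rw [div_le_iff₀ hJ', ← h']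
        exact Nat.floor_le (mul_nonneg (ha t h) hJ'.le)) ((c + 1) / J) (by gcongr; linarith)
      (fun t ht => by
        obtain ⟨h, h'⟩ := Finset.mem_filter.1 ht
        rw [le_div_iff₀ hJ', ← h']
        exact (Nat.lt_floor_add_one _).le)
    obtain ⟨H, a1, a2, a3⟩ := this
    refine ⟨H, a1, a2, a3.trans (le_of_eq ?_)⟩
    field_simp; ring
  choose H H0 H1 H2 using key
  refine ⟨fun x => NN 2 (fun c => H c x), fun x => NN_nonneg _ _, ?_, ?_⟩
  · intro t ht x
    have hlt : ⌊pos t * J⌋₊ < 2 * J := by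
      rw [Nat.floor_lt (mul_nonneg (ha t ht) hJ'.le)]
      push_cast
      exact mul_lt_mul_of_pos_right (hb t ht) hJ'
    refine (H1 ⟨_, hlt⟩ t (Finset.mem_filter.2 ⟨ht, rfl⟩) x).trans ?_
    have := le_NN (p := 2) (by norm_num) (fun c => H c x) ⟨_, hlt⟩
    rwa [norm_of_nonneg (H0 _ _)] at this
  · rw [NN_two_sq]
    simp only [norm_eq_abs, sq_abs, NN_two_sq]
    rw [sum_comm]
    have : ∀ c : Fin (2 * J), ∑ x, H c x ^ 2 ≤ (B + Λ / J) ^ 2 := by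
      intro c
      have h3 := NN_two_sq (H c)
      simp only [norm_eq_abs, sq_abs] at h3
      rw [← h3]
      exact pow_le_pow_left₀ (NN_nonneg _ _) (H2 c) 2
    refine (sum_le_sum fun c _ => this c).trans (le_of_eq ?_)
    simp

end chain

structure Fam {G : Type*} [Fintype G] [AddCommGroup G] {T ι : Type*} [Fintype T] [Fintype ι]
    (V : G → ℝ) (v : AddChar G ℂ → ℝ) (A : T → G → ℝ) (oct : T → ℕ) (L : ℕ)
    (w : T → ι → ℂ) (W : ι → ℝ) (K : T → ι → G → ℂ) (pos : T → ℝ) (p1 Ca Λ C2 : ℝ) : Prop where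
  hV : IsProb V
  hv : ∀ χ, hat (cx V) χ = v χ
  v0 : ∀ χ, 0 ≤ v χ
  v1 : ∀ χ, v χ ≤ 1
  hA : ∀ t x, 0 ≤ A t x
  hoct : ∀ t, oct t ≤ L
  hAK : ∀ t x, (A t x : ℂ) = ∑ m, w t m * K t m x
  hw : ∀ t m, ‖w t m‖ ≤ W m
  hW0 : ∀ m, 0 ≤ W m
  hW : ∑ m, W m ≤ Ca
  hmass : ∀ t m, ∑ x, K t m x = 1
  hcon : ∀ t m f, NN p1 (cv (K t m) f) ≤ NN p1 f
  h2 : ∀ t m χ, ‖hat (K t m) χ‖ ≤ 1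
  hnear : ∀ t m χ, ‖hat (K t m) χ - 1‖ ≤ C2 * (2 ^ oct t * (1 - v χ))
  hdec : ∀ t m χ, ‖hat (K t m) χ‖ ^ 2 * (2 ^ oct t * (1 - v χ)) ≤ C2
  hlip1 : ∀ t t' m, oct t = oct t' → ∀ f, NN p1 (fun x => cv (K t m) f x - cv (K t' m) f x) ≤
    Λ * |pos t - pos t'| * NN p1 f
  hlip2 : ∀ t t' m, oct t = oct t' → ∀ f, NN 2 (fun x => cv (K t m) f x - cv (K t' m) f x) ≤
    Λ * |pos t - pos t'| * NN 2 f
  hpos0 : ∀ t, 0 ≤ pos t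
  hpos2 : ∀ t, pos t < 2

section eng
variable {G : Type*} [Fintype G] [AddCommGroup G] {T ι : Type*} [Fintype T] [Fintype ι]
  {V : G → ℝ} {v : AddChar G ℂ → ℝ} {A : T → G → ℝ} {oct : T → ℕ} {L : ℕ}
  {w : T → ι → ℂ} {W : ι → ℝ} {K : T → ι → G → ℂ} {pos : T → ℝ} {p1 Ca Λ C2 : ℝ}

theorem Fam.cvA (hF : Fam V v A oct L w W K pos p1 Ca Λ C2) (t : T) (f : G → ℂ) (x : G) :
    cv (cx (A t)) f x = ∑ m, w t m * cv (K t m) f x := by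
  have : cx (A t) = fun x => ∑ m, w t m * K t m x := funext fun x => hF.hAK t x
  rw [this, cv_sum_left]
  simp only [cv_smul_left]

theorem Fam.local (hF : Fam V v A oct L w W K pos p1 Ca Λ C2) (hp1 : 1 ≤ p1) (hΛ : 0 ≤ Λ) :
    Local A oct p1 (Ca * (1 + 2 * Λ)) := by
  classical
  intro k u hu
  have hN := NN_nonneg p1 u
  have e : NN p1 (cx u) = NN p1 u := NN_congr fun x => by simp [cx]
  have key : ∀ m, ∃ H : G → ℝ, (∀ x, 0 ≤ H x) ∧
      (∀ t ∈ Finset.univ.filter (fun t => oct t = k), ∀ x, ‖cv (K t m) (cx u) x‖ ≤ H x) ∧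
      NN p1 H ≤ NN p1 u + Λ * NN p1 u * (2 - 0) := by
    intro m
    refine chain hp1 (fun t => cv (K t m) (cx u)) pos hN (mul_nonneg hΛ hN) _ ?_ ?_ ?_ 2 (by norm_num) ?_
    · intro t _; rw [← e]; exact hF.hcon t m _
    · intro t ht t' ht'
      have := hF.hlip1 t t' m (by rw [(Finset.mem_filter.1 ht).2, (Finset.mem_filter.1 ht').2]) (cx u)
      rw [e] at this
      linarith
    · intro t _; exact hF.hpos0 t
    · intro t _; exact (hF.hpos2 t).le
  choose H H0 H1 H2 using key
  refine ⟨fun x => ∑ m, W m * H m x, fun x => sum_nonneg fun m _ =>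
    mul_nonneg (hF.hW0 m) (H0 m x), ?_, ?_⟩
  · intro t ht x
    have h3 : cv (A t) u x ≤ ‖cv (cx (A t)) (cx u) x‖ := by
      rw [cv_cx, norm_real]; exact le_abs_self _
    refine h3.trans ?_
    rw [hF.cvA]
    refine (norm_sum_le _ _).trans (sum_le_sum fun m _ => ?_)
    rw [norm_mul]
    exact mul_le_mul (hF.hw t m) (H1 m t (by simp [ht]) x) (norm_nonneg _) (hF.hW0 m)
  · refine (NN_sum_le hp1 _ _).trans ?_
    have : ∀ m, NN p1 (fun x => W m * H m x) ≤ W m * ((1 + 2 * Λ) * NN p1 u) := by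
      intro m
      rw [NN_const_mul (by linarith), norm_of_nonneg (hF.hW0 m)]
      exact mul_le_mul_of_nonneg_left ((H2 m).trans (by linarith)) (hF.hW0 m)
    refine (sum_le_sum fun m _ => this m).trans ?_
    rw [← sum_mul, mul_assoc]
    exact mul_le_mul_of_nonneg_right hF.hW (by positivity)

theorem P_local (hV : IsProb V) (hp1 : 1 ≤ p1) (L : ℕ) :
    Local (fun k : Fin (L + 1) => pker V k) (fun k => (k : ℕ)) p1 1 := by
  intro k u hu
  refine ⟨cv (pker V k) u, fun x => cv_nonneg (pker_prob hV k).1 hu x, ?_, ?_⟩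
  · intro t ht x; simp only [ht, le_refl]
  · rw [one_mul]; exact (pker_prob hV k).NN_cv_le hp1 u

theorem P_valid (hV : IsProb V) {p : ℝ} (hp : 1 < p) (L : ℕ) :
    Valid (fun k : Fin (L + 1) => pker V k) p (p / (p - 1)) := by
  intro τ f hf
  obtain ⟨M, hM0, hM, hN⟩ := pker_max hV hp L f hf
  refine le_trans (NN_mono' (by linarith) fun x => ?_) hN
  rw [norm_of_nonneg (cv_nonneg (pker_prob hV _).1 hf x)]
  exact hM _ (Nat.le_of_lt_succ (τ x).2) x

noncomputable def mss (A : T → G → ℝ) (t : T) : ℝ := ∑ x, A t x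

theorem Fam.mss_eq (hF : Fam V v A oct L w W K pos p1 Ca Λ C2) (t : T) :
    (mss A t : ℂ) = ∑ m, w t m := by
  unfold mss
  push_cast
  simp only [hF.hAK t]
  rw [sum_comm]
  simp only [← mul_sum, hF.hmass, mul_one]

theorem Fam.mss_nonneg (hF : Fam V v A oct L w W K pos p1 Ca Λ C2) (t : T) : 0 ≤ mss A t :=
  sum_nonneg fun x _ => hF.hA t x

theorem Fam.mss_le (hF : Fam V v A oct L w W K pos p1 Ca Λ C2) (t : T) : mss A t ≤ Ca := by
  have h := hF.mss_eq t
  have h1 : mss A t ≤ ‖(mss A t : ℂ)‖ := by rw [norm_real]; exact le_abs_self _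
  refine h1.trans ?_
  rw [h]
  exact (norm_sum_le _ _).trans ((sum_le_sum fun m _ => hF.hw t m).trans hF.hW)

noncomputable def Dk (V : G → ℝ) (A : T → G → ℝ) (oct : T → ℕ) (t : T) : G → ℂ :=
  fun x => cx (A t) x - (mss A t : ℂ) * cx (pker V (oct t)) x

theorem cv_Dk (t : T) (f : G → ℂ) (x : G) :
    cv (Dk V A oct t) f x = cv (cx (A t)) f x - (mss A t : ℂ) * cv (cx (pker V (oct t))) f x := by
  unfold Dk
  rw [cv_sub_left, cv_smul_left]

theorem Fam.cv_Dk' (hF : Fam V v A oct L w W K pos p1 Ca Λ C2) (t : T) (f : G → ℂ) (x : G) :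
    cv (Dk V A oct t) f x = ∑ m, w t m * (cv (K t m) f x - cv (cx (pker V (oct t))) f x) := by
  rw [cv_Dk, hF.cvA, hF.mss_eq, sum_mul, ← sum_sub_distrib]
  exact sum_congr rfl fun m _ => by ring

noncomputable def En (v : AddChar G ℂ → ℝ) (L : ℕ) (g : G → ℂ) (i : ℕ) : ℝ :=
  (Fintype.card G : ℝ)⁻¹ * ∑ χ, ‖hat g χ‖ ^ 2 * ssym (v χ) L i

theorem card_posR : (0 : ℝ) < Fintype.card G := by exact_mod_cast Fintype.card_pos

theorem Fam.En_nonneg (hF : Fam V v A oct L w W K pos p1 Ca Λ C2) (g : G → ℂ) (i : ℕ) :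
    0 ≤ En v L g i := by
  unfold En
  refine mul_nonneg (by positivity) (sum_nonneg fun χ _ => mul_nonneg (by positivity)
    (ssym_nonneg (hF.v0 χ) (hF.v1 χ) L i))

theorem En_sum (g : G → ℂ) : ∑ i ∈ range (L + 1), En v L g i = NN 2 g ^ 2 := by
  unfold En
  rw [← mul_sum, sum_comm]
  simp only [← mul_sum, ssym_sum, mul_one]
  rw [parseval]
  have := card_posR (G := G)
  field_simp

theorem Fam.L2a (hF : Fam V v A oct L w W K pos p1 Ca Λ C2) (g : G → ℂ) (i : ℕ) {M : G → ℂ} {c : ℝ}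
    (h : ∀ χ, ‖hat M χ‖ ^ 2 * ssym (v χ) L i ≤ c) :
    NN 2 (cv M (cv (cx (sker V L i)) g)) ^ 2 ≤ c * En v L g i := by
  have h1 := NN2_cv_le_of M (cv (cx (sker V L i)) g) (fun χ => c * (‖hat g χ‖ ^ 2 * ssym (v χ) L i)) ?_
  · rw [← mul_sum] at h1
    unfold En
    have := card_posR (G := G)
    rw [show c * ((Fintype.card G : ℝ)⁻¹ * ∑ χ, ‖hat g χ‖ ^ 2 * ssym (v χ) L i) =
      (Fintype.card G : ℝ)⁻¹ * (c * ∑ χ, ‖hat g χ‖ ^ 2 * ssym (v χ) L i) by ring]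
    rwa [le_inv_mul_iff₀ this]
  · intro χ
    have s0 := ssym_nonneg (hF.v0 χ) (hF.v1 χ) L i
    rw [hat_cv, hat_sker (hF.hv χ), norm_mul, norm_real, norm_of_nonneg s0]
    have := mul_le_mul_of_nonneg_right (h χ) (mul_nonneg s0 (sq_nonneg ‖hat g χ‖))
    calc _ = ‖hat M χ‖ ^ 2 * ssym (v χ) L i * (ssym (v χ) L i * ‖hat g χ‖ ^ 2) := by ring
      _ ≤ _ := this
      _ = _ := by ring

theorem Fam.L2_local (hF : Fam V v A oct L w W K pos p1 Ca Λ C2) (hΛ : 0 ≤ Λ) (hC2 : 1 ≤ C2)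
    (hCa : 0 ≤ Ca) (g : G → ℂ) (k i : ℕ) :
    ∃ H : G → ℝ, (∀ x, 0 ≤ H x) ∧
      (∀ t, oct t = k → ∀ x, ‖cv (Dk V A oct t) (cv (cx (sker V L i)) g) x‖ ≤ H x) ∧
      NN 2 H ^ 2 ≤ Ca ^ 2 * (4 * (8 * C2 + Λ ^ 2)) * (1 / 2) ^ ((max i k - min i k) / 2) * En v L g i := by
  classical
  set n := max i k - min i k with hn
  set f := cv (cx (sker V L i)) g with hf
  set En' := En v L g i with hEn
  have hE := hF.En_nonneg g i
  have hSf : NN 2 f ≤ √En' := by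
    refine le_sqrt_of_sq_le ?_
    have := hF.L2a g i (M := cx dlt) (c := 1) (fun χ => by
      rw [hat_dlt]; simpa using ssym_le_one (hF.v0 χ) (hF.v1 χ) L i)
    rw [one_mul] at this
    refine le_trans (le_of_eq ?_) this
    rw [← hf]
    congr 2
    funext x
    classical
    unfold cv cx dlt
    rw [sum_eq_single 0]
    · simp
    · intro b _ hb; simp [hb]
    · simp
  set J := 2 ^ (n / 2) with hJ
  have hJ0 : 0 < J := by positivity
  set B := √(8 * C2 * (1 / 2) ^ n * En') with hB
  have key : ∀ m, ∃ H : G → ℝ, (∀ x, 0 ≤ H x) ∧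
      (∀ t ∈ Finset.univ.filter (fun t => oct t = k), ∀ x,
        ‖cv (K t m) f x - cv (cx (pker V (oct t))) f x‖ ≤ H x) ∧
      NN 2 H ^ 2 ≤ 2 * J * (B + (Λ * √En') / J) ^ 2 := by
    intro m
    refine chain2 (fun t x => cv (K t m) f x - cv (cx (pker V (oct t))) f x) pos (sqrt_nonneg _)
      (mul_nonneg hΛ (sqrt_nonneg _)) J hJ0 _ ?_ ?_ (fun t _ => hF.hpos0 t) (fun t _ => hF.hpos2 t)
    · intro t ht
      have htk := (Finset.mem_filter.1 ht).2
      refine le_sqrt_of_sq_le ?_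
      have := hF.L2a g i (M := fun x => K t m x - cx (pker V (oct t)) x) (c := 8 * C2 * (1 / 2) ^ n)
        (fun χ => by
          rw [hat_sub, hat_pker (hF.hv χ), hn, ← htk]
          exact symb_key (hF.v0 χ) (hF.v1 χ) (hF.hoct t) hC2 (hF.hnear t m χ) (hF.h2 t m χ)
            (hF.hdec t m χ))
      refine le_trans (le_of_eq ?_) this
      congr 2
      funext x
      rw [cv_sub_left]
    · intro t ht t' ht'
      have e : oct t = oct t' := by rw [(Finset.mem_filter.1 ht).2, (Finset.mem_filter.1 ht').2]
      have := hF.hlip2 t t' m e f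
      rw [e]
      simp only [sub_sub_sub_cancel_right]
      refine this.trans ?_
      have h3 := mul_le_mul_of_nonneg_left hSf (mul_nonneg hΛ (abs_nonneg (pos t - pos t')))
      linarith
  choose H H0 H1 H2 using key
  refine ⟨fun x => ∑ m, W m * H m x, fun x => sum_nonneg fun m _ =>
    mul_nonneg (hF.hW0 m) (H0 m x), ?_, ?_⟩
  · intro t ht x
    rw [hF.cv_Dk']
    refine (norm_sum_le _ _).trans (sum_le_sum fun m _ => ?_)
    rw [norm_mul]
    exact mul_le_mul (hF.hw t m) (H1 m t (by simp [ht]) x) (norm_nonneg _) (hF.hW0 m)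
  · set R := 4 * (8 * C2 + Λ ^ 2) * (1 / 2) ^ (n / 2) * En' with hR
    have hR0 : 0 ≤ R := by positivity
    have hRb : 2 * J * (B + (Λ * √En') / J) ^ 2 ≤ R := by
      have hJr : ((J : ℕ) : ℝ) = 2 ^ (n / 2) := by simp [hJ]
      have hJp : (0 : ℝ) < J := by exact_mod_cast hJ0
      have b1 : B ^ 2 = 8 * C2 * (1 / 2) ^ n * En' := sq_sqrt (by positivity)
      have b2 : (Λ * √En' / J) ^ 2 = Λ ^ 2 * En' / J ^ 2 := by
        rw [div_pow, mul_pow, sq_sqrt hE]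
      have b3 : (B + (Λ * √En') / J) ^ 2 ≤ 2 * (B ^ 2 + (Λ * √En' / J) ^ 2) := by
        nlinarith [sq_nonneg (B - Λ * √En' / J)]
      have b4 : (J : ℝ) * (1 / 2) ^ n ≤ (1 / 2) ^ (n / 2) := by
        rw [hJr]
        have : n = n / 2 + (n - n / 2) := by omega
        nth_rewrite 2 [this]
        rw [pow_add, ← mul_assoc, ← mul_pow]
        rw [show (2 : ℝ) * (1 / 2) = 1 by norm_num, one_pow, one_mul]
        exact pow_le_pow_of_le_one (by norm_num) (by norm_num) (by omega)
      have b5 : (J : ℝ)⁻¹ = (1 / 2) ^ (n / 2) := by rw [hJr]; simp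
      calc 2 * J * (B + (Λ * √En') / J) ^ 2 ≤ 2 * J * (2 * (B ^ 2 + (Λ * √En' / J) ^ 2)) := by gcongr
        _ = 4 * (8 * C2 * En' * (J * (1 / 2) ^ n) + Λ ^ 2 * En' * (J : ℝ)⁻¹) := by
          rw [b1, b2]; field_simp; ring
        _ ≤ 4 * (8 * C2 * En' * (1 / 2) ^ (n / 2) + Λ ^ 2 * En' * (1 / 2) ^ (n / 2)) := by
          rw [b5]; gcongr
        _ = R := by rw [hR]; ring
    have hHm : ∀ m, NN 2 (H m) ≤ √R := fun m => le_sqrt_of_sq_le ((H2 m).trans hRb)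
    have : NN 2 (fun x => ∑ m, W m * H m x) ≤ Ca * √R := by
      refine (NN_sum_le (by norm_num) _ _).trans ?_
      have : ∀ m, NN 2 (fun x => W m * H m x) ≤ W m * √R := by
        intro m
        rw [NN_const_mul (by norm_num), norm_of_nonneg (hF.hW0 m)]
        exact mul_le_mul_of_nonneg_left (hHm m) (hF.hW0 m)
      refine (sum_le_sum fun m _ => this m).trans ?_
      rw [← sum_mul]
      exact mul_le_mul_of_nonneg_right hF.hW (sqrt_nonneg _)
    refine (pow_le_pow_left₀ (NN_nonneg _ _) this 2).trans (le_of_eq ?_)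
    rw [mul_pow, sq_sqrt hR0, hR]; ring

end eng

theorem shift_sum_le {a : ℕ → ℝ} (ha : ∀ i, 0 ≤ a i) {L : ℕ} (ha' : ∀ i, L < i → a i = 0) (z : ℤ) :
    ∑ k : Fin (L + 1), (if 0 ≤ ((k : ℕ) : ℤ) + z then a (((k : ℕ) : ℤ) + z).toNat else 0) ≤
      ∑ i ∈ range (L + 1), a i := by
  classical
  rw [Fin.sum_univ_eq_sum_range (fun k => if 0 ≤ (k : ℤ) + z then a ((k : ℤ) + z).toNat else 0)]
  rw [← sum_filter]
  have hinj : Set.InjOn (fun k : ℕ => ((k : ℤ) + z).toNat)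
      ((range (L + 1)).filter (fun k : ℕ => 0 ≤ (k : ℤ) + z)) := by
    intro x hx y hy h
    simp only [coe_filter, mem_range, Set.mem_setOf_eq] at hx hy
    simp only at h
    omega
  rw [← sum_image (g := fun k : ℕ => ((k : ℤ) + z).toNat) (f := a) hinj]
  set S := ((range (L + 1)).filter (fun k : ℕ => 0 ≤ (k : ℤ) + z)).image
    (fun k : ℕ => ((k : ℤ) + z).toNat)
  calc ∑ i ∈ S, a i = ∑ i ∈ S.filter (· ∈ range (L + 1)), a i := by
        rw [sum_filter]
        refine sum_congr rfl fun i _ => ?_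
        split_ifs with h
        · rfl
        · exact ha' i (by simpa using h)
    _ ≤ _ := sum_le_sum_of_subset_of_nonneg (fun i hi => (Finset.mem_filter.1 hi).2)
        fun i _ _ => ha i

theorem shift_sum_eq {M : Type*} [AddCommMonoid M] (a : ℕ → M) {L k : ℕ} (hk : k ≤ L)
    (ha' : ∀ i, L < i → a i = 0) :
    ∑ z ∈ Icc (-(L : ℤ)) L, (if 0 ≤ (k : ℤ) + z then a ((k : ℤ) + z).toNat else 0) =
      ∑ i ∈ range (L + 1), a i := by
  classical
  rw [← sum_filter]
  symm
  refine Finset.sum_bij_ne_zero (fun i _ _ => (i : ℤ) - k) ?_ ?_ ?_ ?_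
  · intro i hi _
    simp only [mem_filter, mem_Icc, mem_range] at *
    omega
  · intro i _ _ j _ _ h; omega
  · intro z hz hne
    simp only [mem_filter, mem_Icc] at hz
    have hle : ((k : ℤ) + z).toNat ≤ L := by
      by_contra h; exact hne (ha' _ (by omega))
    exact ⟨((k : ℤ) + z).toNat, by simpa using by omega, hne, by omega⟩
  · intro i _ _
    congr 1; omega

section eng2
variable {G : Type*} [Fintype G] [AddCommGroup G] {T ι : Type*} [Fintype T] [Fintype ι]
  {V : G → ℝ} {v : AddChar G ℂ → ℝ} {A : T → G → ℝ} {oct : T → ℕ} {L : ℕ}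
  {w : T → ι → ℂ} {W : ι → ℝ} {K : T → ι → G → ℂ} {pos : T → ℝ} {p1 Ca Λ C2 : ℝ}

noncomputable def szk (V : G → ℝ) (L : ℕ) (z : ℤ) (k : ℕ) : G → ℂ :=
  if 0 ≤ (k : ℤ) + z then cx (sker V L ((k : ℤ) + z).toNat) else fun _ => 0

theorem sker_gt {L i : ℕ} (h : L < i) : sker V L i = fun _ => 0 := by
  unfold sker; rw [if_neg (by omega), if_neg (by omega)]

theorem cv_zero_left (f : G → ℂ) (x : G) : cv (fun _ => (0 : ℂ)) f x = 0 := by simp [cv]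

theorem cv_zero_right (f : G → ℂ) (x : G) : cv f (fun _ => (0 : ℂ)) x = 0 := by simp [cv]

theorem cx_zero : cx (fun _ : G => (0 : ℝ)) = fun _ => 0 := by funext x; simp [cx]

theorem szk_sq (z : ℤ) (g : G → ℂ) (x : G) :
    NN 2 (fun k : Fin (L + 1) => ‖cv (szk V L z k) g x‖) ≤ sqf V L g x := by
  refine abs_le_of_sq_le_sq' ?_ (sqf_nonneg L g x) |>.2
  unfold sqf
  rw [NN_two_sq, NN_two_sq]
  rw [Fin.sum_univ_eq_sum_range (fun i => ‖cv (cx (sker V L i)) g x‖ ^ 2)]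
  refine le_trans (le_of_eq ?_) (shift_sum_le (a := fun i => ‖cv (cx (sker V L i)) g x‖ ^ 2)
    (fun i => by positivity) (fun i hi => by rw [sker_gt hi, cx_zero, cv_zero_left]; simp) z)
  refine sum_congr rfl fun k _ => ?_
  unfold szk
  split_ifs
  · simp
  · rw [cv_zero_left]; simp

noncomputable def Tz (V : G → ℝ) (A : T → G → ℝ) (oct : T → ℕ) (L : ℕ) (τ : G → T) (z : ℤ) (g : G → ℂ)
    (x : G) : ℂ := cv (Dk V A oct (τ x)) (cv (szk V L z (oct (τ x))) g) x

theorem Tz_matrix (τ : G → T) (z : ℤ) (g : G → ℂ) (x : G) :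
    Tz V A oct L τ z g x = ∑ y, cv (Dk V A oct (τ x)) (szk V L z (oct (τ x))) (x - y) * g y := by
  unfold Tz
  rw [← cv_assoc, cv_comm, cv]
  exact sum_congr rfl fun y _ => mul_comm _ _

theorem Fam.Tz_L2 (hF : Fam V v A oct L w W K pos p1 Ca Λ C2) (hΛ : 0 ≤ Λ) (hC2 : 1 ≤ C2)
    (hCa : 0 ≤ Ca) (τ : G → T) (z : ℤ) (g : G → ℂ) :
    NN 2 (Tz V A oct L τ z g) ≤
      √(Ca ^ 2 * (4 * (8 * C2 + Λ ^ 2))) * √((1 / 2) ^ (z.natAbs / 2)) * NN 2 g := by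
  set c := Ca ^ 2 * (4 * (8 * C2 + Λ ^ 2)) with hc
  have hc0 : 0 ≤ c := by positivity
  have hg := NN_nonneg 2 g
  have key : ∀ k : Fin (L + 1), ∃ H : G → ℝ, (∀ x, 0 ≤ H x) ∧
      (∀ t, oct t = k → ∀ x, ‖cv (Dk V A oct t) (cv (szk V L z k) g) x‖ ≤ H x) ∧
      NN 2 H ^ 2 ≤ c * (1 / 2) ^ (z.natAbs / 2) *
        (if 0 ≤ ((k : ℕ) : ℤ) + z then En v L g (((k : ℕ) : ℤ) + z).toNat else 0) := by
    intro k
    unfold szk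
    split_ifs with h
    · obtain ⟨H, h0, h1, h2⟩ := hF.L2_local hΛ hC2 hCa g k (((k : ℕ) : ℤ) + z).toNat
      refine ⟨H, h0, h1, h2.trans (le_of_eq ?_)⟩
      have : max (((k : ℕ) : ℤ) + z).toNat (k : ℕ) - min (((k : ℕ) : ℤ) + z).toNat (k : ℕ) = z.natAbs := by
        omega
      rw [this]
    · refine ⟨fun _ => 0, fun _ => le_rfl, fun t _ x => ?_, ?_⟩
      · have : cv (fun _ => (0 : ℂ)) g = fun _ => 0 := funext fun x => cv_zero_left g x
        rw [this, cv_zero_right]; simp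
      · rw [NN_zero (by norm_num)]; simp
  choose H H0 H1 H2 using key
  refine abs_le_of_sq_le_sq' ?_ (by positivity) |>.2
  rw [NN_two_sq, mul_pow, mul_pow, sq_sqrt hc0, sq_sqrt (by positivity)]
  calc ∑ x, ‖Tz V A oct L τ z g x‖ ^ 2 ≤ ∑ x, ∑ k, H k x ^ 2 := by
        refine sum_le_sum fun x _ => ?_
        have h1 := H1 ⟨oct (τ x), Nat.lt_succ_of_le (hF.hoct _)⟩ (τ x) rfl x
        refine (pow_le_pow_left₀ (norm_nonneg _) h1 2).trans ?_
        exact single_le_sum (f := fun k => H k x ^ 2) (fun k _ => sq_nonneg _)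
          (mem_univ _)
    _ = ∑ k, NN 2 (H k) ^ 2 := by
        rw [sum_comm]
        refine sum_congr rfl fun k _ => ?_
        rw [NN_two_sq]; simp
    _ ≤ _ := sum_le_sum fun k _ => H2 k
    _ ≤ _ := by
        rw [← mul_sum, ← En_sum (L := L) (v := v)]
        refine mul_le_mul_of_nonneg_left (shift_sum_le (hF.En_nonneg g) (fun i hi => ?_) z) (by positivity)
        unfold En ssym
        have : ¬ i < L := by omega
        have h' : ¬ i = L := by omega
        simp [this, h']

theorem Fam.Tz_Ls (hF : Fam V v A oct L w W K pos p1 Ca Λ C2) (hΛ : 0 ≤ Λ)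
    (hCa : 0 ≤ Ca) {p s θ B : ℝ} (hp1 : 1 < p1)
    (hpp : p1 < p) (hp2 : p < 2) (hθ : θ = 1 - p1 / 2) (hs : 1 / s = 1 / 2 + θ / p) (hs1 : 1 < s)
    (hs2 : s < 2) (hB : 0 ≤ B) (hval : Valid A p B) (τ : G → T) (z : ℤ) (g : G → ℂ) :
    NN s (Tz V A oct L τ z g) ≤ ((Ca * (1 + 2 * Λ)) ^ (p1 / 2) * B ^ θ + Ca * (p / (p - 1)) ^ θ) *
      (4 * (CLP s + 1)) * NN s g := by
  have hs0 : 0 < s := by linarith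
  have hpm : 0 < p - 1 := by linarith
  have hpp0 : 0 < p := by linarith
  set gk : Fin (L + 1) → G → ℝ := fun k x => ‖cv (szk V L z k) g x‖ with hgk
  have hg0 : ∀ k x, 0 ≤ gk k x := fun k x => norm_nonneg _
  have v1 := vv hF.hA hp1 hpp hp2 hθ hs hs0 (by positivity) hB (hF.local hp1.le hΛ) hval hF.hoct τ gk hg0
  have v2 := vv (A := fun k : Fin (L + 1) => pker V k) (oct := fun k => (k : ℕ))
    (fun t x => (pker_prob hF.hV _).1 x) hp1 hpp hp2 hθ hs hs0 zero_le_one (by positivity)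
    (P_local hF.hV hp1.le L) (P_valid hF.hV (by linarith) L) (fun k => Nat.le_of_lt_succ k.2)
    (fun x => ⟨oct (τ x), Nat.lt_succ_of_le (hF.hoct _)⟩) gk hg0
  rw [one_rpow, one_mul] at v2
  have hq : NN s (fun x => NN 2 (fun k => gk k x)) ≤ 4 * (CLP s + 1) * NN s g := by
    refine (NN_mono' hs0 fun x => ?_).trans (sqf_cx hF.hV hs1 hs2 L g)
    rw [norm_of_nonneg (NN_nonneg _ _)]
    exact szk_sq z g x
  set Q := NN s (fun x => NN 2 (fun k => gk k x))
  have hpt : ∀ x, ‖Tz V A oct L τ z g x‖ ≤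
      cv (A (τ x)) (gk ⟨oct (τ x), Nat.lt_succ_of_le (hF.hoct _)⟩) x +
      Ca * cv (pker V (oct (τ x))) (gk ⟨oct (τ x), Nat.lt_succ_of_le (hF.hoct _)⟩) x := by
    intro x
    unfold Tz
    rw [cv_Dk]
    refine (norm_sub_le _ _).trans (add_le_add (norm_cv_cx_le (hF.hA _) _ x) ?_)
    rw [norm_mul, norm_real, norm_of_nonneg (hF.mss_nonneg _)]
    exact mul_le_mul (hF.mss_le _) (norm_cv_cx_le (pker_prob hF.hV _).1 _ x) (norm_nonneg _) hCa
  refine (NN_mono' hs0 hpt).trans ((NN_add_le hs1.le _ _).trans ?_)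
  rw [NN_const_mul hs0, norm_of_nonneg hCa]
  calc _ ≤ (Ca * (1 + 2 * Λ)) ^ (p1 / 2) * B ^ θ * Q + Ca * ((p / (p - 1)) ^ θ * Q) := by
        refine add_le_add v1 (mul_le_mul_of_nonneg_left v2 hCa)
    _ = ((Ca * (1 + 2 * Λ)) ^ (p1 / 2) * B ^ θ + Ca * (p / (p - 1)) ^ θ) * Q := by ring
    _ ≤ _ := by
        rw [mul_assoc _ (4 * (CLP s + 1))]
        exact mul_le_mul_of_nonneg_left hq (by positivity)

open Complex.HadamardThreeLines in
theorem Fam.Tz_Lp (hF : Fam V v A oct L w W K pos p1 Ca Λ C2) {p s θ' B0 B1 : ℝ}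
    (hs1 : 1 < s) (h0 : 0 ≤ θ') (h1 : θ' ≤ 1) (hpe : 1 / p = (1 - θ') / s + θ' / 2) (hB0 : 0 ≤ B0)
    (hB1 : 0 ≤ B1) (τ : G → T) (z : ℤ) (hs : ∀ g, NN s (Tz V A oct L τ z g) ≤ B0 * NN s g)
    (h2 : ∀ g, NN 2 (Tz V A oct L τ z g) ≤ B1 * NN 2 g) (g : G → ℂ) :
    NN p (Tz V A oct L τ z g) ≤ B0 ^ (1 - θ') * B1 ^ θ' * NN p g := by
  have := stein (fun _ x y => cv (Dk V A oct (τ x)) (szk V L z (oct (τ x))) (x - y)) hs1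
    (p1 := 2) (by norm_num) h0 h1 hpe hB0 hB1 (fun x y => diffContOnCl_const)
    (fun x y => ⟨_, fun _ _ => le_rfl⟩) (fun _ _ f => by simp only [← Tz_matrix]; exact hs f)
    (fun _ _ f => by simp only [← Tz_matrix]; exact h2 f) g
  simp only [← Tz_matrix] at this
  exact this

theorem Fam.decomp (hF : Fam V v A oct L w W K pos p1 Ca Λ C2) (τ : G → T) (f : G → ℝ) (x : G) :
    ((cv (A (τ x)) f x : ℝ) : ℂ) = (mss A (τ x) : ℂ) * ((cv (pker V (oct (τ x))) f x : ℝ) : ℂ) +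
      ∑ z ∈ Icc (-(L : ℤ)) L, Tz V A oct L τ z (cx f) x := by
  have h1 : ∑ z ∈ Icc (-(L : ℤ)) L, Tz V A oct L τ z (cx f) x =
      cv (Dk V A oct (τ x)) (cx f) x := by
    have e : ∀ z, Tz V A oct L τ z (cx f) x = if 0 ≤ ((oct (τ x) : ℕ) : ℤ) + z then
        (fun i => cv (Dk V A oct (τ x)) (cv (cx (sker V L i)) (cx f)) x)
          (((oct (τ x) : ℕ) : ℤ) + z).toNat else 0 := by
      intro z
      unfold Tz szk
      split_ifs
      · rfl
      · have : cv (fun _ => (0 : ℂ)) (cx f) = fun _ => 0 := funext fun x => cv_zero_left _ x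
        rw [this, cv_zero_right]
    simp only [e]
    rw [shift_sum_eq (fun i => cv (Dk V A oct (τ x)) (cv (cx (sker V L i)) (cx f)) x) (hF.hoct (τ x))]
    · rw [← cv_sum]
      congr 1
      funext y
      rw [← cv_sum_left]
      have : (fun x => ∑ i ∈ range (L + 1), cx (sker V L i) x) = cx dlt := by
        funext y; simp only [cx]; rw [← sum_sker (V := V) L y]; push_cast; rfl
      rw [this, cv_cx, cv_dlt]; rfl
    · intro i hi
      have : cv (cx (sker V L i)) (cx f) = fun _ => 0 := by
        rw [sker_gt hi, cx_zero]; exact funext fun x => cv_zero_left _ x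
      rw [this, cv_zero_right]
  rw [h1, cv_Dk, cv_cx, cv_cx]; ring

end eng2

theorem summ_half {ρ : ℝ} (h0 : 0 < ρ) (h1 : ρ < 1) : Summable fun z : ℤ => ρ ^ (z.natAbs / 2) := by
  have hn : Summable fun n : ℕ => ρ ^ (n / 2) := by
    have hr0 : 0 < √ρ := Real.sqrt_pos.2 h0
    have hr1 : √ρ < 1 := by rw [sqrt_lt' one_pos]; simpa using h1
    refine Summable.of_nonneg_of_le (fun n => by positivity) (fun n => ?_)
      ((summable_geometric_of_lt_one hr0.le hr1).mul_left (√ρ)⁻¹)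
    rw [le_inv_mul_iff₀ hr0]
    have : ρ ^ (n / 2) = √ρ ^ (2 * (n / 2)) := by rw [pow_mul, sq_sqrt h0.le]
    rw [this, ← pow_succ']
    exact pow_le_pow_of_le_one hr0.le hr1.le (by omega)
  refine Summable.of_nat_of_neg ?_ ?_ <;> simpa using hn

theorem bootstrap {p1 p Ca Λ C2 : ℝ} (hp1 : 1 < p1) (hpp : p1 < p) (hp2 : p < 2) (hΛ : 0 ≤ Λ)
    (hC2 : 1 ≤ C2) (hCa : 0 ≤ Ca) : ∃ C3 κ : ℝ, 1 ≤ C3 ∧ 0 ≤ κ ∧ κ < 1 ∧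
    ∀ {G T ι : Type} [Fintype G] [AddCommGroup G] [Fintype T] [Fintype ι]
    {V : G → ℝ} {v : AddChar G ℂ → ℝ} {A : T → G → ℝ} {oct : T → ℕ} {L : ℕ}
    {w : T → ι → ℂ} {W : ι → ℝ} {K : T → ι → G → ℂ} {pos : T → ℝ},
    Fam V v A oct L w W K pos p1 Ca Λ C2 → ∀ B, 1 ≤ B → Valid A p B → Valid A p (C3 * B ^ κ) := by
  have hp0 : 0 < p := by linarith
  set θ := 1 - p1 / 2 with hθ
  have hθ0 : 0 < θ := by rw [hθ]; linarith
  have hθ1 : θ < 1 := by rw [hθ]; linarith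
  have hθp : 0 < θ / p := by positivity
  have hθp2 : θ / p < 1 / 2 := by rw [div_lt_iff₀ hp0, hθ]; linarith
  set s := (1 / 2 + θ / p)⁻¹ with hsd
  have hs : 1 / s = 1 / 2 + θ / p := by rw [hsd]; simp
  have hs0 : 0 < s := by positivity
  have hs1 : 1 < s := by rw [hsd]; exact (one_lt_inv₀ (by positivity)).2 (by linarith)
  have hs2 : s < 2 := by rw [hsd]; exact inv_lt_of_inv_lt₀ (by norm_num) (by linarith)
  set θ' := (1 / s - 1 / p) / (1 / s - 1 / 2) with hθ'
  have hden : 0 < 1 / s - 1 / 2 := by rw [hs]; linarith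
  have hp2' : 1 / 2 < 1 / p := by
    rw [div_lt_div_iff₀ (by norm_num) hp0]; linarith
  have hsp : 0 < 1 / s - 1 / p := by
    rw [hs, show 1 / 2 + θ / p - 1 / p = (p - p1) / (2 * p) by rw [hθ]; field_simp; ring]
    have : 0 < p - p1 := by linarith
    positivity
  have hθ'0 : 0 < θ' := by positivity
  have hθ'1 : θ' < 1 := by rw [hθ', div_lt_one hden]; linarith
  have hpe : 1 / p = (1 - θ') / s + θ' / 2 := by
    have : θ' * (1 / s - 1 / 2) = 1 / s - 1 / p := by rw [hθ']; exact div_mul_cancel₀ _ hden.ne'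
    have e : (1 - θ') / s + θ' / 2 = 1 / s - θ' * (1 / s - 1 / 2) := by ring
    rw [e, this]; ring
  have hpm : 0 < p - 1 := by linarith
  have hCLP : 0 ≤ CLP s + 1 := by
    have : 0 < s - 1 := by linarith
    unfold CLP; positivity
  set c4 := ((Ca * (1 + 2 * Λ)) ^ (p1 / 2) + Ca * (p / (p - 1)) ^ θ) * (4 * (CLP s + 1)) with hc4
  have hc40 : 0 ≤ c4 := by positivity
  set c5 := √(Ca ^ 2 * (4 * (8 * C2 + Λ ^ 2))) with hc5
  set ρ : ℝ := (1 / 2) ^ (θ' / 2) with hρ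
  have hρ0 : 0 < ρ := by positivity
  have hρ1 : ρ < 1 := rpow_lt_one (by norm_num) (by norm_num) (by positivity)
  have hsum := summ_half hρ0 hρ1
  set S := ∑' z : ℤ, ρ ^ (z.natAbs / 2) with hS
  have hS0 : 0 ≤ S := tsum_nonneg fun z => by positivity
  set κ := θ * (1 - θ') with hκ
  have hθ'' : 0 < 1 - θ' := by linarith
  have hκ0 : 0 ≤ κ := by positivity
  set c6 := c4 ^ (1 - θ') * c5 ^ θ' with hc6
  have hc60 : 0 ≤ c6 := by positivity
  have hpq : 0 ≤ p / (p - 1) := by positivity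
  refine ⟨Ca * (p / (p - 1)) + c6 * S + 1, κ, by nlinarith [mul_nonneg hCa hpq, mul_nonneg hc60 hS0],
    hκ0, by nlinarith, ?_⟩
  intro G T ι _ _ _ _ V v A oct L w W K pos hF B hB hval τ f hf
  have hB0 : 0 ≤ B := by linarith
  have hN := NN_nonneg p f
  have hT : ∀ z, NN p (Tz V A oct L τ z (cx f)) ≤ c6 * B ^ κ * NN p f * ρ ^ (z.natAbs / 2) := by
    intro z
    have hls : ∀ g, NN s (Tz V A oct L τ z g) ≤ c4 * B ^ θ * NN s g := by
      intro g
      refine (hF.Tz_Ls hΛ hCa hp1 hpp hp2 hθ hs hs1 hs2 hB0 hval τ z g).trans ?_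
      refine mul_le_mul_of_nonneg_right ?_ (NN_nonneg _ _)
      have h1 : 1 ≤ B ^ θ := one_le_rpow hB hθ0.le
      have h2 : Ca * (p / (p - 1)) ^ θ ≤ Ca * (p / (p - 1)) ^ θ * B ^ θ :=
        le_mul_of_one_le_right (by positivity) h1
      calc _ ≤ ((Ca * (1 + 2 * Λ)) ^ (p1 / 2) * B ^ θ + Ca * (p / (p - 1)) ^ θ * B ^ θ) *
            (4 * (CLP s + 1)) := by gcongr
        _ = _ := by rw [hc4]; ring
    have := hF.Tz_Lp hs1 hθ'0.le hθ'1.le hpe (by positivity) (by positivity) τ z hls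
      (hF.Tz_L2 hΛ hC2 hCa τ z) (cx f)
    refine this.trans (le_of_eq ?_)
    have e : NN p (cx f) = NN p f := NN_congr fun x => by simp [cx]
    have e2 : √((1 / 2 : ℝ) ^ (z.natAbs / 2)) ^ θ' = ρ ^ (z.natAbs / 2) := by
      rw [hρ, sqrt_eq_rpow, ← rpow_natCast _ (z.natAbs / 2),
        ← rpow_natCast _ (z.natAbs / 2), ← rpow_mul (by positivity),
        ← rpow_mul (by positivity), ← rpow_mul (by positivity)]
      congr 1; ring
    rw [e, ← hc5, mul_rpow (x := c5) (by positivity) (by positivity), e2,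
      mul_rpow (x := c4) hc40 (by positivity), ← rpow_mul hB0, ← hκ, hc6]
    ring
  have hpt : ∀ x, ‖cv (A (τ x)) f x‖ ≤ Ca * cv (pker V (oct (τ x))) f x +
      ∑ z ∈ Icc (-(L : ℤ)) L, ‖Tz V A oct L τ z (cx f) x‖ := by
    intro x
    rw [← norm_real, hF.decomp]
    refine (norm_add_le _ _).trans (add_le_add ?_ (norm_sum_le _ _))
    have h0 : 0 ≤ cv (pker V (oct (τ x))) f x := cv_nonneg (pker_prob hF.hV _).1 hf x
    rw [norm_mul, norm_real, norm_real, norm_of_nonneg (hF.mss_nonneg _),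
      norm_of_nonneg h0]
    exact mul_le_mul_of_nonneg_right (hF.mss_le _) h0
  refine (NN_mono' hp0 hpt).trans ((NN_add_le (by linarith) _ _).trans ?_)
  rw [NN_const_mul hp0, norm_of_nonneg hCa]
  have hP := P_valid hF.hV (by linarith : 1 < p) L
    (fun x => ⟨oct (τ x), Nat.lt_succ_of_le (hF.hoct _)⟩) f hf
  have h2 : NN p (fun x => ∑ z ∈ Icc (-(L : ℤ)) L, ‖Tz V A oct L τ z (cx f) x‖) ≤
      c6 * B ^ κ * NN p f * S := by
    refine (NN_sum_le (by linarith) _ _).trans ?_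
    calc _ ≤ ∑ z ∈ Icc (-(L : ℤ)) L, c6 * B ^ κ * NN p f * ρ ^ (z.natAbs / 2) := by
          refine sum_le_sum fun z _ => ?_
          rw [NN_norm (f := fun x => Tz V A oct L τ z (cx f) x)]
          exact hT z
      _ ≤ _ := by
          rw [← mul_sum]
          exact mul_le_mul_of_nonneg_left (hsum.sum_le_tsum _ fun z _ => by positivity) (by positivity)
  have hBκ : 1 ≤ B ^ κ := one_le_rpow hB hκ0
  have h3 : Ca * (p / (p - 1) * NN p f) ≤ Ca * (p / (p - 1)) * NN p f * B ^ κ := by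
    rw [← mul_assoc]; exact le_mul_of_one_le_right (by positivity) hBκ
  have h4 : 0 ≤ B ^ κ * NN p f := by positivity
  calc _ ≤ Ca * (p / (p - 1) * NN p f) + c6 * B ^ κ * NN p f * S :=
        add_le_add (mul_le_mul_of_nonneg_left hP hCa) h2
    _ ≤ Ca * (p / (p - 1)) * NN p f * B ^ κ + c6 * B ^ κ * NN p f * S + B ^ κ * NN p f := by linarith
    _ = _ := by ring

theorem engine {p1 p Ca Λ C2 : ℝ} (hp1 : 1 < p1) (hpp : p1 < p) (hp2 : p < 2) (hΛ : 0 ≤ Λ)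
    (hC2 : 1 ≤ C2) (hCa : 0 ≤ Ca) : ∃ C : ℝ, 1 ≤ C ∧
    ∀ {G T ι : Type} [Fintype G] [AddCommGroup G] [Fintype T] [Fintype ι]
    {V : G → ℝ} {v : AddChar G ℂ → ℝ} {A : T → G → ℝ} {oct : T → ℕ} {L : ℕ}
    {w : T → ι → ℂ} {W : ι → ℝ} {K : T → ι → G → ℂ} {pos : T → ℝ},
    Fam V v A oct L w W K pos p1 Ca Λ C2 → Valid A p C := by
  obtain ⟨C3, κ, h3, hκ0, hκ1, H⟩ := bootstrap hp1 hpp hp2 hΛ hC2 hCa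
  have hκ' : 0 < 1 - κ := by linarith
  have hp0 : 0 < p := by linarith
  refine ⟨C3 ^ (1 / (1 - κ)), one_le_rpow h3 (by positivity), ?_⟩
  intro G T ι _ _ _ _ V v A oct L w W K pos hF
  set S := {B : ℝ | 1 ≤ B ∧ Valid A p B} with hS
  have hbdd : BddBelow S := ⟨1, fun B hB => hB.1⟩
  have hne : S.Nonempty := by
    refine ⟨Fintype.card T * Ca + 1, by simp; positivity, ?_⟩
    intro τ f hf
    have h1 : ∀ x, ‖cv (A (τ x)) f x‖ ≤ ∑ t, cv (A t) f x := by
      intro x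
      rw [norm_of_nonneg (cv_nonneg (hF.hA _) hf x)]
      exact single_le_sum (f := fun t => cv (A t) f x)
        (fun t _ => cv_nonneg (hF.hA t) hf x) (mem_univ (τ x))
    refine (NN_mono' hp0 h1).trans ((NN_sum_le (by linarith) _ _).trans ?_)
    have hN := NN_nonneg p f
    have : ∀ t, NN p (fun x => cv (A t) f x) ≤ Ca * NN p f := by
      intro t
      refine (NN_cv_le (by linarith) (A t) f).trans (mul_le_mul_of_nonneg_right ?_ hN)
      simp only [norm_of_nonneg (hF.hA t _)]
      exact hF.mss_le t
    refine (sum_le_sum fun t _ => this t).trans ?_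
    simp only [sum_const, card_univ, nsmul_eq_mul]
    nlinarith
  set β := sInf S with hβ
  have hβ1 : 1 ≤ β := le_csInf hne fun B hB => hB.1
  have hvβ : Valid A p β := by
    intro τ f hf
    by_contra hc
    push Not at hc
    rcases (NN_nonneg p f).eq_or_lt with h0 | h0
    · obtain ⟨B, hB⟩ := hne
      have := hB.2 τ f hf
      rw [← h0] at this hc
      linarith
    · rw [← lt_div_iff₀ h0] at hc
      obtain ⟨B, hB, hlt⟩ := exists_lt_of_csInf_lt hne hc
      rw [lt_div_iff₀ h0] at hlt
      exact absurd (hB.2 τ f hf) (not_le.2 hlt)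
  have hBκ := one_le_rpow hβ1 hκ0
  have hle : β ≤ C3 * β ^ κ := csInf_le hbdd ⟨by nlinarith, H hF β hβ1 hvβ⟩
  have hb : β ≤ C3 ^ (1 / (1 - κ)) := by
    have hβ0 : 0 < β := by linarith
    have h1 : β ^ (1 - κ) ≤ C3 := by
      rw [rpow_sub hβ0, rpow_one, div_le_iff₀ (by positivity)]; exact hle
    have := rpow_le_rpow (by positivity) h1 (by positivity : 0 ≤ 1 / (1 - κ))
    rwa [← rpow_mul hβ0.le, mul_one_div_cancel hκ'.ne', rpow_one] at this
  intro τ f hf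
  exact (hvβ τ f hf).trans (mul_le_mul_of_nonneg_right hb (NN_nonneg _ _))

noncomputable def CS (R : ℕ) (a : ℕ → ℂ) (φ : ℝ) : ℂ :=
  a 0 + ∑ k ∈ range R, 2 * a (k + 1) * (cos ((k + 1) * φ) : ℂ)

noncomputable def sg (φ : ℝ) : ℝ := 2 - 2 * cos φ

theorem sg_nonneg (φ : ℝ) : 0 ≤ sg φ := by unfold sg; linarith [cos_le_one φ]

theorem sg_le (φ : ℝ) : sg φ ≤ 4 := by unfold sg; linarith [neg_one_le_cos φ]

theorem sg_eq (φ : ℝ) : sg φ = (2 * sin (φ / 2)) ^ 2 := by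
  have := cos_sq' (φ / 2)
  have h2 := cos_sq (φ / 2)
  rw [show 2 * (φ / 2) = φ by ring] at h2
  unfold sg; nlinarith

theorem abs_sin_nat (n : ℕ) (x : ℝ) : |sin (n * x)| ≤ n * |sin x| := by
  induction n with
  | zero => simp
  | succ k ih =>
    push_cast
    rw [add_mul, one_mul, sin_add]
    refine (abs_add_le _ _).trans ?_
    rw [abs_mul, abs_mul]
    nlinarith [abs_nonneg (sin x), abs_nonneg (sin (k * x)), abs_cos_le_one x,
      abs_cos_le_one (k * x), abs_nonneg (cos x), abs_nonneg (cos (k * x))]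

theorem one_sub_cos_nat (n : ℕ) (φ : ℝ) : 1 - cos (n * φ) ≤ n ^ 2 * sg φ / 2 := by
  have h1 := sg_eq (n * φ)
  have h2 := sg_eq φ
  have h3 := abs_sin_nat n (φ / 2)
  rw [← mul_div_assoc] at h3
  have h4 : sin (n * φ / 2) ^ 2 ≤ (n * |sin (φ / 2)|) ^ 2 := by
    rw [← sq_abs]; gcongr
  rw [mul_pow, sq_abs] at h4
  have h5 : 1 - cos (n * φ) = sg (n * φ) / 2 := by unfold sg; ring
  rw [h5, h1, h2]; nlinarith

theorem CS_zero (R : ℕ) (a : ℕ → ℂ) : CS R a 0 = a 0 + ∑ k ∈ range R, 2 * a (k + 1) := by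
  simp [CS]

theorem CS_add (R : ℕ) (a b : ℕ → ℂ) (φ : ℝ) : CS R (fun k => a k + b k) φ = CS R a φ + CS R b φ := by
  simp only [CS, mul_add, add_mul, sum_add_distrib]; ring

theorem CS_smul (R : ℕ) (c : ℂ) (b : ℕ → ℂ) (φ : ℝ) : CS R (fun k => c * b k) φ = c * CS R b φ := by
  simp only [CS, mul_add, mul_sum]
  congr 1
  exact sum_congr rfl fun k _ => by ring

theorem CS_sub (R : ℕ) (a b : ℕ → ℂ) (φ : ℝ) : CS R (fun k => a k - b k) φ = CS R a φ - CS R b φ := by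
  have h := CS_add R a (fun k => (-1) * b k) φ
  rw [CS_smul] at h
  rw [show (fun k => a k - b k) = fun k => a k + -1 * b k from funext fun k => by ring, h]; ring

theorem CS_diff (R : ℕ) (a : ℕ → ℂ) (φ : ℝ) : CS R a 0 - CS R a φ =
    ∑ k ∈ range R, 2 * a (k + 1) * ((1 - cos ((k + 1) * φ) : ℝ) : ℂ) := by
  rw [CS_zero, CS, add_sub_add_left_eq_sub, ← sum_sub_distrib]
  exact sum_congr rfl fun k _ => by push_cast; ring

theorem CS_near {R : ℕ} {a : ℕ → ℂ} {n B : ℝ} (hn : 0 < n)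
    (hB : ∑ k ∈ range R, (1 + ((k + 1) / n) ^ 2) * ‖a (k + 1)‖ ≤ B) (φ : ℝ) :
    ‖CS R a 0 - CS R a φ‖ ≤ 4 * B * min 1 (n ^ 2 * sg φ) := by
  have hs := sg_nonneg φ
  rw [CS_diff]
  refine (norm_sum_le _ _).trans ?_
  have hm : 0 ≤ min 1 (n ^ 2 * sg φ) := le_min zero_le_one (by positivity)
  calc _ ≤ ∑ k ∈ range R, 4 * ((1 + ((k + 1) / n) ^ 2) * ‖a (k + 1)‖) * min 1 (n ^ 2 * sg φ) := by
        refine sum_le_sum fun k _ => ?_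
        have h1 := one_sub_cos_nat (k + 1) φ
        push_cast at h1
        have h2 : 1 - cos ((k + 1) * φ) ≤ 2 := by linarith [neg_one_le_cos ((k + 1) * φ)]
        have h0 : 0 ≤ 1 - cos ((k + 1) * φ) := by linarith [cos_le_one ((k + 1) * φ)]
        rw [norm_mul, norm_mul, norm_real, norm_eq_abs, abs_of_nonneg h0]
        have h3 : 1 - cos ((k + 1) * φ) ≤ 2 * (1 + ((k + 1) / n) ^ 2) * min 1 (n ^ 2 * sg φ) := by
          rcases min_cases 1 (n ^ 2 * sg φ) with h | h
          · rw [h.1]; nlinarith [sq_nonneg (((k : ℝ) + 1) / n)]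
          · rw [h.1]
            have : (((k : ℝ) + 1) / n) ^ 2 * (n ^ 2 * sg φ) = (k + 1) ^ 2 * sg φ := by field_simp
            nlinarith [mul_nonneg (sq_nonneg n) hs, mul_nonneg (sq_nonneg ((k : ℝ) + 1)) hs]
        have h4 : (‖(2 : ℂ)‖ : ℝ) = 2 := by simp
        rw [h4]
        nlinarith [norm_nonneg (a (k + 1))]
    _ = 4 * (∑ k ∈ range R, (1 + ((k + 1) / n) ^ 2) * ‖a (k + 1)‖) * min 1 (n ^ 2 * sg φ) := by
        rw [← sum_mul, mul_sum]
    _ ≤ _ := by gcongr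

noncomputable def DK (m : ℕ) (φ : ℝ) : ℝ := 1 + ∑ k ∈ range m, 2 * cos ((k + 1) * φ)

theorem DK_sin (m : ℕ) (φ : ℝ) : DK m φ * sin (φ / 2) = sin ((2 * m + 1) * φ / 2) := by
  induction m with
  | zero => simp [DK]
  | succ k ih =>
    rw [DK, sum_range_succ, ← add_assoc, ← DK, add_mul, ih]
    push_cast
    have h1 : (2 * ((k : ℝ) + 1) + 1) * φ / 2 = (k + 1) * φ + φ / 2 := by ring
    have h2 : (2 * (k : ℝ) + 1) * φ / 2 = (k + 1) * φ - φ / 2 := by ring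
    rw [h1, h2, sin_add, sin_sub]; ring

theorem DK_le (m : ℕ) (φ : ℝ) : |DK m φ| ^ 2 * sg φ ≤ 4 := by
  have h := DK_sin m φ
  rw [sg_eq, sq_abs]
  have := sin_sq_le_one ((2 * m + 1) * φ / 2)
  rw [← h] at this
  nlinarith

theorem CS_abel (R : ℕ) (a : ℕ → ℂ) (φ : ℝ) : CS R a φ =
    ∑ m ∈ range R, (a m - a (m + 1)) * (DK m φ : ℂ) + a R * (DK R φ : ℂ) := by
  induction R with
  | zero => simp [CS, DK]
  | succ R ih =>
    rw [CS, sum_range_succ, ← add_assoc, ← CS, ih, sum_range_succ]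
    have : (DK (R + 1) φ : ℂ) = DK R φ + 2 * (cos ((R + 1) * φ) : ℂ) := by
      rw [DK, sum_range_succ, ← add_assoc, ← DK]; push_cast; ring
    rw [this]; ring

theorem CS_decay {R : ℕ} {a : ℕ → ℂ} {B : ℝ}
    (hB : ∑ m ∈ range R, ‖a m - a (m + 1)‖ + ‖a R‖ ≤ B) (φ : ℝ) :
    ‖CS R a φ‖ ^ 2 * sg φ ≤ 4 * B ^ 2 := by
  have hs := sg_nonneg φ
  have hD : ∀ m, |DK m φ| * sqrt (sg φ) ≤ 2 := by
    intro m
    refine abs_le_of_sq_le_sq' ?_ (by norm_num) |>.2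
    rw [mul_pow, sq_sqrt hs]; linarith [DK_le m φ]
  have h : ‖CS R a φ‖ * sqrt (sg φ) ≤ 2 * B := by
    rw [CS_abel]
    calc _ ≤ (∑ m ∈ range R, ‖a m - a (m + 1)‖ * |DK m φ| + ‖a R‖ * |DK R φ|) * sqrt (sg φ) := by
          gcongr
          refine (norm_add_le _ _).trans (add_le_add ((norm_sum_le _ _).trans (le_of_eq ?_)) (le_of_eq ?_))
          · exact sum_congr rfl fun m _ => by rw [norm_mul, norm_real, norm_eq_abs]
          · rw [norm_mul, norm_real, norm_eq_abs]
      _ = ∑ m ∈ range R, ‖a m - a (m + 1)‖ * (|DK m φ| * sqrt (sg φ)) + ‖a R‖ * (|DK R φ| * sqrt (sg φ)) := by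
          rw [add_mul, sum_mul]; simp only [mul_assoc]
      _ ≤ ∑ m ∈ range R, ‖a m - a (m + 1)‖ * 2 + ‖a R‖ * 2 := by
          gcongr <;> exact hD _
      _ ≤ _ := by rw [← sum_mul]; linarith
  have : (‖CS R a φ‖ * sqrt (sg φ)) ^ 2 ≤ (2 * B) ^ 2 := by gcongr
  rw [mul_pow, sq_sqrt hs] at this
  linarith

theorem sum_sq_id (m : ℕ) : ∑ k ∈ range m, ((k : ℝ) + 1) ^ 2 = (m : ℝ) * (m + 1) * (2 * m + 1) / 6 := by
  induction m with
  | zero => simp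
  | succ k ih => rw [sum_range_succ, ih]; push_cast; ring

theorem DK_eq (m : ℕ) (φ : ℝ) : DK m φ = 2 * m + 1 - ∑ k ∈ range m, 2 * (1 - cos ((k + 1) * φ)) := by
  rw [DK]
  simp only [mul_sub, sum_sub_distrib]
  simp; ring

theorem DK_bound {m : ℕ} (hm : 1 ≤ m) {φ : ℝ} (hφ : |φ| ≤ π) :
    |DK m φ| ≤ (2 * m + 1) * (1 - min 1 (m ^ 2 * sg φ) / 15) := by
  have hs := sg_nonneg φ
  have hm1 : (1 : ℝ) ≤ m := by exact_mod_cast hm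
  rcases le_or_gt 4 (m ^ 2 * sg φ) with h4 | h4
  · rw [min_eq_left (by linarith)]
    have h1 := DK_le m φ
    refine abs_le_of_sq_le_sq' (a := |DK m φ|) ?_ (by nlinarith) |>.2
    by_contra hc
    push Not at hc
    have : ((2 * m + 1 : ℝ) * (1 - 1 / 15)) ^ 2 * sg φ ≤ 4 := by nlinarith
    nlinarith
  · have hsp : |φ| ≤ π * |sin (φ / 2)| := by
      have h1 : sin (|φ| / 2) = |sin (φ / 2)| := by
        rcases abs_cases φ with h | h
        · rw [h.1, abs_of_nonneg]
          exact sin_nonneg_of_nonneg_of_le_pi (by linarith) (by linarith [abs_le.1 hφ |>.2, pi_pos])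
        · rw [h.1, neg_div, sin_neg, abs_of_nonpos]
          exact sin_nonpos_of_nonpos_of_neg_pi_le (by linarith) (by linarith [abs_le.1 hφ |>.1, pi_pos])
      have := mul_le_sin (x := |φ| / 2) (by positivity) (by linarith)
      rw [h1] at this
      have h2 : 2 / π * (|φ| / 2) = |φ| / π := by ring
      rw [h2, div_le_iff₀ pi_pos] at this
      linarith
    have hms : (m : ℝ) * |sin (φ / 2)| ≤ 1 := by
      refine abs_le_of_sq_le_sq' ?_ (by norm_num) |>.2
      rw [mul_pow, sq_abs]; rw [sg_eq] at h4; nlinarith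
    have hmφ : (m : ℝ) * |φ| ≤ π := by
      nlinarith [pi_pos]
    have hsφ : sg φ ≤ φ ^ 2 := by
      rw [sg_eq]
      have := abs_sin_le_abs (x := φ / 2)
      have h2 : sin (φ / 2) ^ 2 ≤ (φ / 2) ^ 2 := sq_le_sq.2 this
      nlinarith
    have hpi : π ^ 2 ≤ 10 := by nlinarith [pi_lt_d2, pi_pos]
    have lowk : ∀ k ∈ range m, (2 / 5 : ℝ) * sg φ * ((k : ℝ) + 1) ^ 2 ≤ 2 * (1 - cos ((k + 1) * φ)) := by
      intro k hk
      have hkm : (k : ℝ) + 1 ≤ m := by exact_mod_cast Finset.mem_range.1 hk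
      have e : 2 * (1 - cos ((k + 1) * φ)) = sg ((k + 1) * |φ|) := by
        unfold sg
        have : cos ((k + 1) * |φ|) = cos ((k + 1) * φ) := by
          rw [← cos_abs ((k + 1) * φ), abs_mul, abs_of_pos (by positivity : (0 : ℝ) < k + 1)]
        rw [this]; ring
      rw [e, sg_eq ((k + 1) * |φ|)]
      have h1 := mul_le_sin (x := (k + 1) * |φ| / 2) (by positivity)
        (by nlinarith [abs_nonneg φ])
      have h2 : (2 / π * ((k + 1) * |φ| / 2)) ^ 2 ≤ sin ((k + 1) * |φ| / 2) ^ 2 := by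
        have := pi_pos
        gcongr
      have h3 : (2 / π * ((k + 1) * |φ| / 2)) ^ 2 = (k + 1) ^ 2 * φ ^ 2 / π ^ 2 := by
        rw [← sq_abs φ]; field_simp
      have h5 : (k + 1 : ℝ) ^ 2 * φ ^ 2 / 10 ≤ (k + 1) ^ 2 * φ ^ 2 / π ^ 2 := by
        have := pi_pos
        gcongr
      rw [h3] at h2
      have : ((k : ℝ) + 1) ^ 2 * sg φ ≤ (k + 1) ^ 2 * φ ^ 2 := by gcongr
      rw [mul_pow]
      set X := ((k : ℝ) + 1) ^ 2 * φ ^ 2 / π ^ 2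
      set Y := sin ((k + 1) * |φ| / 2) ^ 2
      linarith
    have upk : ∀ k ∈ range m, 2 * (1 - cos ((k + 1) * φ)) ≤ sg φ * ((k : ℝ) + 1) ^ 2 := by
      intro k _
      have := one_sub_cos_nat (k + 1) φ
      push_cast at this; linarith
    have h1 := sum_le_sum lowk
    have h2 := sum_le_sum upk
    rw [← mul_sum (a := 2 / 5 * sg φ), sum_sq_id] at h1
    rw [← mul_sum (a := sg φ), sum_sq_id] at h2
    have hmin : min 1 (m ^ 2 * sg φ) ≤ m ^ 2 * sg φ := min_le_right _ _
    have hmin1 : min 1 (m ^ 2 * sg φ) ≤ 1 := min_le_left _ _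
    rw [abs_le, DK_eq]
    have hp : (0 : ℝ) < 2 * m + 1 := by positivity
    constructor
    · have a1 : sg φ * (m * (m + 1) * (2 * m + 1) / 6) ≤ (2 * m + 1) * (m ^ 2 * sg φ / 3) := by
        have : sg φ * (m * (m + 1)) ≤ sg φ * (m * (2 * m)) := by gcongr; linarith
        nlinarith
      nlinarith
    · have a1 : (2 * m + 1) * (m ^ 2 * sg φ / 15) ≤ 2 / 5 * sg φ * (m * (m + 1) * (2 * m + 1) / 6) := by
        have : sg φ * (m * m) ≤ sg φ * (m * (m + 1)) := by gcongr; linarith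
        nlinarith
      nlinarith

theorem sum_zmod {M : Type*} [AddCommMonoid M] (R : ℕ) (F : ℤ → M) :
    ∑ x : ZMod (2 * R + 1), F x.valMinAbs =
      F 0 + ∑ k ∈ range R, (F ((k : ℤ) + 1) + F (-((k : ℤ) + 1))) := by
  have h1 : ∑ x : ZMod (2 * R + 1), F x.valMinAbs = ∑ z ∈ Icc (-(R : ℤ)) R, F z := by
    refine Finset.sum_nbij (fun x => x.valMinAbs) ?_ ?_ ?_ fun _ _ => rfl
    · intro x _
      have := ZMod.valMinAbs_mem_Ioc x
      simp only [Set.mem_Ioc] at this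
      push_cast at this
      simp only [mem_Icc]; omega
    · exact (ZMod.injective_valMinAbs).injOn
    · intro z hz
      simp only [Finset.coe_Icc, Set.mem_Icc] at hz
      refine ⟨(z : ZMod (2 * R + 1)), by simp, ?_⟩
      rw [ZMod.valMinAbs_spec]
      refine ⟨rfl, ?_⟩
      simp only [Set.mem_Ioc]; push_cast; omega
  rw [h1]; clear h1
  induction R with
  | zero => simp
  | succ R ih =>
    have : Icc (-((R + 1 : ℕ) : ℤ)) ((R + 1 : ℕ) : ℤ) =
        insert ((R : ℤ) + 1) (insert (-((R : ℤ) + 1)) (Icc (-(R : ℤ)) R)) := by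
      ext z; simp; omega
    rw [this, sum_insert (by simp; omega), sum_insert (by simp), ih,
      sum_range_succ]
    abel

noncomputable def rad (R : ℕ) (a : ℕ → ℂ) : ZMod (2 * R + 1) → ℂ := fun x => a x.valMinAbs.natAbs

theorem sum_rad {M : Type*} [AddCommMonoid M] (R : ℕ) (F : ℕ → M) :
    ∑ x : ZMod (2 * R + 1), F x.valMinAbs.natAbs =
      F 0 + ∑ k ∈ range R, (F (k + 1) + F (k + 1)) := by
  rw [sum_zmod R (fun z => F z.natAbs)]
  simp only [Int.natAbs_neg, Int.natAbs_zero]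
  rfl

noncomputable def ph {R : ℕ} (ψ : AddChar (ZMod (2 * R + 1)) ℂ) : ℝ := Complex.arg (ψ 1)

theorem ph_le {R : ℕ} (ψ : AddChar (ZMod (2 * R + 1)) ℂ) : |ph ψ| ≤ π := Complex.abs_arg_le_pi _

theorem psi_eq {R : ℕ} (ψ : AddChar (ZMod (2 * R + 1)) ℂ) (x : ZMod (2 * R + 1)) :
    ψ (-x) = Complex.exp (-(x.valMinAbs * ph ψ) * I) := by
  have h1 : ψ 1 = Complex.exp (ph ψ * I) := by
    have := Complex.norm_mul_exp_arg_mul_I (ψ 1)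
    rw [AddChar.norm_apply] at this
    simpa [ph] using this.symm
  have h2 : -x = (-x.valMinAbs) • (1 : ZMod (2 * R + 1)) := by
    simp [zsmul_one]
  rw [h2, AddChar.map_zsmul_eq_zpow, h1, ← Complex.exp_int_mul]
  congr 1; push_cast; ring

theorem hat_rad {R : ℕ} (a : ℕ → ℂ) (ψ : AddChar (ZMod (2 * R + 1)) ℂ) :
    hat (rad R a) ψ = CS R a (ph ψ) := by
  unfold hat rad
  simp only [psi_eq]
  rw [sum_zmod R (fun z => a z.natAbs * Complex.exp (-(z * ph ψ) * I)), CS]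
  congr 1
  · simp
  · refine sum_congr rfl fun k _ => ?_
    rw [Int.natAbs_neg, show ((k : ℤ) + 1).natAbs = k + 1 from rfl]
    push_cast
    rw [Complex.cos]; ring_nf

theorem sum_rad_eq (R : ℕ) (a : ℕ → ℂ) : ∑ x, rad R a x = CS R a 0 := by
  unfold rad
  rw [sum_rad R a, CS_zero]; simp only [two_mul]

noncomputable def PK (R d : ℕ) (a : ℕ → ℂ) : (Fin d → ZMod (2 * R + 1)) → ℂ := fun x => ∏ j, rad R a (x j)

theorem hat_PK {R d : ℕ} (a : ℕ → ℂ) (χ : AddChar (Fin d → ZMod (2 * R + 1)) ℂ) :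
    hat (PK R d a) χ = ∏ j, CS R a (ph (chi χ j)) := by
  unfold PK
  rw [hat_prod (fun _ => rad R a)]
  simp only [hat_rad]

theorem sum_PK (R d : ℕ) (a : ℕ → ℂ) : ∑ x, PK R d a x = CS R a 0 ^ d := by
  unfold PK
  rw [sum_prod_eq (fun _ => rad R a)]
  simp [sum_rad_eq]

theorem sum_norm_PK {R d : ℕ} {a : ℕ → ℂ} (h0 : ∀ k, ((‖a k‖ : ℝ) : ℂ) = a k) (h1 : CS R a 0 = 1) :
    ∑ x, ‖PK R d a x‖ ≤ 1 := by
  have h : ∀ x, ((‖PK R d a x‖ : ℝ) : ℂ) = PK R d a x := by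
    intro x
    unfold PK rad
    rw [norm_prod]; push_cast; simp only [h0]
  have : ((∑ x, ‖PK R d a x‖ : ℝ) : ℂ) = 1 := by
    push_cast; simp only [h]; rw [sum_PK, h1, one_pow]
  have h2 : (∑ x, ‖PK R d a x‖ : ℝ) = 1 := by exact_mod_cast this
  exact h2.le

theorem contr2 {R d : ℕ} {a : ℕ → ℂ} (h : ∀ φ, |φ| ≤ π → ‖CS R a φ‖ ≤ 1)
    (χ : AddChar (Fin d → ZMod (2 * R + 1)) ℂ) : ‖hat (PK R d a) χ‖ ≤ 1 := by
  rw [hat_PK, norm_prod]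
  exact prod_le_one (fun _ _ => norm_nonneg _) fun j _ => h _ (ph_le _)

theorem PK_diff {R d : ℕ} {a : ℂ → ℕ → ℂ} {S : Set ℂ}
    (hd : ∀ k, DifferentiableOn ℂ (fun w => a w k) S) (x : Fin d → ZMod (2 * R + 1)) :
    DifferentiableOn ℂ (fun w => PK R d (a w) x) S := by
  unfold PK rad
  exact DifferentiableOn.fun_finsetProd fun j _ => hd _

theorem contrp {R d : ℕ} {p : ℝ} (hp : 1 < p) (hp2 : p ≤ 2) {a : ℂ → ℕ → ℂ} {ρ : ℝ} (hρ : 0 < ρ)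
    (hd : ∀ k, DifferentiableOn ℂ (fun w => a w k) (Metric.ball 0 ρ))
    (h2 : ∀ w ∈ Metric.ball (0 : ℂ) ρ, ∀ φ, |φ| ≤ π → ‖CS R (a w) φ‖ ≤ 1)
    (hr : ∀ r : ℝ, |r| < ρ → (∀ k, ((‖a r k‖ : ℝ) : ℂ) = a r k) ∧ CS R (a r) 0 = 1)
    (w : ℂ) (hw : ‖w‖ ≤ (1 - 1 / p) / 2 * ρ) (f : (Fin d → ZMod (2 * R + 1)) → ℂ) :
    NN p (cv (PK R d (a w)) f) ≤ NN p f :=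
  disc_lemma hp hp2 (fun w => PK R d (a w)) hρ (PK_diff hd) (fun w hw => contr2 (h2 w hw))
    (fun r hr' => sum_norm_PK (hr r hr').1 (hr r hr').2) w hw f

noncomputable def aV : ℕ → ℂ := fun k => if k = 0 then 1 / 2 else if k = 1 then 1 / 4 else 0
noncomputable def VV (R d : ℕ) : (Fin d → ZMod (2 * R + 1)) → ℝ := fun x => ‖PK R d aV x‖
noncomputable def vs {R d : ℕ} (χ : AddChar (Fin d → ZMod (2 * R + 1)) ℂ) : ℝ :=
  ∏ j, (1 - sg (ph (chi χ j)) / 4)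

theorem CS_aV {R : ℕ} (hR : 1 ≤ R) (φ : ℝ) : CS R aV φ = ((1 - sg φ / 4 : ℝ) : ℂ) := by
  obtain ⟨r, rfl⟩ : ∃ r, R = r + 1 := ⟨R - 1, by omega⟩
  rw [CS, sum_range_succ']
  simp [aV, sg]; ring

theorem aV_norm (k : ℕ) : ((‖aV k‖ : ℝ) : ℂ) = aV k := by
  unfold aV; split_ifs <;> simp

theorem cx_VV (R d : ℕ) : cx (VV R d) = PK R d aV := by
  funext x
  unfold cx VV PK rad
  rw [norm_prod]; push_cast; simp only [aV_norm]

theorem VV_prob {R d : ℕ} (hR : 1 ≤ R) : IsProb (VV R d) := by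
  refine ⟨fun x => norm_nonneg _, ?_⟩
  have h : ((∑ x, VV R d x : ℝ) : ℂ) = 1 := by
    push_cast
    have := sum_PK R d aV
    rw [← cx_VV, CS_aV hR] at this
    simpa [cx, sg] using this
  exact_mod_cast h

theorem VV_hat {R d : ℕ} (hR : 1 ≤ R) (χ : AddChar (Fin d → ZMod (2 * R + 1)) ℂ) :
    hat (cx (VV R d)) χ = vs χ := by
  rw [cx_VV, hat_PK, vs]; push_cast
  exact prod_congr rfl fun j _ => by rw [CS_aV hR]; push_cast; ring

theorem prod_one_sub {ι : Type*} (s : Finset ι) (f : ι → ℝ) (h0 : ∀ i, 0 ≤ f i) (h1 : ∀ i, f i ≤ 1) :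
    0 ≤ ∏ i ∈ s, (1 - f i) ∧ ∏ i ∈ s, (1 - f i) ≤ 1 ∧ 1 - ∑ i ∈ s, f i ≤ ∏ i ∈ s, (1 - f i) := by
  induction s using cons_induction with
  | empty => simp
  | cons a s ha ih =>
    rw [prod_cons, sum_cons]
    have := h0 a; have := h1 a
    refine ⟨mul_nonneg (by linarith) ih.1, by nlinarith [ih.1, ih.2.1], by nlinarith [ih.1, ih.2.1, ih.2.2]⟩

theorem prod_one_sub_le_exp {ι : Type*} (s : Finset ι) (f : ι → ℝ) (h1 : ∀ i, f i ≤ 1) :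
    ∏ i ∈ s, (1 - f i) ≤ exp (-∑ i ∈ s, f i) := by
  rw [← Finset.sum_neg_distrib, exp_sum]
  exact Finset.prod_le_prod (fun i _ => by linarith [h1 i]) fun i _ => one_sub_le_exp_neg _

theorem norm_prod_sub_one {ι : Type*} (s : Finset ι) (f : ι → ℂ) (h : ∀ i, ‖f i‖ ≤ 1) :
    ‖∏ i ∈ s, f i - 1‖ ≤ ∑ i ∈ s, ‖1 - f i‖ := by
  induction s using cons_induction with
  | empty => simp
  | cons a s ha ih =>
    rw [prod_cons, sum_cons]
    have e : f a * ∏ i ∈ s, f i - 1 = f a * (∏ i ∈ s, f i - 1) + -(1 - f a) := by ring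
    rw [e]
    refine (norm_add_le _ _).trans ?_
    rw [norm_mul, norm_neg]
    nlinarith [h a, norm_nonneg (f a), norm_nonneg (∏ i ∈ s, f i - 1)]

theorem prod_one_add_ge {ι : Type*} (s : Finset ι) (f : ι → ℝ) (h0 : ∀ i, 0 ≤ f i) :
    1 + ∑ i ∈ s, f i ≤ ∏ i ∈ s, (1 + f i) := by
  induction s using cons_induction with
  | empty => simp
  | cons a s ha ih =>
    rw [prod_cons, sum_cons]
    have h2 := sum_nonneg (s := s) fun i _ => h0 i
    nlinarith [h0 a]

theorem vs_01 {R d : ℕ} (χ : AddChar (Fin d → ZMod (2 * R + 1)) ℂ) : 0 ≤ vs χ ∧ vs χ ≤ 1 ∧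
    1 - vs χ ≤ (∑ j, sg (ph (chi χ j))) / 4 ∧
      min (∑ j, sg (ph (chi χ j))) 4 ≤ 8 * (1 - vs χ) := by
  have h0 : ∀ j, 0 ≤ sg (ph (chi χ j)) / 4 := fun j => by have := sg_nonneg (ph (chi χ j)); positivity
  have h1 : ∀ j, sg (ph (chi χ j)) / 4 ≤ 1 := fun j => by have := sg_le (ph (chi χ j)); linarith
  have h := prod_one_sub univ _ h0 h1
  have h' := prod_one_sub_le_exp univ _ h1
  rw [← sum_div] at h h'
  unfold vs
  refine ⟨h.1, h.2.1, by linarith [h.2.2], ?_⟩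
  set l := ∑ j, sg (ph (chi χ j)) with hl
  have hl0 : 0 ≤ l := sum_nonneg fun j _ => sg_nonneg _
  have he : exp (-(l / 4)) ≤ 1 / (1 + l / 4) := by
    rw [exp_neg, ← one_div]
    exact one_div_le_one_div_of_le (by positivity) (by linarith [add_one_le_exp (l / 4)])
  have h3 : ∏ j, (1 - sg (ph (chi χ j)) / 4) ≤ 1 / (1 + l / 4) := h'.trans he
  have h4 : min l 4 / 8 ≤ 1 - 1 / (1 + l / 4) := by
    have : 1 - 1 / (1 + l / 4) = (l / 4) / (1 + l / 4) := by field_simp; ring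
    rw [this, le_div_iff₀ (by positivity)]
    rcases min_cases l 4 with h | h <;> rw [h.1] <;> nlinarith
  linarith

def Good (R : ℕ) (n c C : ℝ) (a : ℕ → ℂ) : Prop := CS R a 0 = 1 ∧ ∀ φ, |φ| ≤ π →
  ‖CS R a φ‖ ^ 2 * (1 + c * (n ^ 2 * sg φ)) ≤ 1 ∧ ‖1 - CS R a φ‖ ≤ C * (n ^ 2 * sg φ)

theorem Good.one {R : ℕ} {n c C : ℝ} {a : ℕ → ℂ} (h : Good R n c C a) (hc : 0 ≤ c) (φ : ℝ)
    (hφ : |φ| ≤ π) : ‖CS R a φ‖ ≤ 1 := by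
  have := (h.2 φ hφ).1
  have hs : 0 ≤ c * (n ^ 2 * sg φ) := mul_nonneg hc (mul_nonneg (sq_nonneg _) (sg_nonneg φ))
  have h2 : ‖CS R a φ‖ ^ 2 ≤ 1 ^ 2 := by nlinarith [sq_nonneg ‖CS R a φ‖]
  exact abs_le_of_sq_le_sq' h2 zero_le_one |>.2

theorem Good.near {R d : ℕ} {n c C : ℝ} {a : ℕ → ℂ} (h : Good R n c C a) (hc : 0 ≤ c) (hC : 0 ≤ C) {k : ℕ}
    (hk : n ^ 2 ≤ 2 * 2 ^ k) (χ : AddChar (Fin d → ZMod (2 * R + 1)) ℂ) :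
    ‖hat (PK R d a) χ - 1‖ ≤ (16 * C + 4) * (2 ^ k * (1 - vs χ)) := by
  obtain ⟨v0, v1, hv, hv'⟩ := vs_01 χ
  have h1 : ‖hat (PK R d a) χ - 1‖ ≤ C * (n ^ 2 * ∑ j, sg (ph (chi χ j))) := by
    rw [hat_PK]
    refine (norm_prod_sub_one _ _ fun j => h.one hc _ (ph_le _)).trans ?_
    rw [mul_sum, mul_sum]
    exact sum_le_sum fun j _ => (h.2 _ (ph_le _)).2
  have h2 : ‖hat (PK R d a) χ - 1‖ ≤ 2 := by
    refine (norm_sub_le _ _).trans ?_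
    have := contr2 (d := d) (h.one hc) χ
    rw [norm_one]; linarith
  have hk1 : (1 : ℝ) ≤ 2 ^ k := one_le_pow₀ (by norm_num)
  have hy : 0 ≤ 2 ^ k * (1 - vs χ) := mul_nonneg (by positivity) (by linarith)
  set l := ∑ j, sg (ph (chi χ j)) with hl
  have hl0 : 0 ≤ l := sum_nonneg fun j _ => sg_nonneg _
  rcases min_cases l 4 with h3 | h3 <;> rw [h3.1] at hv'
  · have : n ^ 2 * l ≤ 2 * 2 ^ k * (8 * (1 - vs χ)) := by gcongr
    nlinarith [mul_le_mul_of_nonneg_left this hC]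
  · nlinarith [mul_nonneg hC hy]

theorem Good.dec {R d : ℕ} {n c C : ℝ} {a : ℕ → ℂ} (h : Good R n c C a) (hc : 0 < c) {k : ℕ}
    (hk : 2 ^ k ≤ n ^ 2) (χ : AddChar (Fin d → ZMod (2 * R + 1)) ℂ) :
    ‖hat (PK R d a) χ‖ ^ 2 * (2 ^ k * (1 - vs χ)) ≤ 1 / (4 * c) := by
  obtain ⟨v0, v1, hv, hv'⟩ := vs_01 χ
  have h1 : ‖hat (PK R d a) χ‖ ^ 2 * (1 + c * (n ^ 2 * ∑ j, sg (ph (chi χ j)))) ≤ 1 := by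
    have e : ‖hat (PK R d a) χ‖ ^ 2 = ∏ j, ‖CS R a (ph (chi χ j))‖ ^ 2 := by
      rw [hat_PK, norm_prod, Finset.prod_pow]
    have h2 := prod_one_add_ge univ (fun j => c * (n ^ 2 * sg (ph (chi χ j))))
      fun j => mul_nonneg hc.le (mul_nonneg (sq_nonneg _) (sg_nonneg _))
    rw [← mul_sum, ← mul_sum] at h2
    refine (mul_le_mul_of_nonneg_left h2 (sq_nonneg _)).trans ?_
    rw [e, ← prod_mul_distrib]
    refine prod_le_one (fun j _ => ?_) fun j _ => (h.2 _ (ph_le _)).1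
    exact mul_nonneg (sq_nonneg _) (add_nonneg zero_le_one (mul_nonneg hc.le (mul_nonneg (sq_nonneg _) (sg_nonneg _))))
  set l := ∑ j, sg (ph (chi χ j)) with hl
  have hl0 : 0 ≤ l := sum_nonneg fun j _ => sg_nonneg _
  have h3 : 2 ^ k * (1 - vs χ) ≤ n ^ 2 * (l / 4) := by
    have : 0 ≤ 1 - vs χ := by linarith
    gcongr
  rw [le_div_iff₀ (by positivity)]
  have h4 := mul_le_mul_of_nonneg_left h3 (sq_nonneg ‖hat (PK R d a) χ‖)
  nlinarith [mul_le_mul_of_nonneg_left h4 hc.le, sq_nonneg ‖hat (PK R d a) χ‖]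

theorem combine {X y c C : ℝ} (hX : 0 ≤ X) (hy : 0 ≤ y) (hc : 0 < c) (hc1 : c ≤ 1) (hC : 1 ≤ C)
    (h1 : X ≤ 1 - c * min 1 y) (h2 : X ^ 2 * y ≤ C) : X ^ 2 * (1 + c / C * y) ≤ 1 := by
  have hX1 : X ≤ 1 := by
    have : 0 ≤ min 1 y := le_min zero_le_one hy
    nlinarith
  have hcC : c / C ≤ c := div_le_self hc.le hC
  rcases min_cases 1 y with h | h <;> rw [h.1] at h1
  · have : c / C * (X ^ 2 * y) ≤ c / C * C := by gcongr
    rw [div_mul_cancel₀ _ (by positivity)] at this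
    nlinarith
  · have h3 : X ^ 2 ≤ 1 - c * y := by nlinarith
    have h4 : X ^ 2 * (1 + c / C * y) ≤ X ^ 2 * (1 + c * y) := by gcongr
    nlinarith [mul_nonneg hc.le hy]

theorem mkFam {R d : ℕ} (hR : 1 ≤ R) {T ι : Type} [Fintype T] [Fintype ι] {p1 Ca Λ c C : ℝ}
    (hp2 : p1 ≤ 2) (hc : 0 < c) (hC : 0 ≤ C) (hΛ : 0 ≤ Λ)
    {A : T → (Fin d → ZMod (2 * R + 1)) → ℝ} {n : T → ℝ} (hn : ∀ t, 1 ≤ n t)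
    {w : T → ι → ℂ} {W : ι → ℝ} {a : T → ι → ℕ → ℂ}
    (hA : ∀ t x, 0 ≤ A t x) (hAK : ∀ t x, (A t x : ℂ) = ∑ m, w t m * PK R d (a t m) x)
    (hw : ∀ t m, ‖w t m‖ ≤ W m) (hW0 : ∀ m, 0 ≤ W m) (hW : ∑ m, W m ≤ Ca)
    (hg : ∀ t m, Good R (n t) c C (a t m))
    (hcon : ∀ t m f, NN p1 (cv (PK R d (a t m)) f) ≤ NN p1 f)
    (hlip : ∀ r, p1 ≤ r → r ≤ 2 → ∀ t t' m, n t ≤ n t' → n t' ≤ 2 * n t → ∀ f,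
      NN r (fun x => cv (PK R d (a t m)) f x - cv (PK R d (a t' m)) f x) ≤
        Λ * ((n t' - n t) / n t) * NN r f) :
    ∃ (oct : T → ℕ) (L : ℕ) (pos : T → ℝ), Fam (VV R d) vs A oct L w W (fun t m => PK R d (a t m)) pos
      p1 Ca Λ (16 * C + 4 + 1 / (4 * c)) := by
  classical
  have hex : ∀ t, ∃ k : ℕ, (2 : ℝ) ^ k ≤ n t ^ 2 ∧ n t ^ 2 < 2 * 2 ^ k := by
    intro t
    obtain ⟨k, h1, h2⟩ := exists_nat_pow_near (one_le_pow₀ (n := 2) (hn t)) (one_lt_two)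
    exact ⟨k, h1, by rw [pow_succ (2 : ℝ) k] at h2; linarith⟩
  choose oct o1 o2 using hex
  have hs : ∀ k : ℕ, 0 < sqrt (2 ^ k) := fun k => Real.sqrt_pos.2 (by positivity)
  have hn0 : ∀ t, 0 < n t := fun t => by linarith [hn t]
  have hsn : ∀ t, sqrt (2 ^ oct t) ≤ n t := fun t => by
    rw [sqrt_le_left (hn0 t).le]; exact o1 t
  have hns : ∀ t, n t < 2 * sqrt (2 ^ oct t) := fun t => by
    refine abs_lt_of_sq_lt_sq' ?_ (by positivity) |>.2
    rw [mul_pow, sq_sqrt (by positivity)]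
    have : (0 : ℝ) < 2 ^ oct t := by positivity
    linarith [o2 t]
  have hlip' : ∀ r, p1 ≤ r → r ≤ 2 → ∀ t t' m, oct t = oct t' → ∀ f,
      NN r (fun x => cv (PK R d (a t m)) f x - cv (PK R d (a t' m)) f x) ≤
        Λ * |n t / sqrt (2 ^ oct t) - n t' / sqrt (2 ^ oct t')| * NN r f := by
    intro r hr1 hr2 t t' m ho f
    have hN := NN_nonneg r f
    have key : ∀ t t', oct t = oct t' → n t ≤ n t' → (n t' - n t) / n t ≤
        |n t / sqrt (2 ^ oct t) - n t' / sqrt (2 ^ oct t')| ∧ n t' ≤ 2 * n t := by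
      intro t t' ho hle
      rw [← ho, ← sub_div, abs_div, abs_of_pos (hs _), abs_sub_comm, abs_of_nonneg (by linarith)]
      refine ⟨div_le_div_of_nonneg_left (by linarith) (hs _) (hsn t), ?_⟩
      have := hns t'; have := hsn t
      rw [← ho] at *; linarith
    rcases le_total (n t) (n t') with h | h
    · obtain ⟨k1, k2⟩ := key t t' ho h
      refine (hlip r hr1 hr2 t t' m h k2 f).trans ?_
      gcongr
    · obtain ⟨k1, k2⟩ := key t' t ho.symm h
      rw [abs_sub_comm] at k1
      have e : NN r (fun x => cv (PK R d (a t m)) f x - cv (PK R d (a t' m)) f x) =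
          NN r (fun x => cv (PK R d (a t' m)) f x - cv (PK R d (a t m)) f x) :=
        NN_congr fun x => norm_sub_rev _ _
      rw [e]
      refine (hlip r hr1 hr2 t' t m h k2 f).trans ?_
      gcongr
  have hv := fun χ => vs_01 (R := R) (d := d) χ
  have hy : ∀ t (χ : AddChar (Fin d → ZMod (2 * R + 1)) ℂ), 0 ≤ 2 ^ oct t * (1 - vs χ) := fun t χ =>
    mul_nonneg (by positivity) (by linarith [(hv χ).2.1])
  have hci : 0 < 1 / (4 * c) := by positivity
  refine ⟨oct, Finset.univ.sup oct, fun t => n t / sqrt (2 ^ oct t), ?_⟩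
  exact {
    hV := VV_prob hR
    hv := VV_hat hR
    v0 := fun χ => (hv χ).1
    v1 := fun χ => (hv χ).2.1
    hA := hA
    hoct := fun t => Finset.le_sup (mem_univ t)
    hAK := hAK
    hw := hw
    hW0 := hW0
    hW := hW
    hmass := fun t m => by rw [sum_PK, (hg t m).1, one_pow]
    hcon := hcon
    h2 := fun t m => contr2 ((hg t m).one hc.le)
    hnear := fun t m χ => ((hg t m).near hc.le hC (o2 t).le χ).trans (by
      exact mul_le_mul_of_nonneg_right (by linarith) (hy t χ))
    hdec := fun t m χ => ((hg t m).dec hc (o1 t) χ).trans (by linarith)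
    hlip1 := hlip' p1 le_rfl hp2
    hlip2 := hlip' 2 hp2 le_rfl
    hpos0 := fun t => div_nonneg (hn0 t).le (hs _).le
    hpos2 := fun t => by rw [div_lt_iff₀ (hs _)]; exact hns t }

noncomputable def ub (m : ℕ) : ℕ → ℂ := fun k => if k ≤ m then (1 / (2 * m + 1) : ℂ) else 0

theorem sum_le_range {M : Type*} [AddCommMonoid M] {R m : ℕ} (h : m ≤ R) (F : ℕ → M)
    (hF : ∀ k, m ≤ k → F k = 0) : ∑ k ∈ range R, F k = ∑ k ∈ range m, F k :=
  (Finset.sum_subset (range_mono h) fun k _ hk => hF k (by simpa using hk)).symm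

theorem CS_ub {R m : ℕ} (h : m ≤ R) (φ : ℝ) : CS R (ub m) φ = ((DK m φ / (2 * m + 1) : ℝ) : ℂ) := by
  rw [CS, sum_le_range h]
  · rw [DK]; push_cast
    rw [add_div, sum_div]
    congr 1
    · refine sum_congr rfl fun k hk => ?_
      rw [ub, if_pos (by have := Finset.mem_range.1 hk; omega)]; ring
  · intro k hk; rw [ub, if_neg (by omega)]; simp

theorem DK_zero (m : ℕ) : DK m 0 = 2 * m + 1 := by simp [DK]; ring

theorem norm_CS_ub {R m : ℕ} (h : m ≤ R) (hm : 1 ≤ m) {φ : ℝ} (hφ : |φ| ≤ π) :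
    ‖CS R (ub m) φ‖ ≤ 1 - 1 / 15 * min 1 ((m : ℝ) ^ 2 * sg φ) := by
  have hp : (0 : ℝ) < 2 * m + 1 := by positivity
  rw [CS_ub h, norm_real, norm_eq_abs, abs_div, abs_of_pos hp, div_le_iff₀ hp]
  linarith [DK_bound hm hφ]

theorem good_ub {R m : ℕ} (h : m ≤ R) (hm : 1 ≤ m) : Good R m (1 / 15) 4 (ub m) := by
  have hp : (0 : ℝ) < 2 * m + 1 := by positivity
  have hm0 : (0 : ℝ) < m := by exact_mod_cast hm
  have h0 : CS R (ub m) 0 = 1 := by rw [CS_ub h, DK_zero, div_self hp.ne']; simp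
  refine ⟨h0, fun φ hφ => ⟨?_, ?_⟩⟩
  · have := sg_nonneg φ
    have := combine (c := 1 / 15) (C := 1) (norm_nonneg _) (by positivity) (by norm_num) (by norm_num) le_rfl
      (norm_CS_ub h hm hφ) ?_
    · simpa using this
    · rw [CS_ub h, norm_real, norm_eq_abs, abs_div, abs_of_pos hp, div_pow,
        div_mul_eq_mul_div, div_le_one (by positivity)]
      have := DK_le m φ
      nlinarith
  · rw [← h0]
    refine (CS_near (n := m) (B := 1) hm0 ?_ φ).trans ?_
    · rw [sum_le_range h]
      · calc _ ≤ ∑ k ∈ range m, (1 + 1) * (1 / (2 * m + 1) : ℝ) := by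
              refine sum_le_sum fun k hk => ?_
              have hk' : (k : ℝ) + 1 ≤ m := by exact_mod_cast Finset.mem_range.1 hk
              rw [ub, if_pos (by have := Finset.mem_range.1 hk; omega)]
              have e : ‖(1 / (2 * m + 1) : ℂ)‖ = 1 / (2 * m + 1) := by
                rw [show (1 / (2 * m + 1) : ℂ) = ((1 / (2 * m + 1) : ℝ) : ℂ) by push_cast; rfl,
                  norm_real, norm_of_nonneg (by positivity)]
              rw [e]
              gcongr
              exact pow_le_one₀ (by positivity) ((div_le_one hm0).2 hk')
          _ ≤ 1 := by
              simp only [sum_const, card_range, nsmul_eq_mul]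
              rw [← mul_assoc, mul_one_div, div_le_one hp]; linarith
      · intro k hk; rw [ub, if_neg (by omega)]; simp
    · have := min_le_right 1 ((m : ℝ) ^ 2 * sg φ)
      linarith

theorem ub_diff {R n n' : ℕ} (hn : 1 ≤ n) (h : n ≤ n') (h2 : n' ≤ 2 * n) (hR : n' ≤ R) (φ : ℝ) :
    ‖CS R (ub n') φ - CS R (ub n) φ‖ ≤ 16 * (((n' : ℝ) - n) / n) * min 1 ((n : ℝ) ^ 2 * sg φ) := by
  have hn0 : (0 : ℝ) < n := by exact_mod_cast hn
  have hnn : (n : ℝ) ≤ n' := by exact_mod_cast h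
  have hnn2 : (n' : ℝ) ≤ 2 * n := by exact_mod_cast h2
  have e0 : CS R (fun k => ub n' k - ub n k) 0 = 0 := by
    rw [CS_sub, (good_ub hR (by omega)).1, (good_ub (by omega) hn).1, sub_self]
  have h3 := CS_near (R := R) (a := fun k => ub n' k - ub n k) (n := n) (B := 4 * (((n' : ℝ) - n) / n)) hn0 ?_ φ
  · rw [e0, zero_sub, norm_neg, CS_sub] at h3
    refine h3.trans (le_of_eq (by ring))
  · have eu : ∀ m : ℕ, (1 / (2 * m + 1) : ℂ) = ((1 / (2 * m + 1) : ℝ) : ℂ) := fun m => by push_cast; rfl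
    rw [sum_le_range hR, ← Finset.sum_range_add_sum_Ico _ h]
    · have A1 : ∑ k ∈ range n, (1 + (((k : ℝ) + 1) / n) ^ 2) * ‖ub n' (k + 1) - ub n (k + 1)‖ ≤
          ∑ k ∈ range n, (((n' : ℝ) - n) / n) / n := by
        refine sum_le_sum fun k hk => ?_
        have hk1 := Finset.mem_range.1 hk
        have hk' : (k : ℝ) + 1 ≤ n := by exact_mod_cast hk1
        rw [ub, ub, if_pos (by omega), if_pos (by omega), eu, eu, ← Complex.ofReal_sub, norm_real,
          norm_eq_abs]
        have e : (1 / (2 * (n' : ℝ) + 1) - 1 / (2 * n + 1)) = -(2 * (n' - n) / ((2 * n' + 1) * (2 * n + 1))) := by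
          field_simp; ring
        rw [e, abs_neg, abs_of_nonneg (div_nonneg (by linarith) (by positivity))]
        calc _ ≤ (1 + 1) * (2 * ((n' : ℝ) - n) / ((2 * n) * (2 * n))) := by
              have : 0 ≤ (n' : ℝ) - n := by linarith
              gcongr
              · exact pow_le_one₀ (by positivity) ((div_le_one hn0).2 hk')
              · linarith
              · linarith
          _ = _ := by field_simp; ring
      have A2 : ∑ k ∈ Ico n n', (1 + (((k : ℝ) + 1) / n) ^ 2) * ‖ub n' (k + 1) - ub n (k + 1)‖ ≤
          ∑ k ∈ Ico n n', 5 * (1 / (2 * n : ℝ)) := by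
        refine sum_le_sum fun k hk => ?_
        have hk1 := Finset.mem_Ico.1 hk
        have hk' : (k : ℝ) + 1 ≤ n' := by exact_mod_cast hk1.2
        rw [ub, ub, if_pos (by omega), if_neg (by omega), sub_zero, eu, norm_real,
          norm_of_nonneg (by positivity)]
        have h5 : (((k : ℝ) + 1) / n) ^ 2 ≤ 2 ^ 2 := by
          gcongr; rw [div_le_iff₀ hn0]; linarith
        gcongr
        · linarith
        · linarith
      refine (add_le_add A1 A2).trans ?_
      simp only [sum_const, card_range, nsmul_eq_mul, Nat.card_Ico]
      rw [Nat.cast_sub h]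
      have : 0 ≤ ((n' : ℝ) - n) / n := div_nonneg (by linarith) hn0.le
      have e1 : (n : ℝ) * (((n' : ℝ) - n) / n / n) = ((n' : ℝ) - n) / n := by field_simp
      have e2 : ((n' : ℝ) - n) * (5 * (1 / (2 * n))) = 5 / 2 * (((n' : ℝ) - n) / n) := by field_simp
      rw [e1, e2]; linarith
    · intro k hk; rw [ub, ub, if_neg (by omega), if_neg (by omega)]; simp

theorem ub_nonneg (m k : ℕ) : ∃ b : ℝ, 0 ≤ b ∧ ub m k = b := by
  unfold ub; split_ifs
  · exact ⟨1 / (2 * m + 1), by positivity, by push_cast; rfl⟩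
  · exact ⟨0, le_rfl, by simp⟩

theorem PK_contr {R d : ℕ} {p : ℝ} (hp : 1 ≤ p) {a : ℕ → ℂ} (h0 : ∀ k, ((‖a k‖ : ℝ) : ℂ) = a k) (h1 : CS R a 0 = 1)
    (f : (Fin d → ZMod (2 * R + 1)) → ℂ) : NN p (cv (PK R d a) f) ≤ NN p f := by
  refine (NN_cv_le hp _ _).trans ?_
  have := sum_norm_PK (d := d) h0 h1
  have := NN_nonneg p f
  nlinarith

theorem ub_lip {R d n n' : ℕ} {p1 r : ℝ} (hp1 : 1 < p1) (hr1 : p1 ≤ r) (hr2 : r ≤ 2)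
    (hn : 1 ≤ n) (h : n ≤ n') (h2 : n' ≤ 2 * n) (hR : n' ≤ R) (f : (Fin d → ZMod (2 * R + 1)) → ℂ) :
    NN r (fun x => cv (PK R d (ub n)) f x - cv (PK R d (ub n')) f x) ≤
      (3840 / (1 - 1 / p1) ^ 2) * (((n' : ℝ) - n) / n) * NN r f := by
  have hN := NN_nonneg r f
  have hr : 1 < r := by linarith
  have hnr : ∀ m k, ((‖ub m k‖ : ℝ) : ℂ) = ub m k := by
    intro m k; obtain ⟨b, hb, e⟩ := ub_nonneg m k
    rw [e, norm_real, norm_of_nonneg hb]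
  rcases h.eq_or_lt with rfl | hlt
  · have : NN r (fun x => cv (PK R d (ub n)) f x - cv (PK R d (ub n)) f x) = 0 := by
      simp only [sub_self]; exact NN_zero (by linarith)
    rw [this]; simp
  have hn0 : (0 : ℝ) < n := by exact_mod_cast hn
  have hnn : (n : ℝ) < n' := by exact_mod_cast hlt
  have hnn2 : (n' : ℝ) ≤ 2 * n := by exact_mod_cast h2
  set δ := ((n' : ℝ) - n) / n with hδ
  have hδ0 : 0 < δ := div_pos (by linarith) hn0
  set κ := (1 - 1 / p1) / 2 with hκ
  have hp0 : 0 < p1 := by linarith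
  have hκ0 : 0 < κ := by
    have : 1 / p1 < 1 := by rw [div_lt_one hp0]; exact hp1
    rw [hκ]; linarith
  have hκr : κ ≤ (1 - 1 / r) / 2 := by
    have := one_div_le_one_div_of_le hp0 hr1
    rw [hκ]; linarith
  have g1 := good_ub (R := R) (m := n) (by omega) hn
  have g2 := good_ub (R := R) (m := n') hR (by omega)
  let a : ℂ → ℕ → ℂ := fun z k => (1 - z) * ub n k + z * ub n' k
  have hCS : ∀ z φ, CS R (a z) φ = (1 - z) * CS R (ub n) φ + z * CS R (ub n') φ := by
    intro z φ
    rw [← CS_smul, ← CS_smul, ← CS_add]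
  set ρ := sqrt (1 / (240 * δ)) with hρ
  have hρ0 : 0 < ρ := Real.sqrt_pos.2 (by positivity)
  have hρ2 : ρ ^ 2 = 1 / (240 * δ) := sq_sqrt (by positivity)
  have hcon : ∀ z : ℂ, ‖z‖ ≤ κ ^ 2 * ρ ^ 2 → ∀ f, NN r (cv (PK R d (a z)) f) ≤ NN r f := by
    intro z hz f
    obtain ⟨w, hw⟩ := IsAlgClosed.exists_pow_nat_eq z (n := 2) (by norm_num)
    have := contrp (R := R) (d := d) hr hr2 (a := fun w => a (w ^ 2)) hρ0 ?_ ?_ ?_ w ?_ f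
    · simpa only [hw] using this
    · intro k; apply Differentiable.differentiableOn; fun_prop
    · intro w hw φ hφ
      have hw' : ‖w‖ < ρ := by simpa using hw
      rw [hCS, show (1 - w ^ 2) * CS R (ub n) φ + w ^ 2 * CS R (ub n') φ =
        CS R (ub n) φ + w ^ 2 * (CS R (ub n') φ - CS R (ub n) φ) by ring]
      refine (norm_add_le _ _).trans ?_
      rw [norm_mul, norm_pow]
      have b1 := norm_CS_ub (R := R) (m := n) (by omega) hn hφ
      have b2 := ub_diff hn h h2 hR φ
      have b3 : ‖w‖ ^ 2 ≤ 1 / (240 * δ) := by rw [← hρ2]; gcongr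
      have b4 : ‖w‖ ^ 2 * ‖CS R (ub n') φ - CS R (ub n) φ‖ ≤
        1 / (240 * δ) * (16 * δ * min 1 ((n : ℝ) ^ 2 * sg φ)) := by gcongr
      have b5 : 1 / (240 * δ) * (16 * δ * min 1 ((n : ℝ) ^ 2 * sg φ)) = 1 / 15 * min 1 ((n : ℝ) ^ 2 * sg φ) := by
        field_simp; ring
      linarith
    · intro s hs
      refine ⟨fun k => ?_, by rw [hCS, g1.1, g2.1]; ring⟩
      have hs2 : s ^ 2 ≤ 1 / (240 * δ) := by rw [← hρ2, ← sq_abs s]; gcongr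
      have hs3 : s ^ 2 * δ ≤ 1 := by
        rw [le_div_iff₀ (by positivity)] at hs2
        nlinarith [sq_nonneg s]
      suffices hh : ∃ b : ℝ, 0 ≤ b ∧ a ((s : ℂ) ^ 2) k = b by
        obtain ⟨b, hb, e⟩ := hh
        rw [e, norm_real, norm_of_nonneg hb]
      by_cases hk : k ≤ n
      · refine ⟨(1 - s ^ 2) * (1 / (2 * n + 1)) + s ^ 2 * (1 / (2 * n' + 1)), ?_, ?_⟩
        · have e : (1 - s ^ 2) * (1 / (2 * (n : ℝ) + 1)) + s ^ 2 * (1 / (2 * n' + 1)) =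
            ((2 * n' + 1) - 2 * (s ^ 2 * δ) * n) / ((2 * n + 1) * (2 * n' + 1)) := by
            rw [hδ]; field_simp; ring
          rw [e]
          refine div_nonneg ?_ (by positivity)
          nlinarith
        · simp only [a, ub]; rw [if_pos hk, if_pos (by omega)]; push_cast; rfl
      · obtain ⟨b, hb, e⟩ := ub_nonneg n' k
        refine ⟨s ^ 2 * b, by positivity, ?_⟩
        simp only [a]; rw [e, ub, if_neg hk]; push_cast; ring
    · have : ‖w‖ ^ 2 ≤ (κ * ρ) ^ 2 := by rw [← norm_pow, hw, mul_pow]; exact hz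
      have := abs_le_of_sq_le_sq' this (by positivity) |>.2
      refine this.trans (by gcongr)
  have e0 : a 0 = ub n := by funext k; simp [a]
  have e1 : a 1 = ub n' := by funext k; simp [a]
  have fin : NN r (fun x => cv (PK R d (ub n)) f x - cv (PK R d (ub n')) f x) ≤ 4 / (κ ^ 2 * ρ ^ 2) * NN r f := by
    have e : NN r (fun x => cv (PK R d (ub n)) f x - cv (PK R d (ub n')) f x) =
          NN r (fun x => cv (PK R d (ub n')) f x - cv (PK R d (ub n)) f x) :=
        NN_congr fun x => norm_sub_rev _ _
    rcases lt_or_ge 1 (κ ^ 2 * ρ ^ 2) with h1 | h1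
    · have := lip_lemma (p := r) hr (fun z => PK R d (a z)) (ρ := κ ^ 2 * ρ ^ 2) (by positivity)
        (PK_diff fun k => (by apply Differentiable.differentiableOn; fun_prop))
        (fun w hw f => hcon w (by simpa using (by simpa using hw : ‖w‖ < κ ^ 2 * ρ ^ 2).le) f) (w := 1) (w' := 0)
        (by simpa using h1) (by simpa using by positivity) f
      rw [e]
      simpa [e0, e1] using this
    · have h3 := (NN_sub_le hr.le (cv (PK R d (ub n)) f) (cv (PK R d (ub n')) f)).trans
        (add_le_add (PK_contr hr.le (hnr n) g1.1 f) (PK_contr hr.le (hnr n') g2.1 f))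
      have : 2 ≤ 4 / (κ ^ 2 * ρ ^ 2) := by
        rw [le_div_iff₀ (by positivity)]; linarith
      nlinarith
  refine fin.trans (le_of_eq ?_)
  rw [hρ2, hκ]
  have : 1 - 1 / p1 ≠ 0 := by intro hh; rw [hκ, hh] at hκ0; simp at hκ0
  field_simp; ring

theorem cube_valid {p : ℝ} (hp : 1 < p) (hp2 : p < 2) : ∃ C, 1 ≤ C ∧ ∀ (R d : ℕ) (T : Type) [Fintype T]
    (m : T → ℕ), (∀ t, 1 ≤ m t) → (∀ t, m t ≤ R) → 1 ≤ R →
    Valid (fun t (x : Fin d → ZMod (2 * R + 1)) => ‖PK R d (ub (m t)) x‖) p C := by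
  set p1 := (1 + p) / 2 with hp1
  have h1 : 1 < p1 := by rw [hp1]; linarith
  have h2 : p1 < p := by rw [hp1]; linarith
  obtain ⟨C, hC, H⟩ := engine (p1 := p1) (p := p) (Λ := 3840 / (1 - 1 / p1) ^ 2)
    (C2 := 16 * 4 + 4 + 1 / (4 * (1 / 15))) (Ca := 1) h1 h2 hp2 (by positivity) (by norm_num) zero_le_one
  refine ⟨C, hC, ?_⟩
  intro R d T _ m hm hmR hR
  have hnr : ∀ m k, ((‖ub m k‖ : ℝ) : ℂ) = ub m k := by
    intro m k; obtain ⟨b, hb, e⟩ := ub_nonneg m k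
    rw [e, norm_real, norm_of_nonneg hb]
  obtain ⟨oct, L, pos, hF⟩ := mkFam (R := R) (d := d) hR (T := T) (ι := Unit) (p1 := p1) (Ca := 1)
    (Λ := 3840 / (1 - 1 / p1) ^ 2) (c := 1 / 15) (C := 4) (by linarith) (by norm_num) (by norm_num) (by positivity)
    (A := fun t x => ‖PK R d (ub (m t)) x‖) (n := fun t => m t) (fun t => by exact_mod_cast hm t)
    (w := fun _ _ => 1) (W := fun _ => 1) (a := fun t _ => ub (m t)) (fun t x => norm_nonneg _)
    (fun t x => by
      simp only [Finset.univ_unique, one_mul, sum_const, Finset.card_singleton, one_smul]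
      unfold PK rad
      rw [norm_prod]; push_cast; simp only [hnr])
    (by simp) (by simp) (by simp) (fun t _ => good_ub (hmR t) (hm t))
    (fun t _ f => PK_contr h1.le (hnr _) (good_ub (hmR t) (hm t)).1 f)
    (fun r hr1 hr2 t t' _ hle hle2 f => ub_lip h1 hr1 hr2 (hm t) (by exact_mod_cast hle)
      (by exact_mod_cast hle2) (hmR t') f)
  exact H hF

noncomputable def uu (q n : ℝ) (k : ℕ) : ℝ := ((k : ℝ) / n) ^ q
noncomputable def eg (q n : ℝ) (w : ℂ) (k : ℕ) : ℂ := Complex.exp (-(1 + w) * (uu q n k : ℝ))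
noncomputable def Zg (R : ℕ) (q n : ℝ) (w : ℂ) : ℂ := CS R (eg q n w) 0
noncomputable def Zr (R : ℕ) (q n : ℝ) : ℝ := 1 + ∑ k ∈ range R, 2 * exp (-uu q n (k + 1))
noncomputable def ag (R : ℕ) (q n : ℝ) (w : ℂ) (k : ℕ) : ℂ := (Zg R q n w)⁻¹ * eg q n w k
noncomputable def B0 : ℝ := 800000
noncomputable def ρ0 : ℝ := 1 / (200000 * B0 ^ 3)

theorem norm_exp_sub_exp_le {z : ℂ} (hz : 0 < z.re) {a b : ℝ} (hab : a ≤ b) :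
    ‖Complex.exp (-z * a) - Complex.exp (-z * b)‖ ≤
      ‖z‖ / z.re * (exp (-z.re * a) - exp (-z.re * b)) := by
  have h := image_norm_le_of_norm_deriv_right_le_deriv_boundary (a := a) (b := b)
    (f := fun x : ℝ => Complex.exp (-z * a) - Complex.exp (-z * x))
    (f' := fun x : ℝ => -(Complex.exp (-z * x) * (-z)))
    (B := fun x => ‖z‖ / z.re * (exp (-z.re * a) - exp (-z.re * x)))
    (B' := fun x => ‖z‖ / z.re * (-(exp (-z.re * x) * (-z.re)))) ?_ ?_ ?_ ?_ ?_ (Set.right_mem_Icc.2 hab)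
  · exact h
  · apply Continuous.continuousOn; fun_prop
  · intro x _
    have h1 : HasDerivAt (fun y : ℂ => Complex.exp (-z * y)) (Complex.exp (-z * x) * (-z)) (x : ℂ) := by
      have := ((hasDerivAt_id (x : ℂ)).const_mul (-z)).cexp
      simpa using this
    exact (h1.comp_ofReal.const_sub _).hasDerivWithinAt
  · simp
  · intro x
    have h1 : HasDerivAt (fun y : ℝ => exp (-z.re * y)) (exp (-z.re * x) * (-z.re)) x := by
      have := ((hasDerivAt_id x).const_mul (-z.re)).exp
      simpa using this
    exact (h1.const_sub _).const_mul _
  · intro x _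
    rw [norm_neg, norm_mul, norm_exp, norm_neg]
    have : (-z * (x : ℂ)).re = -z.re * x := by simp
    rw [this]
    field_simp; exact le_rfl

section expo
variable {R : ℕ} {q n : ℝ}

theorem uu_nonneg (hn : 1 ≤ n) (k : ℕ) : 0 ≤ uu q n k := by unfold uu; positivity

theorem uu_mono (hq : 1 ≤ q) (hn : 1 ≤ n) {k l : ℕ} (h : k ≤ l) : uu q n k ≤ uu q n l := by
  unfold uu; gcongr

theorem uu_zero (hq : 1 ≤ q) : uu q n 0 = 0 := by
  unfold uu; simp; rw [zero_rpow (by linarith)]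

theorem one_add_sq_le (hq : 1 ≤ q) (hn : 1 ≤ n) (k : ℕ) : 1 + ((k : ℝ) / n) ^ 2 ≤ 2 * (1 + uu q n k) ^ 2 := by
  have h0 := uu_nonneg (q := q) hn k
  have hs : 0 ≤ (k : ℝ) / n := by positivity
  have h1 : (k : ℝ) / n ≤ 1 + uu q n k := by
    rcases le_total ((k : ℝ) / n) 1 with h | h
    · linarith
    · have : ((k : ℝ) / n) ^ (1 : ℝ) ≤ ((k : ℝ) / n) ^ q := rpow_le_rpow_of_exponent_le h hq
      rw [rpow_one] at this; unfold uu; linarith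
  nlinarith

theorem pow5_le {u : ℝ} (hu : 0 ≤ u) : (1 + u) ^ 5 ≤ 100000 * exp (u / 2) := by
  have h1 : 1 + u ≤ 10 * exp (u / 10) := by linarith [add_one_le_exp (u / 10)]
  calc (1 + u) ^ 5 ≤ (10 * exp (u / 10)) ^ 5 := by gcongr
    _ = 100000 * exp (u / 2) := by
      rw [mul_pow, ← exp_nat_mul]; norm_num; ring_nf

theorem sum_inv (hn : 1 ≤ n) : ∑ k ∈ range R, (1 + ((k + 1 : ℕ) / n : ℝ) ^ 2)⁻¹ ≤ 2 * n := by
  have hn0 : 0 < n := by linarith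
  have h : ∀ R : ℕ, ∑ k ∈ range R, (1 + ((k + 1 : ℕ) / n : ℝ) ^ 2)⁻¹ ≤ 2 * n - 2 * n ^ 2 / (n + R) := by
    intro R
    induction R with
    | zero =>
      simp
      rw [show 2 * n ^ 2 / n = 2 * n by field_simp]
    | succ k ih =>
      rw [sum_range_succ]
      have hk : (0 : ℝ) ≤ k := by positivity
      have : (1 + ((k + 1 : ℕ) / n : ℝ) ^ 2)⁻¹ ≤ 2 * n ^ 2 / (n + k) - 2 * n ^ 2 / (n + (k + 1 : ℕ)) := by
        push_cast
        have e1 : (1 + (((k : ℝ) + 1) / n) ^ 2)⁻¹ = n ^ 2 / (n ^ 2 + (k + 1) ^ 2) := by field_simp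
        have e2 : 2 * n ^ 2 / (n + k) - 2 * n ^ 2 / (n + (k + 1)) = 2 * n ^ 2 / ((n + k) * (n + (k + 1))) := by
          field_simp; ring
        rw [e1, e2, div_le_div_iff₀ (by positivity) (by positivity)]
        nlinarith [sq_nonneg (n - (k + 1)), mul_pos hn0 hn0]
      linarith
  refine (h R).trans ?_
  have : 0 ≤ 2 * n ^ 2 / (n + R) := by positivity
  linarith

theorem moment (hq : 1 ≤ q) (hn : 1 ≤ n) :
    ∑ k ∈ range R, (1 + (((k : ℝ) + 1) / n) ^ 2) * ((1 + uu q n (k + 1)) * exp (-uu q n (k + 1) / 2)) ≤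
      B0 * n := by
  have h : ∀ k ∈ range R, (1 + (((k : ℝ) + 1) / n) ^ 2) * ((1 + uu q n (k + 1)) * exp (-uu q n (k + 1) / 2)) ≤
      400000 * (1 + ((k + 1 : ℕ) / n : ℝ) ^ 2)⁻¹ := by
    intro k _
    have h1 := one_add_sq_le hq hn (k + 1)
    push_cast at h1 ⊢
    have hu := uu_nonneg (q := q) hn (k + 1)
    set u := uu q n (k + 1)
    set s := 1 + (((k : ℝ) + 1) / n) ^ 2
    have hs : 0 < s := by positivity
    rw [le_mul_inv_iff₀ hs, neg_div, exp_neg]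
    have hE := pow5_le hu
    have h3 : s * s ≤ (2 * (1 + u) ^ 2) * (2 * (1 + u) ^ 2) := by gcongr
    have he := exp_pos (u / 2)
    calc s * ((1 + u) * (exp (u / 2))⁻¹) * s = s * s * (1 + u) / exp (u / 2) := by
          field_simp
      _ ≤ (2 * (1 + u) ^ 2) * (2 * (1 + u) ^ 2) * (1 + u) / exp (u / 2) := by gcongr
      _ ≤ 400000 := by rw [div_le_iff₀ he]; nlinarith
  refine (sum_le_sum h).trans ?_
  rw [← mul_sum]
  have := sum_inv (R := R) hn
  unfold B0; linarith

theorem norm_eg (w : ℂ) (k : ℕ) : ‖eg q n w k‖ = exp (-(1 + w.re) * uu q n k) := by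
  unfold eg
  rw [norm_exp]; simp

theorem norm_eg_le (hn : 1 ≤ n) {w : ℂ} (hw : ‖w‖ ≤ 1 / 2) (k : ℕ) :
    ‖eg q n w k‖ ≤ exp (-uu q n k / 2) := by
  rw [norm_eg, exp_le_exp]
  have := (abs_le.1 (abs_re_le_norm w)).1
  have := uu_nonneg (q := q) hn k
  nlinarith

theorem eg_sub (hn : 1 ≤ n) {w : ℂ} (hw : ‖w‖ ≤ 1 / 2) (k : ℕ) :
    ‖eg q n w k - eg q n 0 k‖ ≤ ‖w‖ * (uu q n k * exp (-uu q n k / 2)) := by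
  have hu := uu_nonneg (q := q) hn k
  set u := uu q n k with hu'
  have e : eg q n w k - eg q n 0 k = Complex.exp (-(u : ℂ)) * (Complex.exp (-(w * u)) - 1) := by
    unfold eg
    rw [mul_sub, ← Complex.exp_add, ← hu']
    congr 2 <;> ring_nf
  have h1 := Complex.norm_exp_sub_sum_le_norm_mul_exp (-(w * u)) 1
  simp only [Finset.range_one, Finset.sum_singleton, pow_zero, Nat.factorial_zero, Nat.cast_one, div_one, pow_one] at h1
  rw [norm_neg, norm_mul, norm_real, norm_of_nonneg hu] at h1
  rw [e, norm_mul, norm_exp]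
  have e2 : (-(u : ℂ)).re = -u := by simp
  rw [e2]
  have h2 : exp (‖w‖ * u) ≤ exp (u / 2) := by rw [exp_le_exp]; nlinarith
  calc _ ≤ exp (-u) * (‖w‖ * u * exp (u / 2)) := by
        gcongr
        exact h1.trans (by gcongr)
    _ = ‖w‖ * (u * (exp (-u) * exp (u / 2))) := by ring
    _ = _ := by rw [← exp_add]; ring_nf

theorem Zg_zero (hq : 1 ≤ q) : Zg R q n 0 = (Zr R q n : ℂ) := by
  unfold Zg Zr
  rw [CS_zero]
  push_cast
  simp [eg, uu_zero hq]

theorem moment' (hq : 1 ≤ q) (hn : 1 ≤ n) (f : ℕ → ℝ)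
    (hf : ∀ k, f k ≤ (1 + uu q n k) * exp (-uu q n k / 2)) :
    ∑ k ∈ range R, (1 + (((k : ℝ) + 1) / n) ^ 2) * f (k + 1) ≤ B0 * n := by
  refine le_trans (sum_le_sum fun k _ => ?_) (moment hq hn)
  exact mul_le_mul_of_nonneg_left (hf _) (by positivity)

theorem msum_le (f : ℕ → ℝ) (hf : ∀ k, 0 ≤ f k) :
    ∑ k ∈ range R, f (k + 1) ≤ ∑ k ∈ range R, (1 + (((k : ℝ) + 1) / n) ^ 2) * f (k + 1) :=
  sum_le_sum fun k _ => by nlinarith [hf (k + 1), sq_nonneg (((k : ℝ) + 1) / n)]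

theorem exp_le_mom (hn : 1 ≤ n) (k : ℕ) : exp (-uu q n k / 2) ≤ (1 + uu q n k) * exp (-uu q n k / 2) := by
  have := uu_nonneg (q := q) hn k
  nlinarith [exp_pos (-uu q n k / 2)]

theorem Zr_le (hq : 1 ≤ q) (hn : 1 ≤ n) : Zr R q n ≤ 3 * B0 * n := by
  have h1 := moment' (R := R) hq hn (fun k => exp (-uu q n k)) fun k =>
    le_trans (Real.exp_le_exp.2 (by linarith [uu_nonneg (q := q) hn k])) (exp_le_mom hn k)
  have h2 := msum_le (R := R) (n := n) (fun k => exp (-uu q n k)) fun k => (exp_pos _).le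
  unfold Zr
  rw [← mul_sum]
  have : 1 ≤ B0 * n := by unfold B0; linarith
  linarith

theorem uu_le_one (hq : 1 ≤ q) (hn : 1 ≤ n) {k : ℕ} (hk : k ≤ ⌊n⌋₊) : uu q n k ≤ 1 := by
  have : (k : ℝ) ≤ n := (Nat.le_floor_iff (by linarith)).1 hk
  exact rpow_le_one (by positivity) ((div_le_one (by linarith)).2 this) (by linarith)

theorem exp_neg_one_ge : (1 / 3 : ℝ) ≤ exp (-1) := by
  rw [exp_neg, ← one_div]
  exact one_div_le_one_div_of_le (exp_pos 1) (by linarith [exp_one_lt_d9])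

theorem Zr_ge' (hq : 1 ≤ q) (hn : 1 ≤ n) (hR : 2 * n ≤ R) : (2 * (⌊n⌋₊ : ℝ) + 1) * exp (-1) ≤ Zr R q n := by
  have hf : ⌊n⌋₊ ≤ R := by
    have := Nat.floor_le (show 0 ≤ n by linarith)
    have : (⌊n⌋₊ : ℝ) ≤ R := by linarith
    exact_mod_cast this
  have h1 : ∑ k ∈ range ⌊n⌋₊, 2 * exp (-1) ≤ ∑ k ∈ range R, 2 * exp (-uu q n (k + 1)) := by
    refine le_trans (sum_le_sum fun k hk => ?_)
      (sum_le_sum_of_subset_of_nonneg (range_mono hf) fun k _ _ => by positivity)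
    have := uu_le_one hq hn (show k + 1 ≤ ⌊n⌋₊ from Finset.mem_range.1 hk)
    gcongr
  rw [sum_const, card_range, nsmul_eq_mul] at h1
  have := Real.exp_le_one_iff.2 (show (-1 : ℝ) ≤ 0 by norm_num)
  unfold Zr; linarith

theorem Zr_ge (hq : 1 ≤ q) (hn : 1 ≤ n) (hR : 2 * n ≤ R) : n / 3 ≤ Zr R q n := by
  have := Zr_ge' hq hn hR
  have h2 := Nat.lt_floor_add_one n
  have h3 := exp_neg_one_ge
  nlinarith [Nat.cast_nonneg (α := ℝ) ⌊n⌋₊]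

theorem Zg_sub (hq : 1 ≤ q) (hn : 1 ≤ n) {w : ℂ} (hw : ‖w‖ ≤ 1 / 2) :
    ‖Zg R q n 0 - Zg R q n w‖ ≤ 2 * ‖w‖ * B0 * n := by
  have h0 := norm_nonneg w
  rw [norm_sub_rev]
  unfold Zg
  rw [← CS_sub, CS_zero]
  have e : eg q n w 0 - eg q n 0 0 = 0 := by simp [eg, uu_zero hq]
  rw [e, zero_add]
  have h1 := moment' (R := R) hq hn (fun k => uu q n k * exp (-uu q n k / 2)) fun k => by
    nlinarith [exp_pos (-uu q n k / 2)]
  have h2 := msum_le (R := R) (n := n) (fun k => uu q n k * exp (-uu q n k / 2)) fun k =>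
    mul_nonneg (uu_nonneg hn k) (exp_pos _).le
  calc _ ≤ ∑ k ∈ range R, 2 * ‖w‖ * (uu q n (k + 1) * exp (-uu q n (k + 1) / 2)) := by
        refine (norm_sum_le _ _).trans (sum_le_sum fun k _ => ?_)
        rw [norm_mul, Complex.norm_two]
        have := eg_sub (q := q) hn hw (k + 1)
        linarith
    _ ≤ _ := by
      rw [← mul_sum]
      have := mul_le_mul_of_nonneg_left (h2.trans h1) h0
      nlinarith

theorem ρ0_pos : 0 < ρ0 := by unfold ρ0 B0; norm_num

theorem Zg_ge (hq : 1 ≤ q) (hn : 1 ≤ n) (hR : 2 * n ≤ R) {w : ℂ} (hw : ‖w‖ ≤ ρ0) : n / 6 ≤ ‖Zg R q n w‖ := by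
  have hw2 : ‖w‖ ≤ 1 / 2 := hw.trans (by unfold ρ0 B0; norm_num)
  have h1 := Zg_sub (R := R) hq hn hw2
  have h2 : ‖Zg R q n 0‖ = Zr R q n := by
    rw [Zg_zero hq, norm_real, norm_of_nonneg]
    linarith [Zr_ge hq hn hR]
  have h3 := norm_sub_norm_le (Zg R q n 0) (Zg R q n w)
  have h4 := Zr_ge hq hn hR
  have h5 : 2 * ‖w‖ * B0 * n ≤ n / 6 := by
    have : 2 * ‖w‖ * B0 ≤ 1 / 6 := by
      unfold ρ0 at hw; unfold B0 at *; norm_num at hw ⊢; linarith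
    nlinarith
  linarith

theorem Zg_ne (hq : 1 ≤ q) (hn : 1 ≤ n) (hR : 2 * n ≤ R) {w : ℂ} (hw : ‖w‖ ≤ ρ0) : Zg R q n w ≠ 0 := by
  have := Zg_ge hq hn hR hw
  intro h; rw [h] at this; simp at this; linarith

theorem CS_ag (φ : ℝ) (w : ℂ) : CS R (ag R q n w) φ = (Zg R q n w)⁻¹ * CS R (eg q n w) φ := CS_smul _ _ _ _

theorem ag_mass (hq : 1 ≤ q) (hn : 1 ≤ n) (hR : 2 * n ≤ R) {w : ℂ} (hw : ‖w‖ ≤ ρ0) : CS R (ag R q n w) 0 = 1 := by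
  rw [CS_ag]; exact inv_mul_cancel₀ (Zg_ne hq hn hR hw)

end expo

theorem norm_CS_le {R : ℕ} {b : ℕ → ℂ} (h : ∀ k, k ≤ R → ∃ r : ℝ, 0 ≤ r ∧ b k = r) (φ : ℝ) :
    ‖CS R b φ‖ ≤ (CS R b 0).re := by
  choose! r h0 h1 using h
  rw [CS_zero, CS]
  refine (norm_add_le _ _).trans ?_
  rw [add_re, h1 0 (by omega), Complex.re_sum]
  refine add_le_add (by rw [norm_real, norm_of_nonneg (h0 0 (by omega))]; simp) ?_
  refine (norm_sum_le _ _).trans (sum_le_sum fun k hk => ?_)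
  have hk' : k + 1 ≤ R := Finset.mem_range.1 hk
  rw [h1 _ hk', norm_mul, norm_mul, norm_real, norm_real, Complex.norm_two,
    norm_of_nonneg (h0 _ hk'), norm_eq_abs]
  have := abs_cos_le_one ((k + 1) * φ)
  have := h0 _ hk'
  simp; nlinarith

section expo
variable {R : ℕ} {q n : ℝ}

theorem ag_sub (hq : 1 ≤ q) (hn : 1 ≤ n) (hR : 2 * n ≤ R) {w : ℂ} (hw : ‖w‖ ≤ ρ0) :
    ∑ k ∈ range R, (1 + (((k : ℝ) + 1) / n) ^ 2) * ‖ag R q n w (k + 1) - ag R q n 0 (k + 1)‖ ≤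
      37 * B0 ^ 2 * ‖w‖ := by
  have hn0 : 0 < n := by linarith
  have hw0 := norm_nonneg w
  have hw2 : ‖w‖ ≤ 1 / 2 := hw.trans (by unfold ρ0 B0; norm_num)
  have hZ := Zg_ge hq hn hR hw
  have hZne := Zg_ne hq hn hR hw
  have h00 : ‖(0 : ℂ)‖ ≤ ρ0 := by simpa using ρ0_pos.le
  have hZ0 : n / 3 ≤ ‖Zg R q n 0‖ := by
    rw [Zg_zero hq, norm_real]
    exact (Zr_ge hq hn hR).trans (le_abs_self _)
  have hZne0 := Zg_ne hq hn hR h00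
  have hZs := Zg_sub (R := R) hq hn hw2
  have hB : 0 < B0 := by unfold B0; norm_num
  have key : ∀ k, ‖ag R q n w k - ag R q n 0 k‖ ≤
      (‖w‖ * (6 / n)) * (uu q n k * exp (-uu q n k / 2)) +
        (36 * ‖w‖ * B0 / n) * exp (-uu q n k / 2) := by
    intro k
    have e : ag R q n w k - ag R q n 0 k = (Zg R q n w)⁻¹ * (eg q n w k - eg q n 0 k) +
        (Zg R q n w)⁻¹ * (Zg R q n 0)⁻¹ * (Zg R q n 0 - Zg R q n w) * eg q n 0 k := by
      unfold ag; field_simp; ring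
    have i1 : ‖(Zg R q n w)⁻¹‖ ≤ 6 / n := by
      rw [norm_inv, ← one_div, div_le_div_iff₀ (by linarith) hn0]; linarith
    have i2 : ‖(Zg R q n 0)⁻¹‖ ≤ 3 / n := by
      rw [norm_inv, ← one_div, div_le_div_iff₀ (by linarith) hn0]; linarith
    have hu := uu_nonneg (q := q) hn k
    rw [e]
    refine (norm_add_le _ _).trans (add_le_add ?_ ?_)
    · rw [norm_mul]
      calc _ ≤ 6 / n * (‖w‖ * (uu q n k * exp (-uu q n k / 2))) := by
            gcongr; exact eg_sub hn hw2 k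
        _ = _ := by ring
    · rw [norm_mul, norm_mul, norm_mul]
      calc _ ≤ 6 / n * (3 / n) * (2 * ‖w‖ * B0 * n) * exp (-uu q n k / 2) := by
            gcongr; exact norm_eg_le hn (by simp) k
        _ = _ := by field_simp; ring
  have hu := fun k => uu_nonneg (q := q) hn k
  have m1 := moment' (R := R) hq hn (fun k => uu q n k * exp (-uu q n k / 2)) fun k => by
    nlinarith [exp_pos (-uu q n k / 2)]
  have m2 := moment' (R := R) hq hn (fun k => exp (-uu q n k / 2)) fun k => exp_le_mom hn k
  calc _ ≤ ∑ k ∈ range R, ((‖w‖ * (6 / n)) * ((1 + (((k : ℝ) + 1) / n) ^ 2) *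
        (uu q n (k + 1) * exp (-uu q n (k + 1) / 2))) +
        (36 * ‖w‖ * B0 / n) * ((1 + (((k : ℝ) + 1) / n) ^ 2) * exp (-uu q n (k + 1) / 2))) := by
        refine sum_le_sum fun k _ => ?_
        refine (mul_le_mul_of_nonneg_left (key (k + 1)) (by positivity)).trans (le_of_eq (by ring))
    _ ≤ (‖w‖ * (6 / n)) * (B0 * n) + (36 * ‖w‖ * B0 / n) * (B0 * n) := by
        rw [sum_add_distrib, ← mul_sum, ← mul_sum]
        gcongr
    _ = ‖w‖ * (6 * B0 + 36 * B0 ^ 2) := by field_simp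
    _ ≤ _ := by
        have : 6 * B0 ≤ B0 ^ 2 := by unfold B0; norm_num
        nlinarith

theorem eg_real (s : ℝ) (k : ℕ) : eg q n s k = (exp (-(1 + s) * uu q n k) : ℝ) := by
  unfold eg; push_cast; rfl

theorem Zg_real (hq : 1 ≤ q) (s : ℝ) : ∃ z : ℝ, 0 < z ∧ Zg R q n s = z := by
  refine ⟨1 + ∑ k ∈ range R, 2 * exp (-(1 + s) * uu q n (k + 1)), by positivity, ?_⟩
  unfold Zg
  rw [CS_zero]
  simp only [eg_real]
  push_cast
  simp [uu_zero hq]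

theorem ag_real (hq : 1 ≤ q) (s : ℝ) (k : ℕ) : ((‖ag R q n s k‖ : ℝ) : ℂ) = ag R q n s k := by
  obtain ⟨z, hz, e⟩ := Zg_real (R := R) (n := n) hq s
  unfold ag
  rw [e, eg_real, ← Complex.ofReal_inv, ← Complex.ofReal_mul, norm_real,
    norm_of_nonneg (by positivity)]

theorem ag_zero_bound (hq : 1 ≤ q) (hn : 1 ≤ n) (hR : 2 * n ≤ R) {φ : ℝ} (hφ : |φ| ≤ π) :
    ‖CS R (ag R q n 0) φ‖ ≤ 1 - 1 / (540 * B0) * min 1 (n ^ 2 * sg φ) := by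
  have hn0 : 0 < n := by linarith
  have hB : 0 < B0 := by unfold B0; norm_num
  have h00 : ‖(0 : ℂ)‖ ≤ ρ0 := by simpa using ρ0_pos.le
  set m := ⌊n⌋₊ with hm
  have hm1 : 1 ≤ m := Nat.le_floor (by simpa using hn)
  have hmn : (m : ℝ) ≤ n := Nat.floor_le hn0.le
  have hm2 := Nat.lt_floor_add_one n
  rw [← hm] at hm2
  have hm1' : (1 : ℝ) ≤ m := by exact_mod_cast hm1
  have hmR : m ≤ R := by
    have : (m : ℝ) ≤ R := by linarith
    exact_mod_cast this
  have hZ := Zr_ge hq hn hR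
  have hZ' := Zr_ge' hq hn hR
  rw [← hm] at hZ'
  have hZ0 : 0 < Zr R q n := by linarith
  set c1 := (2 * (m : ℝ) + 1) * exp (-1) / Zr R q n with hc1
  have hc1' : 1 / (9 * B0) ≤ c1 := by
    rw [hc1, div_le_div_iff₀ (by positivity) hZ0]
    have h1 := Zr_le (R := R) hq hn
    have := exp_neg_one_ge
    have : n / 3 ≤ (2 * (m : ℝ) + 1) * exp (-1) := by nlinarith
    nlinarith
  have hc1p : 0 < c1 := by positivity
  have hmin : min 1 (n ^ 2 * sg φ) ≤ 4 * min 1 ((m : ℝ) ^ 2 * sg φ) := by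
    have hs := sg_nonneg φ
    have : n ^ 2 ≤ 4 * (m : ℝ) ^ 2 := by nlinarith
    have : n ^ 2 * sg φ ≤ 4 * (m : ℝ) ^ 2 * sg φ := by gcongr
    rcases min_cases 1 ((m : ℝ) ^ 2 * sg φ) with h | h <;> rw [h.1]
    · linarith [min_le_left 1 (n ^ 2 * sg φ)]
    · linarith [min_le_right 1 (n ^ 2 * sg φ)]
  have hb := norm_CS_le (R := R) (b := fun k => ag R q n 0 k - (c1 : ℂ) * ub m k) ?_ φ
  · rw [CS_sub, CS_sub, CS_smul, CS_smul, ag_mass hq hn hR h00, (good_ub hmR hm1).1] at hb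
    have e : (1 - (c1 : ℂ) * 1).re = 1 - c1 := by simp
    rw [e] at hb
    have h3 := norm_CS_ub hmR hm1 hφ
    have h4 : ‖CS R (ag R q n 0) φ‖ ≤ ‖CS R (ag R q n 0) φ - c1 * CS R (ub m) φ‖ + ‖c1 * CS R (ub m) φ‖ := by
      have := norm_add_le (CS R (ag R q n 0) φ - c1 * CS R (ub m) φ) (c1 * CS R (ub m) φ)
      rwa [sub_add_cancel] at this
    rw [norm_mul, norm_real, norm_of_nonneg hc1p.le] at h4
    have h5 := mul_le_mul_of_nonneg_left h3 hc1p.le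
    have hmp : 0 ≤ min 1 (n ^ 2 * sg φ) := le_min zero_le_one (mul_nonneg (sq_nonneg _) (sg_nonneg _))
    have h6 : 1 / (540 * B0) * min 1 (n ^ 2 * sg φ) ≤ c1 * (1 / 15 * min 1 ((m : ℝ) ^ 2 * sg φ)) := by
      calc _ = 1 / (9 * B0) * (1 / 60 * min 1 (n ^ 2 * sg φ)) := by field_simp; ring
        _ ≤ c1 * (1 / 60 * min 1 (n ^ 2 * sg φ)) := by gcongr
        _ ≤ c1 * (1 / 15 * min 1 ((m : ℝ) ^ 2 * sg φ)) := by
          refine mul_le_mul_of_nonneg_left ?_ hc1p.le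
          linarith
    linarith
  · intro k _
    have ea : ag R q n 0 k = ((exp (-uu q n k) / Zr R q n : ℝ) : ℂ) := by
      unfold ag
      rw [Zg_zero hq]
      have := eg_real (q := q) (n := n) 0 k
      simp only [Complex.ofReal_zero, add_zero, neg_mul, one_mul] at this
      rw [this]; push_cast; field_simp
    by_cases hk : k ≤ m
    · refine ⟨(exp (-uu q n k) - exp (-1)) / Zr R q n, ?_, ?_⟩
      · have := uu_le_one hq hn hk
        exact div_nonneg (by linarith [Real.exp_le_exp.2 (show (-1 : ℝ) ≤ -uu q n k by linarith)]) hZ0.le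
      · rw [ea, ub, if_pos hk, hc1, sub_div]
        push_cast
        have : (2 * (m : ℂ) + 1) ≠ 0 := by norm_cast
        field_simp
    · refine ⟨exp (-uu q n k) / Zr R q n, by positivity, ?_⟩
      rw [ea, ub, if_neg hk]; simp

theorem ag_bound (hq : 1 ≤ q) (hn : 1 ≤ n) (hR : 2 * n ≤ R) {w : ℂ} (hw : ‖w‖ ≤ ρ0) {φ : ℝ} (hφ : |φ| ≤ π) :
    ‖CS R (ag R q n w) φ‖ ≤ 1 - 1 / (1080 * B0) * min 1 (n ^ 2 * sg φ) := by
  have hn0 : 0 < n := by linarith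
  have h00 : ‖(0 : ℂ)‖ ≤ ρ0 := by simpa using ρ0_pos.le
  have hB : 0 < B0 := by unfold B0; norm_num
  have h1 := ag_zero_bound hq hn hR hφ
  have h2 := CS_near (a := fun k => ag R q n w k - ag R q n 0 k) hn0 (ag_sub hq hn hR hw) φ
  rw [CS_sub, CS_sub, ag_mass hq hn hR hw, ag_mass hq hn hR h00, sub_self, zero_sub, norm_neg] at h2
  have h3 := norm_add_le (CS R (ag R q n w) φ - CS R (ag R q n 0) φ) (CS R (ag R q n 0) φ)
  rw [sub_add_cancel] at h3
  have hmp : 0 ≤ min 1 (n ^ 2 * sg φ) := le_min zero_le_one (mul_nonneg (sq_nonneg _) (sg_nonneg _))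
  have h4 : 4 * (37 * B0 ^ 2 * ‖w‖) ≤ 1 / (1080 * B0) := by
    calc _ ≤ 4 * (37 * B0 ^ 2 * ρ0) := by gcongr
      _ ≤ _ := by unfold ρ0 B0; norm_num
  have h5 := mul_le_mul_of_nonneg_right h4 hmp
  have h6 : 1 / (540 * B0) = 1 / (1080 * B0) + 1 / (1080 * B0) := by field_simp; norm_num
  rw [h6] at h1
  linarith

theorem ag_decay (hq : 1 ≤ q) (hn : 1 ≤ n) (hR : 2 * n ≤ R) {w : ℂ} (hw : ‖w‖ ≤ ρ0) (φ : ℝ) :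
    ‖CS R (ag R q n w) φ‖ ^ 2 * (n ^ 2 * sg φ) ≤ 1296 := by
  have hn0 : 0 < n := by linarith
  have hw2 : ‖w‖ ≤ 1 / 2 := hw.trans (by unfold ρ0 B0; norm_num)
  have hre : (1 : ℝ) / 2 ≤ (1 + w).re := by
    have := (abs_le.1 (abs_re_le_norm w)).1
    simp; linarith
  have hno : ‖1 + w‖ ≤ 3 / 2 := by
    refine (norm_add_le _ _).trans ?_
    rw [norm_one]; linarith
  have hfac : ‖1 + w‖ / (1 + w).re ≤ 3 := by rw [div_le_iff₀ (by linarith)]; linarith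
  have h1 : ∑ m ∈ range R, ‖eg q n w m - eg q n w (m + 1)‖ + ‖eg q n w R‖ ≤ 3 := by
    have k1 : ∀ m ∈ range R, ‖eg q n w m - eg q n w (m + 1)‖ ≤
        3 * (exp (-(1 + w).re * uu q n m) - exp (-(1 + w).re * uu q n (m + 1))) := by
      intro m _
      have hm := uu_mono hq hn (Nat.le_succ m)
      refine (norm_exp_sub_exp_le (by linarith) hm).trans ?_
      refine mul_le_mul_of_nonneg_right hfac ?_
      rw [sub_nonneg, exp_le_exp]; nlinarith
    have k2 := sum_le_sum k1
    rw [← mul_sum, sum_range_sub' (fun m => exp (-(1 + w).re * uu q n m)), uu_zero hq] at k2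
    have k3 : ‖eg q n w R‖ = exp (-(1 + w).re * uu q n R) := by rw [norm_eg]; simp
    rw [k3]
    have := exp_pos (-(1 + w).re * uu q n R)
    simp only [mul_zero, exp_zero] at k2
    linarith
  have h2 := CS_decay h1 φ
  have hZ := Zg_ge hq hn hR hw
  have hs := sg_nonneg φ
  have h3 : ‖(Zg R q n w)⁻¹‖ * n ≤ 6 := by
    rw [norm_inv, inv_mul_le_iff₀ (by linarith)]; linarith
  have h4 : (‖(Zg R q n w)⁻¹‖ * n) ^ 2 ≤ 6 ^ 2 := by gcongr
  rw [CS_ag, norm_mul]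
  have h5 : (‖(Zg R q n w)⁻¹‖ * n) ^ 2 * (‖CS R (eg q n w) φ‖ ^ 2 * sg φ) ≤ 6 ^ 2 * (4 * 3 ^ 2) := by gcongr
  nlinarith

theorem ag_good (hq : 1 ≤ q) (hn : 1 ≤ n) (hR : 2 * n ≤ R) {w : ℂ} (hw : ‖w‖ ≤ ρ0) :
    Good R n (1 / (1080 * B0) / 1296) (24 * B0) (ag R q n w) := by
  have hn0 : 0 < n := by linarith
  have hB : 1 ≤ B0 := by unfold B0; norm_num
  have hw2 : ‖w‖ ≤ 1 / 2 := hw.trans (by unfold ρ0 B0; norm_num)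
  refine ⟨ag_mass hq hn hR hw, fun φ hφ => ⟨?_, ?_⟩⟩
  · exact combine (norm_nonneg _) (mul_nonneg (sq_nonneg _) (sg_nonneg _)) (by positivity)
      (by unfold B0; norm_num) (by norm_num) (ag_bound hq hn hR hw hφ) (ag_decay hq hn hR hw φ)
  · rw [← ag_mass hq hn hR hw]
    have hZ := Zg_ge hq hn hR hw
    refine (CS_near (B := 6 * B0) hn0 ?_ φ).trans ?_
    · have m2 := moment' (R := R) hq hn (fun k => ‖eg q n w k‖) fun k => (norm_eg_le hn hw2 k).trans (exp_le_mom hn k)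
      unfold ag
      simp only [norm_mul, norm_inv]
      calc _ = ‖Zg R q n w‖⁻¹ * ∑ k ∈ range R, (1 + (((k : ℝ) + 1) / n) ^ 2) * ‖eg q n w (k + 1)‖ := by
            rw [mul_sum]; exact sum_congr rfl fun k _ => by ring
        _ ≤ ‖Zg R q n w‖⁻¹ * (B0 * n) := by gcongr
        _ ≤ _ := by
          rw [inv_mul_le_iff₀ (by linarith)]; nlinarith
    · have := min_le_right 1 (n ^ 2 * sg φ)
      nlinarith

theorem ag_diff (hq : 1 ≤ q) (hn : 1 ≤ n) (hR : 2 * n ≤ R) (k : ℕ) :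
    DifferentiableOn ℂ (fun w => ag R q n w k) (Metric.ball 0 ρ0) := by
  intro w hw
  have hw' : ‖w‖ ≤ ρ0 := by simpa using (by simpa using hw : ‖w‖ < ρ0).le
  apply DifferentiableAt.differentiableWithinAt
  have e : ∀ k, Differentiable ℂ fun w => eg q n w k := by
    intro k; unfold eg; fun_prop
  have z : Differentiable ℂ fun w => Zg R q n w := by
    unfold Zg CS
    refine (e 0).add (Differentiable.fun_sum fun k _ => ?_)
    exact ((e (k + 1)).const_mul _).mul_const _
  unfold ag
  exact ((z w).inv (Zg_ne hq hn hR hw')).mul (e k w)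

theorem ag_contr {d : ℕ} {p1 r : ℝ} (hp1 : 1 < p1) (hr1 : p1 ≤ r) (hr2 : r ≤ 2) (hq : 1 ≤ q) (hn : 1 ≤ n) (hR : 2 * n ≤ R)
    {w : ℂ} (hw : ‖w‖ ≤ (1 - 1 / p1) / 2 * ρ0) (f : (Fin d → ZMod (2 * R + 1)) → ℂ) :
    NN r (cv (PK R d (ag R q n w)) f) ≤ NN r f := by
  have hle : ∀ {w : ℂ}, w ∈ Metric.ball (0 : ℂ) ρ0 → ‖w‖ ≤ ρ0 := fun {w} hw => by
    simpa using (by simpa using hw : ‖w‖ < ρ0).le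
  have hB : 0 < B0 := by unfold B0; norm_num
  refine contrp (by linarith) hr2 (a := ag R q n) ρ0_pos (ag_diff hq hn hR) ?_ ?_ w (hw.trans ?_) f
  · intro w hw φ hφ
    exact (ag_good hq hn hR (hle hw)).one (by positivity) φ hφ
  · intro s hs
    exact ⟨ag_real hq s, ag_mass hq hn hR (by simpa using hs.le)⟩
  · have := one_div_le_one_div_of_le (by linarith) hr1
    have := ρ0_pos
    gcongr

theorem ag_lip {d : ℕ} {p1 r n' : ℝ} (hp1 : 1 < p1) (hr1 : p1 ≤ r) (hr2 : r ≤ 2) (hq : 1 ≤ q) (hn : 1 ≤ n)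
    (hnn : n ≤ n') (hR : 2 * n' ≤ R) {w : ℂ} (hw : ‖w‖ < (1 - 1 / p1) / 2 * ρ0 / 2)
    (f : (Fin d → ZMod (2 * R + 1)) → ℂ) :
    NN r (fun x => cv (PK R d (ag R q n w)) f x - cv (PK R d (ag R q n' w)) f x) ≤
      4 / ((1 - 1 / p1) / 2 * ρ0) * (2 * q) * ((n' - n) / n) * NN r f := by
  have hN := NN_nonneg r f
  have hr : 1 < r := by linarith
  have hn0 : 0 < n := by linarith
  have hn0' : 0 < n' := by linarith
  have hR' : 2 * n ≤ R := by linarith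
  have hp0 : 0 < p1 := by linarith
  set ρ := (1 - 1 / p1) / 2 * ρ0 with hρ
  have hρ0 : 0 < ρ := by
    have : 1 / p1 < 1 := by rw [div_lt_one hp0]; exact hp1
    have := ρ0_pos
    rw [hρ]; apply mul_pos _ this; linarith
  have hρle : ρ ≤ ρ0 := by
    have : 0 < 1 / p1 := by positivity
    have := ρ0_pos
    rw [hρ]; nlinarith
  set g := (n / n') ^ q with hg
  have hg1 : g ≤ 1 := rpow_le_one (by positivity) ((div_le_one hn0').2 hnn) (by linarith)
  have hg2 : 1 - g ≤ q * ((n' - n) / n) := by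
    have h1 := one_add_mul_self_le_rpow_one_add (s := n / n' - 1) (p := q) (by have : 0 < n / n' := by positivity
                                                                               linarith) hq
    rw [show 1 + (n / n' - 1) = n / n' by ring, ← hg] at h1
    have h2 : 1 - n / n' = (n' - n) / n' := by field_simp
    have h3 : (n' - n) / n' ≤ (n' - n) / n := div_le_div_of_nonneg_left (by linarith) hn0 hnn
    nlinarith
  set w' : ℂ := (1 + w) * g - 1 with hw'
  have ee : ∀ k, eg q n' w k = eg q n w' k := by
    intro k
    unfold eg
    have : uu q n' k = g * uu q n k := by
      unfold uu
      rw [hg, ← mul_rpow (by positivity) (by positivity)]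
      congr 1; field_simp
    rw [this, hw']; push_cast; ring_nf
  have ea : ag R q n' w = ag R q n w' := by
    funext k
    unfold ag Zg
    rw [show eg q n' w = eg q n w' from funext ee]
  have hd : ‖w' - w‖ ≤ 2 * q * ((n' - n) / n) := by
    have e : w' - w = -((1 + w) * ((1 - g : ℝ) : ℂ)) := by rw [hw']; push_cast; ring
    rw [e, norm_neg, norm_mul, norm_real, norm_of_nonneg (by linarith)]
    have h1 : ‖1 + w‖ ≤ 2 := by
      refine (norm_add_le _ _).trans ?_
      have : ρ0 ≤ 1 := by unfold ρ0 B0; norm_num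
      rw [norm_one]; linarith
    nlinarith [norm_nonneg (1 + w)]
  have hδ : 0 ≤ (n' - n) / n := div_nonneg (by linarith) hn0.le
  have goal : NN r (fun x => cv (PK R d (ag R q n w)) f x - cv (PK R d (ag R q n' w)) f x) ≤
      4 / ρ * ‖w' - w‖ * NN r f := by
    by_cases hc : ‖w'‖ < ρ
    · have := lip_lemma hr (fun w => PK R d (ag R q n w)) hρ0
        (PK_diff fun k => (ag_diff hq hn hR' k).mono (Metric.ball_subset_ball hρle))
        (fun w hw f => ag_contr hp1 hr1 hr2 hq hn hR' (by simpa using hw : ‖w‖ < ρ).le f)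
        hc hw f
      rw [ea]
      refine le_trans (le_of_eq (NN_congr fun x => norm_sub_rev _ _)) this
    · have h3 := (NN_sub_le hr.le (cv (PK R d (ag R q n w)) f) (cv (PK R d (ag R q n' w)) f)).trans
        (add_le_add (ag_contr hp1 hr1 hr2 hq hn hR' (by linarith) f)
          (ag_contr hp1 hr1 hr2 hq (by linarith) hR (by linarith) f))
      have h4 : ρ / 2 ≤ ‖w' - w‖ := by
        have := norm_sub_norm_le w' w
        linarith
      have : 2 ≤ 4 / ρ * ‖w' - w‖ := by
        rw [div_mul_eq_mul_div, le_div_iff₀ hρ0]; linarith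
      nlinarith
  refine goal.trans ?_
  calc 4 / ρ * ‖w' - w‖ * NN r f ≤ 4 / ρ * (2 * q * ((n' - n) / n)) * NN r f := by
        have := NN_nonneg r f
        gcongr
    _ = _ := by ring

end expo

def LS (d : ℕ) (q t : ℝ) : Set (Fin d → ℤ) := {y | ∑ j, |(y j : ℝ)| ^ q ≤ t ^ q}

theorem LS_abs {d : ℕ} {q t : ℝ} (hq : 1 ≤ q) (ht : 0 ≤ t) {y : Fin d → ℤ} (hy : y ∈ LS d q t) (j : Fin d) :
    |(y j : ℝ)| ≤ t := by
  have h : |(y j : ℝ)| ^ q ≤ t ^ q :=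
    le_trans (single_le_sum (f := fun j => |(y j : ℝ)| ^ q) (fun i _ => by positivity) (mem_univ j)) hy
  exact (rpow_le_rpow_iff (abs_nonneg _) ht (by linarith)).1 h

theorem LS_fin {d : ℕ} {q t : ℝ} (hq : 1 ≤ q) (ht : 0 ≤ t) : (LS d q t).Finite := by
  refine (Set.finite_Icc (fun _ : Fin d => -⌊t⌋) (fun _ => ⌊t⌋)).subset fun y hy => ?_
  have h := fun j => abs_le.1 (LS_abs hq ht hy j)
  exact ⟨fun j => by
    have := Int.le_floor.2 (show ((-y j : ℤ) : ℝ) ≤ t by push_cast; linarith [(h j).1])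
    simp only; omega, fun j => Int.le_floor.2 (h j).2⟩

theorem LS_card {d : ℕ} {q t : ℝ} (hq : 1 ≤ q) (hd : 0 < d) (ht : (d : ℝ) ^ (1 + 1 / q) ≤ t) :
    (1 / 2) * t ^ d * ((2 * Gamma (1 / q + 1)) ^ d / Gamma (d / q + 1)) ≤ (LS d q t).ncard := by
  have hd1 : (1 : ℝ) ≤ d := by exact_mod_cast hd
  have hq0 : 0 < q := by linarith
  set e := (d : ℝ) ^ (1 / q) with he
  have he0 : 0 < e := by positivity
  have hde : d * e ≤ t := by rwa [he, ← rpow_one_add' (by positivity) (by positivity)]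
  have ht0 : 0 < t := lt_of_lt_of_le (by positivity) hde
  have hfin := LS_fin (d := d) hq ht0.le
  haveI : Nonempty (Fin d) := ⟨⟨0, hd⟩⟩
  set s := t - e / 2 with hs
  have hst : t * (1 - 1 / (2 * d)) ≤ s := by
    rw [hs, mul_sub, mul_one]
    have : e / 2 ≤ t * (1 / (2 * d)) := by rw [mul_one_div, div_le_div_iff₀ (by norm_num) (by positivity)]; nlinarith
    linarith
  have h12 : 1 / (2 * (d : ℝ)) ≤ 1 / 2 := by gcongr; linarith
  have hs0 : 0 ≤ s := le_trans (mul_nonneg ht0.le (by linarith)) hst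
  have hpow : (1 / 2) * t ^ d ≤ s ^ d := by
    have h1 := one_add_mul_le_pow (a := -(1 / (2 * (d : ℝ)))) (by linarith) d
    have h2 : 1 + (d : ℝ) * -(1 / (2 * (d : ℝ))) = 1 / 2 := by field_simp; norm_num
    rw [h2] at h1
    calc (1 / 2) * t ^ d ≤ (1 + -(1 / (2 * (d : ℝ)))) ^ d * t ^ d := by gcongr
      _ = (t * (1 - 1 / (2 * d))) ^ d := by rw [← mul_pow]; ring_nf
      _ ≤ s ^ d := pow_le_pow_left₀ (mul_nonneg ht0.le (by linarith)) hst d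
  have hvol := MeasureTheory.volume_sum_rpow_le (ι := Fin d) hq s
  have hsub : {x : Fin d → ℝ | (∑ i, |x i| ^ q) ^ (1 / q) ≤ s} ⊆
      ⋃ y ∈ hfin.toFinset, Set.Icc (fun j => (y j : ℝ) - 1 / 2) (fun j => (y j : ℝ) + 1 / 2) := by
    intro x hx
    have hr := fun j => abs_le.1 (abs_sub_round (x j))
    refine Set.mem_iUnion₂.2 ⟨fun j => round (x j), ?_, fun j => by simp only; linarith [(hr j).1],
      fun j => by simp only; linarith [(hr j).2]⟩
    rw [Set.Finite.mem_toFinset]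
    have h1 := Lp_add_le univ x (fun j => (round (x j) : ℝ) - x j) hq
    have h2 : (∑ j, |(round (x j) : ℝ) - x j| ^ q) ^ (1 / q) ≤ e / 2 := by
      have h3 : (∑ j, |(round (x j) : ℝ) - x j| ^ q) ≤ ∑ j : Fin d, (1 / 2 : ℝ) ^ q :=
        sum_le_sum fun j _ => rpow_le_rpow (abs_nonneg _)
          (by rw [abs_sub_comm]; exact abs_sub_round _) hq0.le
      refine (rpow_le_rpow (sum_nonneg fun j _ => by positivity) h3 (by positivity)).trans ?_
      rw [sum_const, card_univ, Fintype.card_fin, nsmul_eq_mul,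
        mul_rpow (by positivity) (by positivity), ← rpow_mul (by norm_num), mul_one_div_cancel hq0.ne',
        rpow_one, he]
      linarith
    have hx' : (∑ i, |x i| ^ q) ^ (1 / q) ≤ s := hx
    simp only [add_sub_cancel] at h1
    have h4 : (∑ j, |(round (x j) : ℝ)| ^ q) ^ (1 / q) ≤ t := by linarith
    have h5 := rpow_le_rpow (by positivity) h4 hq0.le
    rwa [← rpow_mul (sum_nonneg fun j _ => by positivity), one_div_mul_cancel hq0.ne', rpow_one] at h5
  have hle := (MeasureTheory.measure_mono (μ := MeasureTheory.volume) hsub).trans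
    (MeasureTheory.measure_biUnion_finset_le _ _)
  have hc : ∀ y : Fin d → ℤ, MeasureTheory.volume (Set.Icc (fun j => (y j : ℝ) - 1 / 2) (fun j => (y j : ℝ) + 1 / 2)) = 1 := by
    intro y
    rw [volume_Icc_pi]
    refine Finset.prod_eq_one fun j _ => ?_
    rw [show (y j : ℝ) + 1 / 2 - (y j - 1 / 2) = 1 by ring, ENNReal.ofReal_one]
  rw [hvol, sum_congr rfl fun y _ => hc y, sum_const, nsmul_eq_mul, mul_one,
    ← Set.ncard_eq_toFinset_card _ hfin, Fintype.card_fin, ← ENNReal.ofReal_pow hs0, ← ENNReal.ofReal_mul (by positivity),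
    ENNReal.ofReal_le_natCast] at hle
  have hG : 0 < Gamma (1 / q + 1) := Gamma_pos_of_pos (by positivity)
  have hG' : 0 < Gamma (d / q + 1) := Gamma_pos_of_pos (by positivity)
  refine le_trans ?_ hle
  gcongr

theorem Zr_le_gamma {R : ℕ} {q n : ℝ} (hq : 1 ≤ q) (hn : 0 < n) :
    Zr R q n ≤ 1 + 2 * Gamma (1 / q + 1) * n := by
  have hq0 : 0 < q := by linarith
  have hb : 0 < n ^ (-q) := by positivity
  have key : ∀ x : ℝ, 0 ≤ x → (x / n) ^ q = n ^ (-q) * x ^ q := by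
    intro x hx; rw [div_rpow hx hn.le, rpow_neg hn.le]; field_simp
  have h1 : ∑ k ∈ range R, exp (-uu q n (k + 1)) ≤
      ∫ x in (0 : ℝ)..(0 + R), exp (-n ^ (-q) * x ^ q) := by
    refine le_trans (le_of_eq ?_) (AntitoneOn.sum_le_integral (x₀ := 0) (a := R)
      (f := fun x : ℝ => exp (-n ^ (-q) * x ^ q)) ?_)
    · refine sum_congr rfl fun k _ => ?_
      rw [uu, key _ (by positivity)]; simp
    · intro x hx y hy hxy
      have := rpow_le_rpow hx.1 hxy hq0.le
      exact Real.exp_le_exp.2 (by nlinarith)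
  have hint : MeasureTheory.IntegrableOn (fun x : ℝ => exp (-n ^ (-q) * x ^ q)) (Set.Ioi 0) := by
    by_contra h
    have h2 := integral_exp_neg_mul_rpow hq0 hb
    rw [MeasureTheory.integral_undef h] at h2
    have : 0 < Gamma (1 / q + 1) := Gamma_pos_of_pos (by positivity)
    have : 0 < (n ^ (-q)) ^ (-1 / q) * Gamma (1 / q + 1) := by positivity
    linarith
  have h2 : ∫ x in (0 : ℝ)..(0 + R), exp (-n ^ (-q) * x ^ q) ≤ n * Gamma (1 / q + 1) := by
    have e : (n ^ (-q)) ^ (-1 / q) = n := by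
      rw [← rpow_mul hn.le, show -q * (-1 / q) = 1 by field_simp, rpow_one]
    rw [intervalIntegral.integral_of_le (by positivity), ← e, ← integral_exp_neg_mul_rpow hq0 hb, e]
    exact MeasureTheory.setIntegral_mono_set hint (Filter.Eventually.of_forall fun x => (exp_pos _).le)
      (Set.Ioc_subset_Ioi_self).eventuallyLE
  unfold Zr
  rw [← mul_sum]; linarith

theorem gamma_le {D : ℝ} (hD : 0 < D) : Gamma (D + 1) * exp D ≤ 50 * √(1 + D) * D ^ D := by
  have hs1 : 1 ≤ √(1 + D) := Real.one_le_sqrt.2 (by linarith)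
  have he : exp 1 ≤ 3 := Real.exp_one_lt_three.le
  set N := ⌊D⌋₊ with hN
  have hN1 : (N : ℝ) ≤ D := Nat.floor_le hD.le
  have hN2 : D < N + 1 := Nat.lt_floor_add_one D
  have hG : Gamma (D + 1) ≤ N.factorial * ((N : ℝ) + 1) ^ (D - N) := by
    rcases eq_or_lt_of_le hN1 with h | h
    · rw [← h, Gamma_nat_eq_factorial]; simp
    · have := Gamma_mul_add_mul_le_rpow_Gamma_mul_rpow_Gamma (s := N + 1) (t := (N : ℝ) + 1 + 1) (a := 1 - (D - N))
        (b := D - N) (by positivity) (by positivity) (by linarith) (by linarith) (by ring)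
      rw [show (1 - (D - N)) * ((N : ℝ) + 1) + (D - N) * (N + 1 + 1) = D + 1 by ring,
        Gamma_add_one (s := (N : ℝ) + 1) (by positivity), Gamma_nat_eq_factorial,
        mul_rpow (by positivity) (by positivity)] at this
      refine this.trans (le_of_eq ?_)
      have e : (N.factorial : ℝ) ^ (1 - (D - N)) * (N.factorial : ℝ) ^ (D - N) = N.factorial := by
        rw [← rpow_add (by positivity)]; simp
      linear_combination ((N : ℝ) + 1) ^ (D - N) * e
  rcases Nat.eq_zero_or_pos N with h0 | hpos
  · rw [h0] at hG hN2
    simp at hG hN2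
    have h1 : exp (D - 1) ≤ D ^ D := by
      rw [rpow_def_of_pos hD, exp_le_exp]
      have := one_sub_inv_le_log_of_pos hD
      have := mul_le_mul_of_nonneg_right this hD.le
      rw [sub_mul, inv_mul_cancel₀ hD.ne'] at this
      linarith
    have h2 : exp D = exp 1 * exp (D - 1) := by rw [← exp_add]; ring_nf
    calc Gamma (D + 1) * exp D ≤ 1 * exp D := by gcongr
      _ ≤ 3 * D ^ D := by rw [h2]; nlinarith [exp_pos (D - 1)]
      _ ≤ 50 * √(1 + D) * D ^ D := by gcongr; linarith
  · have hNr : (1 : ℝ) ≤ N := by exact_mod_cast hpos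
    have hst : (N.factorial : ℝ) ≤ 3 * √N * (N / exp 1) ^ N := by
      obtain ⟨k, hk⟩ := Nat.exists_eq_succ_of_ne_zero hpos.ne'
      have h1 : Stirling.stirlingSeq N ≤ Stirling.stirlingSeq 1 := by
        rw [hk]; exact Stirling.stirlingSeq'_antitone (Nat.zero_le k)
      rw [Stirling.stirlingSeq_one, Stirling.stirlingSeq, div_le_iff₀ (by positivity)] at h1
      refine h1.trans (le_of_eq_of_le ?_ (mul_le_mul_of_nonneg_right (mul_le_mul_of_nonneg_right he (sqrt_nonneg _)) (by positivity)))
      rw [sqrt_mul (by norm_num)]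
      field_simp
    have hDD : D ^ D = D ^ N * D ^ (D - N) := by
      rw [← rpow_natCast, ← rpow_add hD]; ring_nf
    have h3 : ((N : ℝ) + 1) ^ (D - N) ≤ 2 * D ^ (D - N) := by
      calc ((N : ℝ) + 1) ^ (D - N) ≤ (2 * D) ^ (D - N) := rpow_le_rpow (by positivity) (by linarith) (by linarith)
        _ = 2 ^ (D - N) * D ^ (D - N) := mul_rpow (by norm_num) hD.le
        _ ≤ 2 * D ^ (D - N) := by
          gcongr
          calc (2 : ℝ) ^ (D - N) ≤ 2 ^ (1 : ℝ) := rpow_le_rpow_of_exponent_le (by norm_num) (by linarith)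
            _ = 2 := rpow_one 2
    have h4 : exp D ≤ 3 * exp 1 ^ N := by
      rw [← exp_nat_mul, mul_one]
      calc exp D ≤ exp (1 + N) := Real.exp_le_exp.2 (by linarith)
        _ = exp 1 * exp N := exp_add _ _
        _ ≤ _ := by gcongr
    calc Gamma (D + 1) * exp D
        ≤ ((3 * √N * (N / exp 1) ^ N) * (2 * D ^ (D - N))) * (3 * exp 1 ^ N) := by
          gcongr
          exact hG.trans (by gcongr)
      _ = 18 * √N * (N ^ N * D ^ (D - N)) := by rw [div_pow]; field_simp; ring
      _ ≤ 18 * √(1 + D) * (D ^ N * D ^ (D - N)) := by gcongr; linarith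
      _ ≤ 50 * √(1 + D) * D ^ D := by rw [← hDD]; gcongr; norm_num

theorem Zr_card {q : ℝ} (hq : 1 ≤ q) : ∃ C, 0 < C ∧ ∀ (R d : ℕ) (t : ℝ), 0 < d → (d : ℝ) ^ (1 + 1 / q) ≤ t →
    exp (d / q) * Zr R q (t / (d / q) ^ (1 / q)) ^ d ≤ C * √(1 + d / q) * (LS d q t).ncard := by
  set g := 2 * Gamma (1 / q + 1) with hg
  have hq0 : 0 < q := by linarith
  have hg0 : 0 < g := mul_pos two_pos (Gamma_pos_of_pos (by positivity))
  refine ⟨100 * exp (1 / g), by positivity, ?_⟩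
  intro R d t hd ht
  have hd1 : (1 : ℝ) ≤ d := by exact_mod_cast hd
  set D := (d : ℝ) / q with hD
  have hD0 : 0 < D := by positivity
  set n := t / D ^ (1 / q) with hn
  have hnd : d ≤ n := by
    rw [hn, le_div_iff₀ (by positivity)]
    refine le_trans ?_ ht
    rw [rpow_add (by positivity), rpow_one]
    gcongr
    exact div_le_self (by positivity) hq
  have hn0 : 0 < n := by linarith
  have ht0 : 0 < t := lt_of_lt_of_le (by positivity) ht
  have hnpow : n ^ d * D ^ D = t ^ d := by
    have : (D ^ (1 / q)) ^ d = D ^ D := by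
      rw [← rpow_natCast, ← rpow_mul hD0.le]; congr 1; rw [hD]; ring
    rw [hn, div_pow, this]; field_simp
  have hZ : Zr R q n ^ d ≤ exp (1 / g) * (g * n) ^ d := by
    have h0 : 0 ≤ Zr R q n := by unfold Zr; positivity
    have h1 : Zr R q n ≤ exp (1 / (g * n)) * (g * n) := by
      refine (Zr_le_gamma hq hn0).trans ?_
      have := mul_le_mul_of_nonneg_right (add_one_le_exp (1 / (g * n))) (by positivity : 0 ≤ g * n)
      rw [add_mul, one_div_mul_cancel (by positivity)] at this
      linarith
    refine (pow_le_pow_left₀ h0 h1 d).trans ?_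
    rw [mul_pow, ← exp_nat_mul]
    gcongr
    rw [mul_one_div, div_le_div_iff₀ (by positivity) hg0]; nlinarith
  have hc := LS_card hq hd ht
  have hG := gamma_le hD0
  have hG0 : 0 < Gamma (D + 1) := Gamma_pos_of_pos (by positivity)
  calc exp D * Zr R q n ^ d ≤ exp D * (exp (1 / g) * (g * n) ^ d) := by gcongr
    _ = exp (1 / g) * (g * n) ^ d / Gamma (D + 1) * (Gamma (D + 1) * exp D) := by field_simp
    _ ≤ exp (1 / g) * (g * n) ^ d / Gamma (D + 1) * (50 * √(1 + D) * D ^ D) := by gcongr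
    _ = 100 * exp (1 / g) * √(1 + D) * ((1 / 2) * t ^ d * (g ^ d / Gamma (D + 1))) := by
        rw [← hnpow, mul_pow]; field_simp; ring
    _ ≤ _ := by gcongr

theorem norm_one_add_exp {φ : ℝ} (h : |φ| ≤ 1) : ‖1 + Complex.exp (φ * I)‖ ≤ 2 - φ ^ 2 / 10 := by
  have hφ : φ ^ 2 ≤ 1 := by rw [← sq_abs]; nlinarith [abs_nonneg φ]
  refine abs_le_of_sq_le_sq' ?_ (by linarith) |>.2
  have hc : cos φ ≤ 1 - φ ^ 2 / 5 := by
    refine (cos_le_one_sub_mul_cos_sq (h.trans (by linarith [pi_gt_three]))).trans ?_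
    have : 1 / 5 ≤ 2 / π ^ 2 := by
      rw [div_le_div_iff₀ (by norm_num) (by positivity)]; nlinarith [pi_lt_d2, pi_pos]
    nlinarith [sq_nonneg φ]
  rw [← normSq_eq_norm_sq, exp_mul_I, normSq_apply]
  simp [cos_ofReal_re, sin_ofReal_re]
  nlinarith [sin_sq_add_cos_sq φ]

theorem pair_norm {a b α β : ℝ} (hb : 0 ≤ b) (hab : b ≤ a) (h : |β - α| ≤ 1) :
    ‖(a : ℂ) * Complex.exp (α * I) + b * Complex.exp (β * I)‖ ≤ a + b - b * ((β - α) ^ 2 / 10) := by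
  have e : (a : ℂ) * Complex.exp (α * I) + b * Complex.exp (β * I) =
      ((a - b : ℝ) : ℂ) * Complex.exp (α * I) +
        b * (Complex.exp (α * I) * (1 + Complex.exp ((β - α : ℝ) * I))) := by
    rw [mul_add (Complex.exp _), ← Complex.exp_add]; push_cast; ring_nf
  rw [e]
  refine (norm_add_le _ _).trans ?_
  simp only [norm_mul, norm_exp_ofReal_mul_I, norm_real, norm_eq_abs, abs_of_nonneg hb,
    abs_of_nonneg (sub_nonneg.2 hab)]
  nlinarith [norm_one_add_exp h]

theorem Zg_le {R : ℕ} {q n τ : ℝ} (hq : 1 ≤ q) (hn : 1 ≤ n) (hR : 4 * n ≤ R) (hτ : |τ| * 4 ^ q ≤ 1) :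
    ‖Zg R q n (τ * I)‖ ≤ Zr R q n * exp (-(exp (-4 ^ q) / (15 * B0)) * τ ^ 2) := by
  have hn0 : 0 < n := by linarith
  set H := ⌈n⌉₊ with hH
  have h1 : n ≤ H := Nat.le_ceil n
  have h2 : (H : ℝ) ≤ 2 * n := by linarith [Nat.ceil_lt_add_one hn0.le]
  have hHR : H + H ≤ R := by have : (H : ℝ) + H ≤ R := by linarith
                             exact_mod_cast this
  obtain ⟨S, hS⟩ := Nat.exists_eq_add_of_le hHR
  have he : ∀ k, eg q n (τ * I) k = (exp (-uu q n k) : ℝ) * Complex.exp ((-(τ * uu q n k) : ℝ) * I) := by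
    intro k; unfold eg; rw [Complex.ofReal_exp, ← Complex.exp_add]; push_cast; ring_nf
  have hp : ∀ k ∈ range H, ‖eg q n (τ * I) (k + 1) + eg q n (τ * I) (H + k + 1)‖ ≤
      exp (-uu q n (k + 1)) + exp (-uu q n (H + k + 1)) - exp (-4 ^ q) * (τ ^ 2 / 10) := by
    intro k hk
    have hk' : ((k + 1 : ℕ) : ℝ) ≤ H := by exact_mod_cast Finset.mem_range.1 hk
    have hm := uu_mono hq hn (show k + 1 ≤ H + k + 1 by omega)
    have hu0 := uu_nonneg (q := q) hn (k + 1)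
    have hu4 : uu q n (H + k + 1) ≤ 4 ^ q := by
      unfold uu
      refine rpow_le_rpow (by positivity) ?_ (by linarith)
      rw [div_le_iff₀ hn0]; push_cast at hk' ⊢; linarith
    have hu1 : 1 ≤ uu q n (H + k + 1) - uu q n (k + 1) := by
      have h := add_rpow_le_rpow_add (a := H / n) (b := ((k + 1 : ℕ) : ℝ) / n) (by positivity) (by positivity) hq
      rw [← add_div] at h
      have h3 : 1 ≤ (H / n) ^ q := one_le_rpow ((one_le_div hn0).2 h1) (by linarith)
      unfold uu
      have : ((H + k + 1 : ℕ) : ℝ) = H + (k + 1 : ℕ) := by push_cast; ring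
      rw [this]; linarith
    have eqq : -(τ * uu q n (H + k + 1)) - -(τ * uu q n (k + 1)) = -(τ * (uu q n (H + k + 1) - uu q n (k + 1))) := by ring
    rw [he, he]
    refine (pair_norm (exp_pos _).le (Real.exp_le_exp.2 (by linarith)) ?_).trans ?_
    · rw [eqq, abs_neg, abs_mul, abs_of_nonneg (a := _ - _) (by linarith)]
      exact le_trans (mul_le_mul_of_nonneg_left (by linarith) (abs_nonneg _)) hτ
    · have hb : exp (-4 ^ q) ≤ exp (-uu q n (H + k + 1)) := Real.exp_le_exp.2 (by linarith)
      have : τ ^ 2 / 10 ≤ (-(τ * uu q n (H + k + 1)) - -(τ * uu q n (k + 1))) ^ 2 / 10 := by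
        rw [eqq, neg_sq, mul_pow]
        exact div_le_div_of_nonneg_right (le_mul_of_one_le_right (sq_nonneg τ) (one_le_pow₀ hu1)) (by norm_num)
      have := mul_le_mul hb this (by positivity) (exp_pos _).le
      linarith
  have hZ : ‖Zg R q n (τ * I)‖ ≤ Zr R q n - 2 * (H * (exp (-4 ^ q) * (τ ^ 2 / 10))) := by
    have hsplit : ∀ {M : Type} [AddCommMonoid M] (f : ℕ → M), ∑ k ∈ range R, f (k + 1) =
        ∑ k ∈ range H, (f (k + 1) + f (H + k + 1)) + ∑ k ∈ range S, f (H + H + k + 1) := by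
      intro M _ f
      rw [hS, sum_range_add, sum_range_add, ← sum_add_distrib]
    have e1 : Zg R q n (τ * I) = eg q n (τ * I) 0 + 2 * ∑ k ∈ range R, eg q n (τ * I) (k + 1) := by
      unfold Zg CS; rw [mul_sum]; simp
    have e2 : Zr R q n = 1 + 2 * ∑ k ∈ range R, exp (-uu q n (k + 1)) := by
      unfold Zr; rw [mul_sum]
    have hn1 : ∀ k, ‖eg q n (τ * I) k‖ = exp (-uu q n k) := by intro k; rw [norm_eg]; simp
    rw [e1, e2, hsplit (fun k => eg q n (τ * I) k), hsplit fun k => exp (-uu q n k)]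
    refine (norm_add_le _ _).trans ?_
    rw [norm_mul, hn1, uu_zero hq]
    have h3 := (norm_add_le (∑ k ∈ range H, (eg q n (τ * I) (k + 1) + eg q n (τ * I) (H + k + 1)))
      (∑ k ∈ range S, eg q n (τ * I) (H + H + k + 1))).trans (add_le_add
        ((norm_sum_le _ _).trans (sum_le_sum hp)) (norm_sum_le _ _))
    simp only [hn1] at h3
    rw [sum_sub_distrib, sum_const, card_range, nsmul_eq_mul] at h3
    simp; linarith
  refine hZ.trans ?_
  have hZr := Zr_le (R := R) hq hn
  have hB : 0 < B0 := by unfold B0; norm_num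
  have h0 : 0 ≤ Zr R q n := by unfold Zr; positivity
  set b := exp (-4 ^ q)
  have hb : 0 < b := exp_pos _
  calc Zr R q n - 2 * (H * (b * (τ ^ 2 / 10))) ≤ Zr R q n - n * (b * τ ^ 2) / 5 := by
        have : n * (b * τ ^ 2) ≤ H * (b * τ ^ 2) := by gcongr
        linarith
    _ ≤ Zr R q n * (1 - b / (15 * B0) * τ ^ 2) := by
        have h4 : Zr R q n * (b / (15 * B0) * τ ^ 2) ≤ 3 * B0 * n * (b / (15 * B0) * τ ^ 2) := by gcongr
        have h5 : 3 * B0 * n * (b / (15 * B0) * τ ^ 2) = n * (b * τ ^ 2) / 5 := by field_simp; ring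
        linarith
    _ ≤ _ := by
        gcongr
        have := one_sub_le_exp_neg (b / (15 * B0) * τ ^ 2)
        rwa [neg_mul]

noncomputable def eS (M : ℕ) (θ : ℝ) : ℂ := ∑ m : Fin M, Complex.exp ((m * θ : ℝ) * I)

theorem eS_low (M : ℕ) (θ : ℝ) : 2 - 2 * cos (M * θ) ≤ θ ^ 2 * ‖eS M θ‖ ^ 2 := by
  set z := Complex.exp (θ * I) with hz
  have h1 : eS M θ * (z - 1) = z ^ M - 1 := by
    rw [← geom_sum_mul, eS, Fin.sum_univ_eq_sum_range (fun m => Complex.exp ((m * θ : ℝ) * I))]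
    congr 1
    refine sum_congr rfl fun m _ => ?_
    rw [hz, ← Complex.exp_nat_mul]; push_cast; ring_nf
  have h2 : ∀ φ : ℝ, ‖Complex.exp (φ * I) - 1‖ ^ 2 = 2 - 2 * cos φ := by
    intro φ
    rw [← normSq_eq_norm_sq, exp_mul_I, normSq_apply]
    simp [cos_ofReal_re, sin_ofReal_re]
    nlinarith [sin_sq_add_cos_sq φ]
  have h3 : z ^ M = Complex.exp ((M * θ : ℝ) * I) := by
    rw [hz, ← Complex.exp_nat_mul]; push_cast; ring_nf
  have h4 : ‖z ^ M - 1‖ ^ 2 = ‖eS M θ‖ ^ 2 * ‖z - 1‖ ^ 2 := by rw [← h1, norm_mul, mul_pow]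
  rw [h3, h2, hz, h2] at h4
  rw [h4, mul_comm]
  gcongr
  linarith [one_sub_sq_div_two_le_cos (x := θ)]

theorem eS_sq (M : ℕ) (θ : ℝ) : ((‖eS M θ‖ ^ 2 : ℝ) : ℂ) =
    ∑ m : Fin M × Fin M, Complex.exp (((m.1 : ℝ) - m.2 : ℝ) * θ * I) := by
  push_cast
  rw [← Complex.mul_conj', eS, map_sum, sum_mul_sum, Fintype.sum_prod_type]
  refine sum_congr rfl fun m _ => sum_congr rfl fun m' _ => ?_
  rw [← Complex.exp_conj, ← Complex.exp_add, map_mul, Complex.conj_ofReal, Complex.conj_I]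
  push_cast; ring_nf

noncomputable def kap (M : ℕ) (c y : ℝ) : ℝ := (‖eS M (c / M * y)‖ ^ 2 + ‖eS M (c / M * y + π / M)‖ ^ 2) / M ^ 2

theorem kap_low {M : ℕ} (hM : 0 < M) {c y : ℝ} (hc : 0 ≤ c) (hc1 : c ≤ 1) (hy : 0 ≤ y) :
    1 ≤ 4 * (exp y * kap M c y) := by
  have hM0 : (0 : ℝ) < M := by exact_mod_cast hM
  have h1 := eS_low M (c / M * y)
  have h2 := eS_low M (c / M * y + π / M)
  have e1 : M * (c / M * y) = c * y := by field_simp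
  have e2 : M * (c / M * y + π / M) = c * y + π := by field_simp
  rw [e2, cos_add_pi] at h2
  rw [e1] at h1
  set A := ‖eS M (c / M * y)‖ ^ 2 with hA
  set B := ‖eS M (c / M * y + π / M)‖ ^ 2 with hB
  have hA0 : 0 ≤ A := by positivity
  have hB0 : 0 ≤ B := by positivity
  have hcy : 0 ≤ c * y := by positivity
  have h3 : (c / M * y) ^ 2 ≤ (c / M * y + π / M) ^ 2 := by
    have := pi_pos
    gcongr; linarith [show 0 ≤ π / M by positivity]
  have h4 : 4 ≤ (c / M * y + π / M) ^ 2 * (A + B) := by nlinarith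
  have h5 : (c / M * y + π / M) ^ 2 * (A + B) = (c * y + π) ^ 2 * kap M c y := by
    unfold kap; rw [← hA, ← hB]; field_simp
  have hk : 0 ≤ kap M c y := by unfold kap; positivity
  have h6 : (c * y + π) ^ 2 ≤ 16 * exp y := by
    have h7 : (c * y + π) ^ 2 ≤ (y + 4) ^ 2 := by
      have := pi_pos
      have := pi_le_four
      gcongr; nlinarith
    nlinarith [quadratic_le_exp_of_nonneg hy]
  rw [h5] at h4
  nlinarith

theorem sum_gauss {c : ℝ} (hc : 0 < c) (M : ℕ) : ∑ m : Fin M × Fin M, exp (-c * ((m.1 : ℝ) - m.2) ^ 2) ≤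
    M * (2 / (1 - exp (-c))) := by
  have hr : exp (-c) < 1 := by simpa using hc
  have hg : ∀ s : Finset ℕ, ∑ k ∈ s, exp (-c) ^ k ≤ (1 - exp (-c))⁻¹ := fun s => by
    rw [← tsum_geometric_of_lt_one (exp_pos _).le hr]
    exact (summable_geometric_of_lt_one (exp_pos _).le hr).sum_le_tsum s fun k _ => by positivity
  have hi : ∀ (s : Finset (Fin M)) (g : Fin M → ℕ), Set.InjOn g s → ∑ k ∈ s, exp (-c) ^ (g k) ≤ (1 - exp (-c))⁻¹ :=
    fun s g h => by rw [← sum_image (f := fun k => exp (-c) ^ k) h]; exact hg _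
  rw [Fintype.sum_prod_type]
  calc _ ≤ ∑ m : Fin M, (2 / (1 - exp (-c))) := sum_le_sum fun m _ => ?_
    _ = _ := by simp
  have hle : ∀ m' : Fin M, exp (-c * ((m : ℝ) - m') ^ 2) ≤ exp (-c) ^ ((m : ℤ) - m').natAbs := by
    intro m'
    rw [← exp_nat_mul]
    refine Real.exp_le_exp.2 ?_
    have h : (((m : ℤ) - m').natAbs : ℝ) ≤ ((m : ℝ) - m') ^ 2 := by
      have h1 : ((m : ℤ) - m').natAbs ≤ ((m : ℤ) - m').natAbs ^ 2 := Nat.le_self_pow (by norm_num) _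
      have h2 : ((((m : ℤ) - m').natAbs ^ 2 : ℕ) : ℤ) = ((m : ℤ) - m') ^ 2 := by push_cast; exact sq_abs _
      have h3 : ((((m : ℤ) - m').natAbs ^ 2 : ℕ) : ℝ) = ((m : ℝ) - m') ^ 2 := by
        rw [← Int.cast_natCast, h2]; push_cast; rfl
      rw [← h3]; exact_mod_cast h1
    nlinarith
  refine (sum_le_sum fun m' _ => hle m').trans ?_
  rw [← Finset.sum_filter_add_sum_filter_not univ (fun m' : Fin M => m' ≤ m), show 2 / (1 - exp (-c)) =
    (1 - exp (-c))⁻¹ + (1 - exp (-c))⁻¹ by ring]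
  refine add_le_add (hi _ _ ?_) (hi _ _ ?_) <;>
  · intro a ha b hb hab
    simp only [coe_filter, mem_univ, true_and, Set.mem_setOf_eq, Fin.le_def] at ha hb
    beta_reduce at hab
    exact Fin.ext (by omega)

theorem PK_ag {R d : ℕ} {q n : ℝ} {w : ℂ} (hZ : Zg R q n w ≠ 0) (x : Fin d → ZMod (2 * R + 1)) :
    Zg R q n w ^ d * PK R d (ag R q n w) x =
      Complex.exp (-(1 + w) * ((∑ j, uu q n (x j).valMinAbs.natAbs : ℝ) : ℂ)) := by
  unfold PK rad ag eg
  rw [prod_mul_distrib, Finset.prod_const, card_univ, Fintype.card_fin, ← mul_assoc, ← mul_pow,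
    mul_inv_cancel₀ hZ, one_pow, one_mul, ← Complex.exp_sum]
  push_cast; rw [mul_sum]

noncomputable def TK (R d : ℕ) (S : Set (Fin d → ℤ)) (x : Fin d → ZMod (2 * R + 1)) : ℝ :=
  S.indicator (fun _ => (S.ncard : ℝ)⁻¹) fun j => (x j).valMinAbs

theorem TK_nonneg (R d : ℕ) (S : Set (Fin d → ℤ)) (x : Fin d → ZMod (2 * R + 1)) : 0 ≤ TK R d S x :=
  Set.indicator_nonneg (fun _ _ => by positivity) _

theorem ball_valid {p q : ℝ} (hp : 1 < p) (hp2 : p < 2) (hq : 1 ≤ q) : ∃ C, 1 ≤ C ∧ ∀ (R d : ℕ) (T : Type) [Fintype T]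
    (t : T → ℝ), 0 < d → (∀ i, (d : ℝ) ^ (1 + 1 / q) ≤ t i) → (∀ i, 4 * q * t i ≤ R) → 1 ≤ R →
    Valid (fun i => TK R d (LS d q (t i))) p C := by
  classical
  set p1 := (1 + p) / 2 with hp1
  have h1 : 1 < p1 := by rw [hp1]; linarith
  have h2 : p1 < p := by rw [hp1]; linarith
  have hq0 : 0 < q := by linarith
  have hB : 0 < B0 := by unfold B0; norm_num
  set ρ := (1 - 1 / p1) / 2 * ρ0 with hρ
  have hρ1 : ρ0 ≤ 1 := by unfold ρ0 B0; norm_num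
  have hρ00 := ρ0_pos
  have hpp : 1 / p1 < 1 := by rw [div_lt_one (by linarith)]; exact h1
  have hpp0 : 0 < 1 / p1 := by positivity
  have hρ0 : 0 < ρ := by rw [hρ]; exact mul_pos (by linarith) hρ00
  have hρle : ρ ≤ ρ0 := by rw [hρ]; nlinarith
  set c := ρ / 4 / 4 ^ q with hc
  have h4q : (1 : ℝ) ≤ 4 ^ q := one_le_rpow (by norm_num) hq0.le
  have hc0 : 0 < c := by positivity
  have hc4 : c * 4 ^ q = ρ / 4 := by rw [hc]; field_simp
  have hcρ : c ≤ ρ / 4 := by rw [← hc4]; nlinarith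
  obtain ⟨C0, hC0, hcard⟩ := Zr_card hq
  set c0 := exp (-4 ^ q) / (15 * B0) with hc0'
  have hc00 : 0 < c0 := by positivity
  set c1 := c0 * c ^ 2 / 4 with hc1
  have hc10 : 0 < c1 := by positivity
  have hr : exp (-c1) < 1 := by simpa using hc10
  obtain ⟨C, hC, H⟩ := engine (p1 := p1) (p := p) (Λ := 4 / ρ * (2 * q))
    (C2 := 16 * (24 * B0) + 4 + 1 / (4 * (1 / (1080 * B0) / 1296))) (Ca := 2 * C0 * (2 / (1 - exp (-c1)))) h1 h2 hp2
    (by positivity) (by have : 0 < 1 / (4 * (1 / (1080 * B0) / 1296)) := by positivity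
                        linarith) (mul_nonneg (by positivity) (div_nonneg (by norm_num) (by linarith)))
  refine ⟨4 * C, by linarith, ?_⟩
  intro R d T _ t hd ht htR hR
  have hd1 : (1 : ℝ) ≤ d := by exact_mod_cast hd
  set D := (d : ℝ) / q with hD
  have hD0 : 0 < D := by positivity
  set n : T → ℝ := fun i => t i / D ^ (1 / q) with hn
  have ht0 : ∀ i, 0 < t i := fun i => lt_of_lt_of_le (by positivity) (ht i)
  have hn1 : ∀ i, 1 ≤ n i := by
    intro i
    rw [hn, one_le_div (by positivity)]
    refine le_trans ?_ (ht i)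
    calc D ^ (1 / q) ≤ (d : ℝ) ^ (1 / q) := by gcongr; exact div_le_self (by positivity) hq
      _ ≤ _ := rpow_le_rpow_of_exponent_le hd1 (by linarith)
  have hnt : ∀ i, n i ≤ q * t i := by
    intro i
    rw [hn, div_le_iff₀ (by positivity), mul_right_comm]
    refine le_mul_of_one_le_left (ht0 i).le ?_
    calc (1 : ℝ) = q * q⁻¹ := (mul_inv_cancel₀ hq0.ne').symm
      _ ≤ q * D ^ (1 / q) := by
        gcongr
        calc q⁻¹ = q⁻¹ ^ (1 : ℝ) := (rpow_one _).symm
          _ ≤ q⁻¹ ^ (1 / q) := rpow_le_rpow_of_exponent_ge (by positivity) (inv_le_one_of_one_le₀ hq)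
            ((div_le_one hq0).2 hq)
          _ ≤ D ^ (1 / q) := by
            gcongr; rw [hD, div_eq_mul_inv]; exact le_mul_of_one_le_left (by positivity) hd1
  have hnR : ∀ i, 4 * n i ≤ R := fun i => by linarith [hnt i, htR i]
  have hnR2 : ∀ i, 2 * n i ≤ R := fun i => by linarith [hnR i, hn1 i]
  set M := Nat.sqrt d + 1 with hM
  have hM0 : (0 : ℝ) < M := by positivity
  have hM1 : (d : ℝ) + 1 ≤ M ^ 2 := by
    have := Nat.lt_succ_sqrt d
    rw [pow_two]; exact_mod_cast this
  have hM2 : (M : ℝ) ^ 2 ≤ 4 * d := by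
    have h3 := Nat.sqrt_le' d
    have h4 : 1 ≤ Nat.sqrt d := Nat.le_sqrt.2 (by omega)
    have : M ^ 2 ≤ 4 * d := by rw [hM]; nlinarith
    exact_mod_cast this
  set τ : Fin M × Fin M → ℝ := fun m => ((m.1 : ℝ) - m.2) * (c / M) with hτ
  have hτc : ∀ m, |τ m| ≤ c := by
    intro m
    have a1 : ((m.1 : ℕ) : ℝ) ≤ M := by exact_mod_cast m.1.2.le
    have a2 : ((m.2 : ℕ) : ℝ) ≤ M := by exact_mod_cast m.2.2.le
    have a3 : (0 : ℝ) ≤ (m.1 : ℕ) := by positivity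
    have a4 : (0 : ℝ) ≤ (m.2 : ℕ) := by positivity
    rw [hτ, abs_mul, abs_of_pos (by positivity : 0 < c / M)]
    calc |((m.1 : ℝ) - m.2)| * (c / M) ≤ M * (c / M) := by
          gcongr; exact abs_le.2 ⟨by linarith, by linarith⟩
      _ = c := by field_simp
  have hw : ∀ m, ‖(τ m * I : ℂ)‖ ≤ ρ / 4 := fun m => by
    rw [norm_mul, norm_I, mul_one, norm_real]; exact (hτc m).trans hcρ
  set V : T → ℝ := fun i => (LS d q (t i)).ncard with hV
  have hV0 : ∀ i, 0 < V i := fun i => by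
    have : (LS d q (t i)).Nonempty := ⟨0, by
      simp only [LS, Set.mem_setOf_eq, Pi.zero_apply, Int.cast_zero, abs_zero, zero_rpow hq0.ne', Finset.sum_const_zero]
      exact rpow_nonneg (ht0 i).le _⟩
    exact Nat.cast_pos.2 ((Set.ncard_pos (LS_fin hq (ht0 i).le)).2 this)
  set y : T → (Fin d → ZMod (2 * R + 1)) → ℝ := fun i x => D - ∑ j, uu q (n i) (x j).valMinAbs.natAbs with hy
  obtain ⟨oct, L, pos, hF⟩ := mkFam (R := R) (d := d) hR (T := T) (ι := Fin M × Fin M) (p1 := p1)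
    (Ca := 2 * C0 * (2 / (1 - exp (-c1)))) (Λ := 4 / ρ * (2 * q)) (c := 1 / (1080 * B0) / 1296) (C := 24 * B0)
    (by linarith) (by positivity) (by positivity) (by positivity)
    (A := fun i x => (V i)⁻¹ * (exp (y i x) * kap M c (y i x))) (n := n) hn1
    (w := fun i m => (V i : ℂ)⁻¹ * ((1 + Complex.exp (((m.1 : ℝ) - m.2 : ℝ) * (π / M : ℝ) * I)) / M ^ 2) *
      (Complex.exp ((1 + τ m * I) * D) * Zg R q (n i) (τ m * I) ^ d))
    (W := fun m => 2 / M ^ 2 * (C0 * M) * exp (-c1 * ((m.1 : ℝ) - m.2) ^ 2))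
    (a := fun i m => ag R q (n i) (τ m * I))
    (fun i x => by have := hV0 i; unfold kap; positivity)
    (fun i x => by
      unfold kap
      push_cast
      have e1 := eS_sq M (c / M * y i x)
      have e2 := eS_sq M (c / M * y i x + π / M)
      push_cast at e1 e2
      rw [e1, e2, ← sum_add_distrib, sum_div, mul_sum, mul_sum]
      refine sum_congr rfl fun m _ => ?_
      have e3 := PK_ag (Zg_ne hq (hn1 i) (hnR2 i) ((hw m).trans (by linarith))) x
      rw [mul_assoc _ (_ * _) (PK _ _ _ _), mul_assoc (Complex.exp ((1 + _) * _)), e3, ← Complex.exp_add]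
      have e4 : Complex.exp ((1 + τ m * I) * D + -(1 + τ m * I) * ((∑ j, uu q (n i) (x j).valMinAbs.natAbs : ℝ) : ℂ))
          = Complex.exp (y i x) * Complex.exp (((m.1 : ℝ) - m.2 : ℝ) * (c / M * y i x) * I) := by
        rw [← Complex.exp_add]; congr 1; rw [hy, hτ]; push_cast; ring
      rw [e4, mul_add _ _ ((π : ℂ) / M), add_mul _ _ I, Complex.exp_add]
      push_cast; ring)
    (fun i m => by
      have hVi := hV0 i
      rw [norm_mul, norm_mul, norm_mul, norm_inv, norm_div, norm_pow, norm_pow, norm_real, Complex.norm_natCast,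
        norm_of_nonneg hVi.le, norm_exp]
      have b1 : ‖1 + Complex.exp (((m.1 : ℝ) - m.2 : ℝ) * (π / M : ℝ) * I)‖ ≤ 2 := by
        rw [← Complex.ofReal_mul]
        refine (norm_add_le _ _).trans ?_
        rw [norm_exp_ofReal_mul_I, norm_one]; norm_num
      have b2 : ((1 + τ m * I) * D).re = D := by simp
      have b3 := Zg_le hq (hn1 i) (hnR i) (τ := τ m) (by
        refine (mul_le_mul_of_nonneg_right (hτc m) (by positivity)).trans ?_
        rw [hc4]; linarith)
      have b4 : exp D * ‖Zg R q (n i) (τ m * I)‖ ^ d ≤ C0 * M * V i * exp (-c1 * ((m.1 : ℝ) - m.2) ^ 2) := by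
        have hZ0 : 0 ≤ Zr R q (n i) := by unfold Zr; positivity
        calc exp D * ‖Zg R q (n i) (τ m * I)‖ ^ d ≤ exp D * (Zr R q (n i) * exp (-c0 * τ m ^ 2)) ^ d := by
              gcongr
          _ = (exp D * Zr R q (n i) ^ d) * exp (d * (-c0 * τ m ^ 2)) := by rw [mul_pow, ← exp_nat_mul]; ring
          _ ≤ (C0 * √(1 + D) * V i) * exp (-c1 * ((m.1 : ℝ) - m.2) ^ 2) := by
              refine mul_le_mul (hcard R d (t i) hd (ht i)) (Real.exp_le_exp.2 ?_) (by positivity) (by positivity)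
              have e : d * (-c0 * τ m ^ 2) = -(c0 * c ^ 2 / 4 * ((m.1 : ℝ) - m.2) ^ 2) * (4 * d / M ^ 2) := by
                rw [hτ]; field_simp
              rw [e, hc1, neg_mul, neg_mul]
              refine neg_le_neg (le_mul_of_one_le_right (by positivity) ?_)
              rw [one_le_div (by positivity)]; exact hM2
          _ ≤ _ := by
              gcongr
              refine Real.sqrt_le_iff.2 ⟨hM0.le, ?_⟩
              have : D ≤ d := div_le_self (by positivity) hq
              linarith
      rw [b2]
      calc _ ≤ (V i)⁻¹ * (2 / M ^ 2) * (C0 * M * V i * exp (-c1 * ((m.1 : ℝ) - m.2) ^ 2)) := by gcongr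
        _ = _ := by field_simp)
    (fun m => by positivity)
    (by
      rw [← mul_sum]
      calc _ ≤ 2 / (M : ℝ) ^ 2 * (C0 * M) * (M * (2 / (1 - exp (-c1)))) := by
            gcongr; exact sum_gauss hc10 M
        _ = _ := by field_simp)
    (fun i m => ag_good hq (hn1 i) (hnR2 i) ((hw m).trans (by linarith)))
    (fun i m f => ag_contr h1 le_rfl (by linarith) hq (hn1 i) (hnR2 i) ((hw m).trans (by linarith)) f)
    (fun r hr1 hr2 i i' m hle _ f => ag_lip h1 hr1 hr2 hq (hn1 i) hle (hnR2 i') ((hw m).trans_lt (by linarith)) f)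
  have hval := H hF
  intro σ f hf
  have hp0 : 0 < p := by linarith
  have hA0 : ∀ i x, 0 ≤ (V i)⁻¹ * (exp (y i x) * kap M c (y i x)) := fun i x => by have := hV0 i; unfold kap; positivity
  calc _ ≤ NN p (fun x => 4 * cv (fun z => (V (σ x))⁻¹ * (exp (y (σ x) z) * kap M c (y (σ x) z))) f x) := by
        refine NN_mono' hp0 fun x => ?_
        rw [norm_of_nonneg (cv_nonneg (TK_nonneg R d _) hf x)]
        unfold cv
        rw [mul_sum]
        refine sum_le_sum fun z _ => ?_
        rw [← mul_assoc]
        refine mul_le_mul_of_nonneg_right ?_ (hf _)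
        simp only [TK, Set.indicator_apply]
        split_ifs with hz
        · have hVi := hV0 (σ x)
          have hy0 : 0 ≤ y (σ x) z := by
            rw [hy]
            have e : ∀ j, uu q (n (σ x)) (z j).valMinAbs.natAbs = |((z j).valMinAbs : ℝ)| ^ q * (D / t (σ x) ^ q) := by
              intro j
              have := ht0 (σ x)
              rw [uu, hn, Nat.cast_natAbs, Int.cast_abs, div_rpow (abs_nonneg _) (by positivity),
                div_rpow (by positivity) (by positivity), ← rpow_mul hD0.le, one_div_mul_cancel hq0.ne', rpow_one]
              field_simp
            simp only [e]
            rw [← sum_mul, sub_nonneg]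
            have hz' : ∑ j, |((z j).valMinAbs : ℝ)| ^ q ≤ t (σ x) ^ q := hz
            have htq : 0 < t (σ x) ^ q := rpow_pos_of_pos (ht0 _) _
            calc _ ≤ t (σ x) ^ q * (D / t (σ x) ^ q) := by gcongr
              _ = D := by field_simp
          have := kap_low (M := M) (by omega) hc0.le (by linarith) hy0
          calc _ = (V (σ x))⁻¹ * 1 := (mul_one _).symm
            _ ≤ (V (σ x))⁻¹ * (4 * (exp (y (σ x) z) * kap M c (y (σ x) z))) := by gcongr
            _ = _ := by ring
        · exact mul_nonneg (by norm_num) (hA0 _ _)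
    _ ≤ 4 * (C * NN p f) := by
        rw [NN_const_mul hp0]
        rw [norm_of_nonneg (by norm_num)]
        exact mul_le_mul_of_nonneg_left (hval σ f hf) (by norm_num)
    _ = _ := by ring

noncomputable def av {d : ℕ} (S : Finset (Fin d → ℤ)) (F : (Fin d → ℤ) → ℝ) (x : Fin d → ℤ) : ℝ :=
  (S.card : ℝ)⁻¹ * ∑ y ∈ S, F (x - y)

theorem av_nonneg {d : ℕ} (S : Finset (Fin d → ℤ)) {F : (Fin d → ℤ) → ℝ} (hF : ∀ x, 0 ≤ F x) (x : Fin d → ℤ) : 0 ≤ av S F x :=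
  mul_nonneg (by positivity) (sum_nonneg fun y _ => hF _)

theorem vma {R : ℕ} {k : ℤ} (h : |k| ≤ R) : ((k : ZMod (2 * R + 1))).valMinAbs = k := by
  rw [abs_le] at h
  exact (ZMod.valMinAbs_spec _ _).2 ⟨by simp, by constructor <;> push_cast <;> omega⟩

theorem transfer_lin {d : ℕ} {p B : ℝ} (hp : 1 < p) (hB : 1 ≤ B) {I : Type} (S : I → Finset (Fin d → ℤ))
    (H : ∀ (T : Type) [Fintype T] (s : T → I), ∃ R0 : ℕ, ∀ R, R0 ≤ R → Valid (fun i => TK R d (S (s i) : Set (Fin d → ℤ))) p B)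
    {F : (Fin d → ℤ) → ℝ} (hF : ∀ x, 0 ≤ F x) (X : Finset (Fin d → ℤ)) (σ : (Fin d → ℤ) → I) :
    ∃ Y : Finset (Fin d → ℤ), ∑ x ∈ X, av (S (σ x)) F x ^ p ≤ B ^ p * ∑ x ∈ Y, F x ^ p := by
  classical
  rcases X.eq_empty_or_nonempty with rfl | ⟨x0, hx0⟩
  · exact ⟨∅, by simp⟩
  obtain ⟨R0, hR0⟩ := H X (fun x => σ x)
  obtain ⟨R1, hR1⟩ : ∃ R1 : ℕ, ∀ x ∈ X, ∀ y ∈ S (σ x), ∀ j, |x j| + |y j| ≤ R1 := by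
    refine ⟨∑ x ∈ X, ∑ y ∈ S (σ x), ∑ j, (|x j| + |y j|).toNat, fun x hx y hy j => ?_⟩
    have h3 := (single_le_sum (f := fun j => (|x j| + |y j|).toNat) (fun _ _ => Nat.zero_le _) (mem_univ j)).trans
      ((single_le_sum (f := fun y => ∑ j, (|x j| + |y j|).toNat) (fun _ _ => Nat.zero_le _) hy).trans
      (single_le_sum (f := fun x => ∑ y ∈ S (σ x), ∑ j, (|x j| + |y j|).toNat) (fun _ _ => Nat.zero_le _) hx))
    have h4 := Int.self_le_toNat (|x j| + |y j|)
    exact h4.trans (by exact_mod_cast h3)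
  set R := max R0 (max R1 (∑ x ∈ X, ∑ j, (x j).natAbs)) with hR
  have hXR : ∀ x ∈ X, ∀ j, |x j| ≤ R := fun x hx j => by
    have h3 := (single_le_sum (f := fun j => (x j).natAbs) (fun _ _ => Nat.zero_le _) (mem_univ j)).trans
      (single_le_sum (f := fun x : Fin d → ℤ => ∑ j, (x j).natAbs) (fun _ _ => Nat.zero_le _) hx)
    rw [Int.abs_eq_natAbs]; exact_mod_cast h3.trans ((le_max_right _ _).trans (le_max_right _ _))
  have hSR : ∀ x ∈ X, ∀ y ∈ S (σ x), ∀ j, |x j| + |y j| ≤ R := fun x hx y hy j =>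
    (hR1 x hx y hy j).trans (by exact_mod_cast (le_max_left _ _).trans (le_max_right _ _))
  let lf : (Fin d → ZMod (2 * R + 1)) → (Fin d → ℤ) := fun z j => (z j).valMinAbs
  let cs : (Fin d → ℤ) → (Fin d → ZMod (2 * R + 1)) := fun x j => (x j : ZMod (2 * R + 1))
  have hlc : ∀ x : Fin d → ℤ, (∀ j, |x j| ≤ R) → lf (cs x) = x := fun x hx => funext fun j => vma (hx j)
  have hlinj : Function.Injective lf := fun z z' h => funext fun j => by
    have := congrFun h j
    simpa [lf] using congrArg (Int.cast (R := ZMod (2 * R + 1))) this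
  let τ : (Fin d → ZMod (2 * R + 1)) → {x // x ∈ X} := fun z => if h : lf z ∈ X then ⟨lf z, h⟩ else ⟨x0, hx0⟩
  have hv := hR0 R (le_max_left _ _) τ (fun z => F (lf z)) (fun z => hF _)
  have hp0 : 0 < p := by linarith
  have h5 := NN_sum_le_of hp0 hv
  rw [mul_rpow (by linarith) (NN_nonneg _ _), NN_pow hp0] at h5
  refine ⟨Finset.univ.image lf, ?_⟩
  rw [sum_image (hlinj.injOn)]
  simp only [norm_of_nonneg (hF _)] at h5
  refine le_trans ?_ h5
  have hci : Set.InjOn cs X := fun x hx x' hx' h => by rw [← hlc x (hXR x hx), h, hlc x' (hXR x' hx')]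
  calc ∑ x ∈ X, av (S (σ x)) F x ^ p ≤ ∑ z ∈ X.image cs, ‖cv (TK R d (S (σ (τ z).1) : Set (Fin d → ℤ)))
        (fun z => F (lf z)) z‖ ^ p := by
        rw [sum_image hci]
        refine sum_le_sum fun x hx => rpow_le_rpow (av_nonneg _ hF x) ?_ hp0.le
        have e := hlc x (hXR x hx)
        have hx' : lf (cs x) ∈ X := by rw [e]; exact hx
        have hτ : (τ (cs x)).1 = x := by simp only [τ]; rw [dif_pos hx']; exact e
        rw [hτ]
        refine le_trans ?_ (le_abs_self _)
        have hyR : ∀ y ∈ S (σ x), ∀ j, |y j| ≤ R := fun y hy j => by linarith [hSR x hx y hy j, abs_nonneg (x j)]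
        have hyi : Set.InjOn cs (S (σ x)) := fun y hy y' hy' h => by rw [← hlc y (hyR y hy), h, hlc y' (hyR y' hy')]
        unfold cv
        refine le_trans (le_of_eq ?_) (sum_le_sum_of_subset_of_nonneg (subset_univ ((S (σ x)).image cs))
          fun z _ _ => mul_nonneg (TK_nonneg _ _ _ _) (hF _))
        rw [sum_image hyi, av, mul_sum]
        refine sum_congr rfl fun y hy => ?_
        have e2 : lf (cs x - cs y) = x - y := by
          rw [← hlc (x - y) fun j => ((abs_sub (x j) (y j)).trans (hSR x hx y hy j))]
          congr 1; funext j; simp [cs]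
        have e3 : TK R d (S (σ x) : Set (Fin d → ℤ)) (cs y) = ((S (σ x)).card : ℝ)⁻¹ := by
          unfold TK
          rw [show (fun j => (cs y j).valMinAbs) = y from hlc y (hyR y hy), Set.indicator_of_mem (by exact hy), Set.ncard_coe_finset]
        simp only [e2, e3]
    _ ≤ _ := sum_le_sum_of_subset_of_nonneg (subset_univ _) fun z _ _ => by positivity

open ENNReal in
theorem transfer {d : ℕ} {r p B : ℝ} (hr : 1 < r) (hrp : r ≤ p) (hB : 1 ≤ B) {I : Type} (S : I → Finset (Fin d → ℤ))
    (hS : ∀ i, (S i).Nonempty)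
    (H : ∀ (T : Type) [Fintype T] (s : T → I), ∃ R0 : ℕ, ∀ R, R0 ≤ R → Valid (fun i => TK R d (S (s i) : Set (Fin d → ℤ))) r B)
    (f : (Fin d → ℤ) → ℂ) :
    ∑' x, (⨆ i, ENNReal.ofReal (av (S i) (fun y => ‖f y‖) x)) ^ p ≤ (ENNReal.ofReal B) ^ p * ∑' x, (‖f x‖₊ : ℝ≥0∞) ^ p := by
  classical
  have hp0 : 0 < p := by linarith
  have hr0 : 0 < r := by linarith
  rw [ENNReal.tsum_eq_iSup_sum]
  refine iSup_le fun X => ?_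
  have e0 : ∀ x, (⨆ i, ENNReal.ofReal (av (S i) (fun y => ‖f y‖) x)) ^ p =
      ⨆ σ : (Fin d → ℤ) → I, ENNReal.ofReal (av (S (σ x)) (fun y => ‖f y‖) x) ^ p := by
    intro x
    refine ((ENNReal.orderIsoRpow p hp0).map_iSup _).trans ?_
    refine le_antisymm (iSup_le fun i => le_iSup_of_le (fun _ => i) le_rfl) (iSup_le fun σ => le_iSup_of_le (σ x) le_rfl)
  rw [sum_congr rfl fun x _ => e0 x, ENNReal.finsetSum_iSup]
  swap
  · intro σ σ'
    refine ⟨fun x => if ENNReal.ofReal (av (S (σ x)) (fun y => ‖f y‖) x) ^ p ≤ ENNReal.ofReal (av (S (σ' x)) (fun y => ‖f y‖) x) ^ p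
      then σ' x else σ x, fun x => ?_⟩
    by_cases h : ENNReal.ofReal (av (S (σ x)) (fun y => ‖f y‖) x) ^ p ≤ ENNReal.ofReal (av (S (σ' x)) (fun y => ‖f y‖) x) ^ p
    · simp only [if_pos h]; exact ⟨h, le_rfl⟩
    · simp only [if_neg h]; exact ⟨le_rfl, (not_le.1 h).le⟩
  refine iSup_le fun σ => ?_
  obtain ⟨Y, hY⟩ := transfer_lin hr hB S H (F := fun y => ‖f y‖ ^ (p / r)) (fun x => by positivity) X σ
  have hav : ∀ x, 0 ≤ av (S (σ x)) (fun y => ‖f y‖) x := fun x => av_nonneg _ (fun _ => norm_nonneg _) x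
  have hmain : ∑ x ∈ X, av (S (σ x)) (fun y => ‖f y‖) x ^ p ≤ B ^ p * ∑ x ∈ Y, ‖f x‖ ^ p := by
    have e1 : ∀ x, (‖f x‖ ^ (p / r)) ^ r = ‖f x‖ ^ p := fun x => by
      rw [← rpow_mul (norm_nonneg _), div_mul_cancel₀ _ hr0.ne']
    simp only [e1] at hY
    calc _ ≤ ∑ x ∈ X, av (S (σ x)) (fun y => ‖f y‖ ^ (p / r)) x ^ r := by
          refine sum_le_sum fun x _ => ?_
          rw [← div_mul_cancel₀ p hr0.ne', rpow_mul (hav x), div_mul_cancel₀ p hr0.ne']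
          refine rpow_le_rpow (rpow_nonneg (hav x) _) ?_ hr0.le
          unfold av
          rw [mul_sum, mul_sum]
          refine rpow_arith_mean_le_arith_mean_rpow _ _ _ (fun _ _ => by positivity) ?_ (fun _ _ => norm_nonneg _)
            ((one_le_div hr0).2 hrp)
          rw [sum_const, nsmul_eq_mul, mul_inv_cancel₀]
          exact_mod_cast (Finset.card_pos.2 (hS _)).ne'
      _ ≤ B ^ r * ∑ x ∈ Y, ‖f x‖ ^ p := hY
      _ ≤ _ := by gcongr
  have h6 := ENNReal.ofReal_le_ofReal hmain
  rw [ENNReal.ofReal_mul (by positivity), ENNReal.ofReal_sum_of_nonneg (fun x _ => rpow_nonneg (hav x) _),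
    ENNReal.ofReal_sum_of_nonneg (fun x _ => by positivity), ← ENNReal.ofReal_rpow_of_nonneg (by linarith) hp0.le] at h6
  calc _ = ∑ x ∈ X, ENNReal.ofReal (av (S (σ x)) (fun y => ‖f y‖) x ^ p) :=
        sum_congr rfl fun x _ => ENNReal.ofReal_rpow_of_nonneg (hav x) hp0.le
    _ ≤ _ := h6
    _ ≤ _ := by
        gcongr
        refine le_trans (le_of_eq (sum_congr rfl fun x _ => ?_)) (ENNReal.sum_le_tsum Y)
        rw [← ENNReal.ofReal_rpow_of_nonneg (norm_nonneg _) hp0.le, ofReal_norm_eq_enorm]; rfl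

noncomputable def CB (d m : ℕ) : Finset (Fin d → ℤ) := Fintype.piFinset fun _ => Icc (-(m : ℤ)) m

theorem CB_card (d m : ℕ) : (CB d m).card = (2 * m + 1) ^ d := by
  unfold CB
  rw [Fintype.card_piFinset_const, Int.card_Icc]
  congr 1; omega

theorem PK_TK (R d m : ℕ) (x : Fin d → ZMod (2 * R + 1)) : ‖PK R d (ub m) x‖ = TK R d (CB d m : Set (Fin d → ℤ)) x := by
  classical
  unfold PK TK rad ub
  rw [norm_prod, Set.ncard_coe_finset, CB_card]
  by_cases h : ∀ j, (x j).valMinAbs.natAbs ≤ m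
  · rw [Set.indicator_of_mem]
    · rw [prod_congr rfl (g := fun _ => ((2 * m + 1 : ℝ))⁻¹) fun j _ => ?_]
      · simp
      · rw [if_pos (h j)]
        have : ((2 * m + 1 : ℂ)) = ((2 * m + 1 : ℝ) : ℂ) := by push_cast; rfl
        rw [norm_div, this, norm_real, norm_one, norm_of_nonneg (by positivity), one_div]
    · simp only [CB, mem_coe, Fintype.mem_piFinset, mem_Icc]
      intro j; have := h j; omega
  · rw [Set.indicator_of_notMem]
    · push Not at h
      obtain ⟨j, hj⟩ := h
      refine Finset.prod_eq_zero (mem_univ j) ?_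
      rw [if_neg (by omega), norm_zero]
    · simp only [CB, mem_coe, Fintype.mem_piFinset, mem_Icc]
      intro h2; apply h; intro j; have := h2 j; omega

theorem lat_cube (d : ℕ) {t : ℝ} (ht : 0 < t) : latticeSet d (qBall d ∞) t = (CB d ⌊t⌋₊ : Set (Fin d → ℤ)) := by
  ext y
  simp only [latticeSet, qBall, if_true, CB, Set.mem_setOf_eq, mem_coe, Fintype.mem_piFinset, mem_Icc,
    Pi.smul_apply, smul_eq_mul]
  refine forall_congr' fun j => ?_
  rw [abs_mul, abs_of_pos (inv_pos.2 ht), inv_mul_le_iff₀ ht, mul_one, ← Int.cast_abs, ← abs_le,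
    Int.abs_eq_natAbs, Int.cast_natCast, ← Nat.le_floor_iff ht.le]
  exact Int.ofNat_le.symm

theorem lat_ball (d : ℕ) {q : ℝ≥0∞} (hq : q ≠ ∞) (h1 : 1 ≤ q.toReal) {t : ℝ} (ht : 0 < t) :
    latticeSet d (qBall d q) t = LS d q.toReal t := by
  ext y
  simp only [latticeSet, qBall, hq, if_false, LS, Set.mem_setOf_eq, Pi.smul_apply, smul_eq_mul]
  simp only [abs_mul, abs_of_pos (inv_pos.2 ht), mul_rpow (inv_pos.2 ht).le (abs_nonneg _), inv_rpow ht.le]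
  rw [← mul_sum, inv_mul_le_iff₀ (by positivity), mul_one]

theorem disc_le {d : ℕ} {G : Set (Fin d → ℝ)} {t : ℝ} {S : Finset (Fin d → ℤ)} (h : latticeSet d G t = (S : Set (Fin d → ℤ)))
    (f : (Fin d → ℤ) → ℂ) (x : Fin d → ℤ) : (‖discAvg d G t f x‖₊ : ℝ≥0∞) ≤ ENNReal.ofReal (av S (fun y => ‖f y‖) x) := by
  unfold discAvg av
  rw [h, Set.ncard_coe_finset, Finset.tsum_subtype' S (fun y => f (x - y)), ← enorm_eq_nnnorm, ← ofReal_norm_eq_enorm]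
  apply ENNReal.ofReal_le_ofReal
  rw [norm_mul, norm_inv, Complex.norm_natCast]
  gcongr
  exact norm_sum_le _ _

theorem package (q : ℝ≥0∞) (hq : 1 ≤ q) {r : ℝ} (hr : 1 < r) (hr2 : r < 2) : ∃ B : ℝ, 1 ≤ B ∧ ∀ d : ℕ, 0 < d →
    ∃ S : {t : ℝ // (d : ℝ) ^ ((1 : ℝ) + (1 / q).toReal) ≤ t} → Finset (Fin d → ℤ),
      (∀ t, latticeSet d (qBall d q) t.1 = (S t : Set (Fin d → ℤ))) ∧ (∀ t, (S t).Nonempty) ∧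
      ∀ (T : Type) [Fintype T] (s : T → {t : ℝ // (d : ℝ) ^ ((1 : ℝ) + (1 / q).toReal) ≤ t}),
        ∃ R0 : ℕ, ∀ R, R0 ≤ R → Valid (fun i => TK R d (S (s i) : Set (Fin d → ℤ))) r B := by
  classical
  have h1t : ∀ d : ℕ, 0 < d → ∀ t : {t : ℝ // (d : ℝ) ^ ((1 : ℝ) + (1 / q).toReal) ≤ t}, 1 ≤ t.1 := fun d hd t =>
    (one_le_rpow (by exact_mod_cast hd) (by positivity)).trans t.2
  by_cases hqi : q = ∞
  · obtain ⟨B, hB, H⟩ := cube_valid hr hr2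
    refine ⟨B, hB, fun d hd => ⟨fun t => CB d ⌊t.1⌋₊, fun t => ?_, fun t => ⟨0, ?_⟩, fun T _ s => ?_⟩⟩
    · have := lat_cube d (by linarith [h1t d hd t] : 0 < t.1)
      rwa [← hqi] at this
    · simp [CB]
    · refine ⟨∑ i, ⌊(s i).1⌋₊ + 1, fun R hR => ?_⟩
      have := H R d T (fun i => ⌊(s i).1⌋₊) (fun i => Nat.le_floor (by simpa using h1t d hd (s i)))
        (fun i => ?_) (by omega)
      · simpa only [PK_TK] using this
      · have := single_le_sum (f := fun i => ⌊(s i).1⌋₊) (fun _ _ => Nat.zero_le _) (mem_univ i)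
        omega
  · have hq1 : 1 ≤ q.toReal := by
      rw [← ENNReal.toReal_one]; exact ENNReal.toReal_mono hqi hq
    obtain ⟨B, hB, H⟩ := ball_valid hr hr2 hq1
    refine ⟨B, hB, fun d hd => ⟨fun t => (LS_fin hq1 (by linarith [h1t d hd t] : (0 : ℝ) ≤ t.1) : (LS d q.toReal t.1).Finite).toFinset, fun t => ?_, fun t => ⟨0, ?_⟩, fun T _ s => ?_⟩⟩
    · rw [Set.Finite.coe_toFinset]; exact lat_ball d hqi hq1 (by linarith [h1t d hd t])
    · have := h1t d hd t
      rw [Set.Finite.mem_toFinset]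
      simp only [LS, Set.mem_setOf_eq, Pi.zero_apply, Int.cast_zero, abs_zero]
      rw [zero_rpow (by linarith)]; simp; positivity
    · have h0 : ∀ i, 0 ≤ 4 * q.toReal * (s i).1 := fun i => by have := h1t d hd (s i); positivity
      refine ⟨∑ i, ⌈4 * q.toReal * (s i).1⌉₊ + 1, fun R hR => ?_⟩
      have := H R d T (fun i => (s i).1) hd (fun i => ?_) (fun i => ?_) (by omega)
      · simpa only [Set.Finite.coe_toFinset] using this
      · refine le_trans (le_of_eq ?_) (s i).2
        rw [ENNReal.toReal_div, ENNReal.toReal_one]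
      · have := single_le_sum (f := fun i => ⌈4 * q.toReal * (s i).1⌉₊) (fun _ _ => Nat.zero_le _) (mem_univ i)
        refine (Nat.le_ceil _).trans ?_
        exact_mod_cast (by omega : ⌈4 * q.toReal * (s i).1⌉₊ ≤ R)

theorem av_le_sup {d : ℕ} (S : Finset (Fin d → ℤ)) (hS : S.Nonempty) (f : (Fin d → ℤ) → ℂ) (x : Fin d → ℤ) :
    ENNReal.ofReal (av S (fun y => ‖f y‖) x) ≤ ⨆ y, nnC f y := by
  by_contra h
  push Not at h
  have hlt : ∀ y ∈ S, ‖f (x - y)‖ < av S (fun y => ‖f y‖) x := fun y _ => by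
    by_contra h2
    push Not at h2
    refine absurd ((ENNReal.ofReal_le_ofReal h2).trans ?_) (not_le.2 h)
    rw [ofReal_norm_eq_enorm]
    exact le_iSup (nnC f) (x - y)
  have h3 := Finset.sum_lt_sum_of_nonempty hS hlt
  rw [sum_const, nsmul_eq_mul] at h3
  have : (S.card : ℝ) ≠ 0 := by exact_mod_cast (Finset.card_pos.2 hS).ne'
  unfold av at h3
  rw [mul_inv_cancel_left₀ this] at h3
  exact lt_irrefl _ h3

end Real
open Real (package disc_le av_le_sup transfer)

/-- dimension-free maximal estimates over large scales `t ≥ d^{1+1/q}` for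
the discrete Hardy–Littlewood operators over `B^q` balls, `p ∈ (1,∞]` (Corollary 2.1). -/
theorem statement8 (q p : ℝ≥0∞) (hq : 1 ≤ q) (hp : 1 < p) :
    ∃ C : ℝ, 0 < C ∧ ∀ (d : ℕ), 0 < d → ∀ f : (Fin d → ℤ) → ℂ,
      lpZ d p (nnC f) ≠ ∞ →
      lpZ d p (fun x => ⨆ t : {t : ℝ // (d : ℝ) ^ ((1 : ℝ) + (1 / q).toReal) ≤ t},
          (‖discAvg d (qBall d q) (↑t) f x‖₊ : ℝ≥0∞))
        ≤ ENNReal.ofReal C * lpZ d p (nnC f) := by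
  by_cases hpi : p = ∞
  · obtain ⟨B, hB, H⟩ := package q hq (r := 3 / 2) (by norm_num) (by norm_num)
    refine ⟨B, by linarith, fun d hd f _ => ?_⟩
    obtain ⟨S, h1, h2, _⟩ := H d hd
    simp only [lpZ, hpi, if_true]
    refine le_trans (iSup_le fun x => iSup_le fun t => (disc_le (h1 t) f x).trans (av_le_sup _ (h2 t) f x)) ?_
    refine le_mul_of_one_le_left (zero_le) ?_
    rw [← ENNReal.ofReal_one]; exact ENNReal.ofReal_le_ofReal hB
  · have hp1 : 1 < p.toReal := by
      rw [← ENNReal.toReal_one]; exact (ENNReal.toReal_lt_toReal (by simp) hpi).2 hp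
    have hm : 1 < min p.toReal 2 := lt_min hp1 (by norm_num)
    have hm1 := min_le_left p.toReal 2
    have hm2 := min_le_right p.toReal 2
    have hr : 1 < (1 + min p.toReal 2) / 2 := by linarith
    obtain ⟨B, hB, H⟩ := package q hq hr (by linarith)
    refine ⟨B, by linarith, fun d hd f _ => ?_⟩
    obtain ⟨S, h1, h2, h3⟩ := H d hd
    simp only [lpZ, hpi, if_false]
    have h4 := transfer hr (by linarith : _ ≤ p.toReal) hB S h2 h3 f
    have hp0 : 0 < p.toReal := by linarith
    have h5 : ∑' x, (⨆ t : {t : ℝ // (d : ℝ) ^ ((1 : ℝ) + (1 / q).toReal) ≤ t},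
          (‖discAvg d (qBall d q) (↑t) f x‖₊ : ℝ≥0∞)) ^ p.toReal ≤ ENNReal.ofReal B ^ p.toReal * ∑' x, (nnC f x) ^ p.toReal :=
      le_trans (ENNReal.tsum_le_tsum fun x => ENNReal.rpow_le_rpow (iSup_mono fun t => disc_le (h1 t) f x) hp0.le) h4
    refine (ENNReal.rpow_le_rpow h5 (by positivity : 0 ≤ 1 / p.toReal)).trans (le_of_eq ?_)
    rw [ENNReal.mul_rpow_of_nonneg _ _ (by positivity), ← ENNReal.rpow_mul, mul_one_div_cancel hp0.ne', ENNReal.rpow_one]
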